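/- Let a, b > 0 be constants with a + b < 1/2. Then there exist a constant C > 0 and a threshold N₀ such that the following holds: for all positive integers m, s, n, t with m, n ≥ N₀ and ms = nt, writing λ = s/n = t/m, if ((1+2λ)²/(4λ(1+λ)))·(1 + 5m/(6n) + 5n/(6m)) ≤ a·log n, then |log( M(m,s;n,t) / G(m,s;n,t) ) − 1/2| ≤ C·n^{−b}; in other words M(m,s;n,t) = G(m,s;n,t)·exp(1/2 + O(n^{−b})) uniformly over this range. -/

import Mathlib

open Real

/-- `M(m,s;n,t)`: the number of `m × n` matrices with nonnegative integer entries whose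
rows each sum to `s` and whose columns each sum to `t`. -/
noncomputable def matCount (m s n t : ℕ) : ℕ :=
  Nat.card {A : Fin m → Fin n → ℕ // (∀ j, ∑ k, A j k = s) ∧ (∀ k, ∑ j, A j k = t)}

/-- Good's approximation
`G(m,s;n,t) = binom(n+s−1,s)^m binom(m+t−1,t)^n / binom(mn+λmn−1, λmn)`,
where `λmn = sm = tn`. -/
noncomputable def goodG (m s n t : ℕ) : ℝ :=
  ((n + s - 1).choose s : ℝ) ^ m * ((m + t - 1).choose t : ℝ) ^ n
    / ((m * n + s * m - 1).choose (s * m) : ℝ)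

namespace Good

/-! ### The beta-binomial weights and their factorial moments -/

/-- Chu-Vandermonde in the upper form. -/
theorem sum_choose_mul_choose_sub (q : ℕ) : ∀ N p : ℕ,
    ∑ v ∈ Finset.range (N + 1), v.choose q * (N - v).choose p = (N + 1).choose (q + p + 1) := by
  intro N
  induction N with
  | zero =>
    intro p
    rcases q with _ | q <;> rcases p with _ | p <;> simp [Nat.choose]
  | succ N ih =>
    intro p
    rw [Finset.sum_range_succ]
    rcases p with _ | p
    · have h0 := ih 0
      simp only [Nat.choose_zero_right, mul_one, add_zero] at h0 ⊢
      rw [h0, Nat.choose_succ_succ (N + 1) q]; ring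
    · have h1 : ∀ v ∈ Finset.range (N + 1), v.choose q * (N + 1 - v).choose (p + 1)
          = v.choose q * (N - v).choose p + v.choose q * (N - v).choose (p + 1) := by
        intro v hv
        have : N + 1 - v = (N - v) + 1 := by
          have := Finset.mem_range.1 hv; omega
        rw [this, Nat.choose_succ_succ]; ring
      rw [Finset.sum_congr rfl h1, Finset.sum_add_distrib, ih, ih]
      simp only [Nat.sub_self, Nat.choose_zero_succ, mul_zero, add_zero]
      rw [show q + (p + 1) + 1 = (q + p + 1) + 1 by ring, Nat.choose_succ_succ (N + 1)]

/-- Probability that one of `j + 2` parts of a uniformly random weak composition of `c`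
equals `v`. -/
noncomputable def bbw (j c v : ℕ) : ℝ :=
  ((c - v + j).choose j : ℝ) / ((c + j + 1).choose (j + 1) : ℝ)

/-- `fm i c q` is the `q`-th binomial moment of a part of a uniformly random weak composition of
`c` into `i + 1` parts. -/
noncomputable def fm (i c q : ℕ) : ℝ :=
  ((c + i).choose (i + q) : ℝ) / ((c + i).choose i : ℝ)

theorem bbw_nonneg (j c v : ℕ) : 0 ≤ bbw j c v := by unfold bbw; positivity

theorem fm_nonneg (i c q : ℕ) : 0 ≤ fm i c q := by unfold fm; positivity

theorem fm_zero (i c : ℕ) : fm i c 0 = 1 := by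
  unfold fm
  have : 0 < (c + i).choose i := Nat.choose_pos (by omega)
  rw [add_zero, div_self]; positivity

theorem bbw_mul_fm (j c v r : ℕ) :
    bbw j c v * fm j (c - v) r
      = ((c - v + j).choose (j + r) : ℝ) / ((c + j + 1).choose (j + 1) : ℝ) := by
  unfold bbw fm
  have : 0 < (c - v + j).choose j := Nat.choose_pos (by omega)
  have h2 : ((c - v + j).choose j : ℝ) ≠ 0 := by positivity
  have : 0 < (c + j + 1).choose (j + 1) := Nat.choose_pos (by omega)
  have h3 : ((c + j + 1).choose (j + 1) : ℝ) ≠ 0 := by positivity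
  field_simp

/-- Conditional binomial moments average to binomial moments. -/
theorem sum_bbw_choose_fm (j c q r : ℕ) :
    ∑ v ∈ Finset.range (c + 1), bbw j c v * ((v.choose q : ℝ) * fm j (c - v) r)
      = fm (j + 1) c (q + r) := by
  have h1 : ∀ v ∈ Finset.range (c + 1), bbw j c v * ((v.choose q : ℝ) * fm j (c - v) r)
      = ((v.choose q * (c + j - v).choose (j + r) : ℕ) : ℝ)
        / ((c + j + 1).choose (j + 1) : ℝ) := by
    intro v hv
    have : c - v + j = c + j - v := by
      have := Finset.mem_range.1 hv; omega
    rw [show bbw j c v * ((v.choose q : ℝ) * fm j (c - v) r)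
      = (v.choose q : ℝ) * (bbw j c v * fm j (c - v) r) by ring, bbw_mul_fm, this]
    push_cast; ring
  rw [Finset.sum_congr rfl h1, ← Finset.sum_div, ← Nat.cast_sum]
  have h2 : ∑ v ∈ Finset.range (c + 1), v.choose q * (c + j - v).choose (j + r)
      = ∑ v ∈ Finset.range (c + j + 1), v.choose q * (c + j - v).choose (j + r) := by
    apply Finset.sum_subset
    · intro v; simp only [Finset.mem_range]; omega
    · intro v hv hv'
      simp only [Finset.mem_range] at hv hv'
      rw [Nat.choose_eq_zero_of_lt (n := c + j - v) (by omega), mul_zero]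
  rw [h2, sum_choose_mul_choose_sub]
  unfold fm
  congr 3
  ring

theorem sum_bbw (j c : ℕ) : ∑ v ∈ Finset.range (c + 1), bbw j c v = 1 := by
  have := sum_bbw_choose_fm j c 0 0
  simpa [fm_zero] using this

theorem sum_bbw_choose (j c q : ℕ) :
    ∑ v ∈ Finset.range (c + 1), bbw j c v * (v.choose q : ℝ) = fm (j + 1) c q := by
  have := sum_bbw_choose_fm j c q 0
  simpa [fm_zero] using this

theorem fm_succ (i c q : ℕ) (h : q ≤ c) :
    fm i c (q + 1) = fm i c q * (((c : ℝ) - q) / (i + 1 + q)) := by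
  unfold fm
  have h1 := Nat.choose_succ_right_eq (c + i) (i + q)
  have h2 : c + i - (i + q) = c - q := by omega
  rw [h2] at h1
  have h3 : ((c + i).choose (i + (q + 1)) : ℝ) * (i + 1 + q)
      = (c + i).choose (i + q) * ((c : ℝ) - q) := by
    have := congrArg (Nat.cast (R := ℝ)) h1
    push_cast [Nat.cast_sub h] at this
    rw [show i + (q + 1) = i + q + 1 by ring]
    linarith
  have h4 : ((i : ℝ) + 1 + q) ≠ 0 := by positivity
  have : 0 < (c + i).choose i := Nat.choose_pos (by omega)
  have h5 : ((c + i).choose i : ℝ) ≠ 0 := by positivity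
  field_simp
  linarith

theorem fm_eq_zero (i c q : ℕ) (h : c < q) : fm i c q = 0 := by
  unfold fm
  rw [Nat.choose_eq_zero_of_lt (by omega)]; simp

theorem fm_succ_le (i c q : ℕ) : fm i c (q + 1) ≤ (c : ℝ) / (i + 1) * fm i c q := by
  by_cases h : q ≤ c
  · rw [fm_succ i c q h, mul_comm]
    apply mul_le_mul_of_nonneg_right _ (fm_nonneg _ _ _)
    have hq := (Nat.cast_nonneg q : (0 : ℝ) ≤ q)
    apply div_le_div₀ (by positivity) (by linarith) (by positivity) (by linarith)
  · rw [fm_eq_zero i c (q + 1) (by omega), fm_eq_zero i c q (by omega)]; simp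

theorem fm_le_pow (i c q : ℕ) : fm i c q ≤ ((c : ℝ) / (i + 1)) ^ q := by
  induction q with
  | zero => simp [fm_zero]
  | succ q ih =>
    refine (fm_succ_le i c q).trans ?_
    rw [pow_succ, mul_comm]
    gcongr

theorem fm_one (i c : ℕ) : fm i c 1 = (c : ℝ) / (i + 1) := by
  rw [fm_succ i c 0 (Nat.zero_le _), fm_zero]; simp

theorem fm_two (i c : ℕ) : fm i c 2 = (c : ℝ) / (i + 1) * (((c : ℝ) - 1) / (i + 2)) := by
  rcases Nat.eq_zero_or_pos c with rfl | h
  · rw [fm_eq_zero _ _ _ (by norm_num)]; simp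
  · rw [fm_succ i c 1 h, fm_one]
    congr 2 <;> push_cast <;> ring

/-- Lower bound for the binomial moments. -/
theorem le_fm_pow (i c r : ℕ) (h : r ≤ c) :
    (((c : ℝ) - r) / (i + r)) ^ r ≤ fm i c r := by
  have key : ∀ q ≤ r, (((c : ℝ) - r) / (i + r)) ^ q ≤ fm i c q := by
    intro q
    induction q with
    | zero => intro _; simp [fm_zero]
    | succ q ih =>
      intro hq
      rw [fm_succ i c q (by omega), pow_succ]
      have hcr : (0 : ℝ) ≤ (c : ℝ) - r := by
        rw [sub_nonneg]; exact_mod_cast h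
      have hqr : ((q : ℝ) + 1) ≤ r := by exact_mod_cast hq
      have hr : (0 : ℝ) < r := by linarith [(Nat.cast_nonneg q : (0 : ℝ) ≤ q)]
      apply mul_le_mul (ih (by omega)) _ (by positivity) (fm_nonneg _ _ _)
      have hq0 := (Nat.cast_nonneg q : (0 : ℝ) ≤ q)
      apply div_le_div₀ (by linarith) (by linarith) (by positivity) (by linarith)
  exact key r le_rfl

/-! ### Expectation under the weights -/

/-- Expectation of `h` under the weights `bbw j c`. -/
noncomputable def EE (j c : ℕ) (h : ℕ → ℝ) : ℝ :=
  ∑ v ∈ Finset.range (c + 1), bbw j c v * h v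

theorem EE_mono {j c : ℕ} {h h' : ℕ → ℝ} (hh : ∀ v ≤ c, h v ≤ h' v) : EE j c h ≤ EE j c h' := by
  unfold EE
  apply Finset.sum_le_sum
  intro v hv
  exact mul_le_mul_of_nonneg_left (hh v (by simpa [Nat.lt_succ_iff] using hv)) (bbw_nonneg _ _ _)

theorem EE_nonneg {j c : ℕ} {h : ℕ → ℝ} (hh : ∀ v ≤ c, 0 ≤ h v) : 0 ≤ EE j c h := by
  unfold EE
  apply Finset.sum_nonneg
  intro v hv
  exact mul_nonneg (bbw_nonneg _ _ _) (hh v (by simpa [Nat.lt_succ_iff] using hv))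

theorem EE_congr {j c : ℕ} {h h' : ℕ → ℝ} (hh : ∀ v ≤ c, h v = h' v) : EE j c h = EE j c h' := by
  unfold EE
  apply Finset.sum_congr rfl
  intro v hv
  rw [hh v (by simpa [Nat.lt_succ_iff] using hv)]

theorem EE_add (j c : ℕ) (h h' : ℕ → ℝ) :
    EE j c (fun v => h v + h' v) = EE j c h + EE j c h' := by
  unfold EE; rw [← Finset.sum_add_distrib]; apply Finset.sum_congr rfl; intros; ring

theorem EE_sub (j c : ℕ) (h h' : ℕ → ℝ) :
    EE j c (fun v => h v - h' v) = EE j c h - EE j c h' := by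
  unfold EE; rw [← Finset.sum_sub_distrib]; apply Finset.sum_congr rfl; intros; ring

theorem EE_mul_left (j c : ℕ) (a : ℝ) (h : ℕ → ℝ) :
    EE j c (fun v => a * h v) = a * EE j c h := by
  unfold EE; rw [Finset.mul_sum]; apply Finset.sum_congr rfl; intros; ring

theorem EE_const (j c : ℕ) (a : ℝ) : EE j c (fun _ => a) = a := by
  unfold EE; rw [← Finset.sum_mul, sum_bbw, one_mul]

theorem EE_abs_le (j c : ℕ) (h : ℕ → ℝ) : |EE j c h| ≤ EE j c (fun v => |h v|) := by
  unfold EE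
  refine (Finset.abs_sum_le_sum_abs _ _).trans (le_of_eq ?_)
  apply Finset.sum_congr rfl
  intro v _
  rw [abs_mul, abs_of_nonneg (bbw_nonneg _ _ _)]

/-- Cauchy-Schwarz. -/
theorem EE_mul_sq_le (j c : ℕ) (h h' : ℕ → ℝ) :
    (EE j c (fun v => h v * h' v)) ^ 2
      ≤ EE j c (fun v => h v ^ 2) * EE j c (fun v => h' v ^ 2) := by
  unfold EE
  have := Finset.sum_mul_sq_le_sq_mul_sq (Finset.range (c + 1))
    (fun v => √(bbw j c v) * h v) (fun v => √(bbw j c v) * h' v)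
  have hs : ∀ v, √(bbw j c v) * √(bbw j c v) = bbw j c v := fun v =>
    Real.mul_self_sqrt (bbw_nonneg _ _ _)
  have e1 : ∀ v, √(bbw j c v) * h v * (√(bbw j c v) * h' v) = bbw j c v * (h v * h' v) := by
    intro v; linear_combination (h v * h' v) * hs v
  have e2 : ∀ (g : ℕ → ℝ) v, (√(bbw j c v) * g v) ^ 2 = bbw j c v * g v ^ 2 := by
    intro g v; linear_combination (g v ^ 2) * hs v
  simpa only [e1, e2] using this

theorem EE_choose (j c q : ℕ) : EE j c (fun v => (v.choose q : ℝ)) = fm (j + 1) c q :=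
  sum_bbw_choose j c q

theorem EE_id (j c : ℕ) : EE j c (fun v => (v : ℝ)) = (c : ℝ) / (j + 2) := by
  have := EE_choose j c 1
  simp only [Nat.choose_one_right] at this
  rw [this, fm_one]; push_cast; ring

theorem EE_sq (j c : ℕ) :
    EE j c (fun v => (v : ℝ) ^ 2)
      = (c : ℝ) / (j + 2) + 2 * ((c : ℝ) / (j + 2) * (((c : ℝ) - 1) / (j + 3))) := by
  have h : ∀ v : ℕ, (v : ℝ) ^ 2 = (v : ℝ) + 2 * (v.choose 2 : ℝ) := by
    intro v; rw [Nat.cast_choose_two]; ring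
  rw [EE_congr (fun v _ => h v), EE_add, EE_mul_left, EE_id, EE_choose, fm_two]
  push_cast; ring

/-- The variance of the weights `bbw j c`. -/
theorem EE_var (j c : ℕ) :
    EE j c (fun v => ((v : ℝ) - (c : ℝ) / (j + 2)) ^ 2)
      = (c : ℝ) / (j + 2) * (1 + (c : ℝ) / (j + 2)) * ((j + 1) / (j + 3)) := by
  have h : ∀ v : ℕ, ((v : ℝ) - (c : ℝ) / (j + 2)) ^ 2
      = ((v : ℝ) ^ 2 - 2 * ((c : ℝ) / (j + 2)) * v) + ((c : ℝ) / (j + 2)) ^ 2 := by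
    intro v; ring
  rw [EE_congr (fun v _ => h v), EE_add, EE_sub, EE_mul_left, EE_const, EE_id, EE_sq]
  field_simp; ring

theorem EE_sub_mean (j c : ℕ) :
    EE j c (fun v => (v : ℝ) - (c : ℝ) / (j + 2)) = 0 := by
  rw [EE_sub, EE_id, EE_const, sub_self]

theorem EE_pow_four_le (j c : ℕ) :
    EE j c (fun v => (v : ℝ) ^ 4)
      ≤ (c : ℝ) / (j + 2) + 14 * ((c : ℝ) / (j + 2)) ^ 2 + 36 * ((c : ℝ) / (j + 2)) ^ 3
        + 24 * ((c : ℝ) / (j + 2)) ^ 4 := by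
  have h : ∀ v : ℕ, (v : ℝ) ^ 4 = (v.choose 1 : ℝ) + 14 * (v.choose 2 : ℝ)
      + 36 * (v.choose 3 : ℝ) + 24 * (v.choose 4 : ℝ) := by
    intro v
    rw [Nat.cast_choose_eq_descPochhammer_div ℝ v 3, Nat.cast_choose_eq_descPochhammer_div ℝ v 4,
      Nat.cast_choose_two, Nat.choose_one_right]
    simp [Nat.factorial, descPochhammer]
    ring
  rw [EE_congr (fun v _ => h v), EE_add, EE_add, EE_add, EE_mul_left, EE_mul_left, EE_mul_left]
  simp only [EE_choose]
  have h1 := fm_le_pow (j + 1) c 1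
  have h2 := fm_le_pow (j + 1) c 2
  have h3 := fm_le_pow (j + 1) c 3
  have h4 := fm_le_pow (j + 1) c 4
  have e : ((j + 1 : ℕ) : ℝ) + 1 = j + 2 := by push_cast; ring
  rw [e] at h1 h2 h3 h4
  linarith

end Good

namespace Good

/-! ### Pointwise bounds for the weights -/

theorem bbw_zero (j c : ℕ) : bbw j c 0 = ((j : ℝ) + 1) / (c + j + 1) := by
  unfold bbw
  have h := Nat.add_one_mul_choose_eq (c + j) j
  have h1 : 0 < (c + j + 1).choose (j + 1) := Nat.choose_pos (by omega)
  have h2 : ((c + j + 1).choose (j + 1) : ℝ) ≠ 0 := by positivity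
  rw [Nat.sub_zero, div_eq_div_iff h2 (by positivity)]
  have := congrArg (Nat.cast (R := ℝ)) h
  push_cast at this
  linarith

theorem bbw_le_zero (j c v : ℕ) : bbw j c v ≤ bbw j c 0 := by
  unfold bbw
  gcongr
  simp

theorem bbw_succ_le (j c v : ℕ) : bbw j c (v + 1) ≤ bbw j c v := by
  unfold bbw
  gcongr
  simp

theorem bbw_zero_le (j c : ℕ) : bbw j c 0 ≤ 1 / (1 + (c : ℝ) / (j + 2)) := by
  rw [bbw_zero, div_le_div_iff₀ (by positivity) (by positivity)]
  have : (0 : ℝ) ≤ c := Nat.cast_nonneg c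
  have hj : (0 : ℝ) ≤ j := Nat.cast_nonneg j
  have e : ((j : ℝ) + 1) * (1 + (c : ℝ) / (j + 2)) = j + 1 + c * ((j + 1) / (j + 2)) := by
    field_simp
  rw [e]
  have : ((j : ℝ) + 1) / (j + 2) ≤ 1 := by rw [div_le_one (by positivity)]; linarith
  nlinarith

theorem le_bbw_zero (j c : ℕ) : 1 / (2 * (1 + (c : ℝ) / (j + 2))) ≤ bbw j c 0 := by
  rw [bbw_zero, div_le_div_iff₀ (by positivity) (by positivity)]
  have hc : (0 : ℝ) ≤ c := Nat.cast_nonneg c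
  have hj : (0 : ℝ) ≤ j := Nat.cast_nonneg j
  have e : ((j : ℝ) + 1) * (2 * (1 + (c : ℝ) / (j + 2)))
      = 2 * (j + 1) + c * (2 * (j + 1) / (j + 2)) := by
    field_simp
  rw [e]
  have : 1 ≤ 2 * ((j : ℝ) + 1) / (j + 2) := by rw [le_div_iff₀ (by positivity)]; linarith
  nlinarith

theorem bbw_one (j c : ℕ) (hc : 1 ≤ c) : bbw j c 1 * (c + j) = bbw j c 0 * c := by
  unfold bbw
  obtain ⟨d, rfl⟩ := Nat.exists_eq_add_of_le' hc
  have h := Nat.add_one_mul_choose_eq (d + j) d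
  have h0 : (d + 1 - 1 + j).choose j = (d + j).choose d := by
    rw [Nat.add_sub_cancel, Nat.choose_symm_add]
  have h1 : (d + 1 - 0 + j).choose j = (d + j + 1).choose (d + 1) := by
    rw [Nat.sub_zero, ← Nat.choose_symm_add]; congr 1; ring
  rw [h0, h1]
  have := congrArg (Nat.cast (R := ℝ)) h
  push_cast at this ⊢
  have h1 : 0 < (d + 1 + j + 1).choose (j + 1) := Nat.choose_pos (by omega)
  have h2 : ((d + 1 + j + 1).choose (j + 1) : ℝ) ≠ 0 := by positivity
  field_simp
  linarith

theorem bbw_zero_mul_one (j c : ℕ) (hc : 1 ≤ c) :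
    (c : ℝ) / (j + 2) * (1 + (c : ℝ) / (j + 2)) / (4 * (1 + (c : ℝ) / (j + 2)) ^ 4)
      ≤ bbw j c 0 * bbw j c 1 := by
  have h0 := le_bbw_zero j c
  have h1 := bbw_one j c hc
  have hc' : (1 : ℝ) ≤ c := by exact_mod_cast hc
  have hj : (0 : ℝ) ≤ j := Nat.cast_nonneg j
  have h2 : bbw j c 1 = bbw j c 0 * (c / (c + j)) := by
    field_simp; linarith
  have h3 : (c : ℝ) / (j + 2) / (1 + (c : ℝ) / (j + 2)) ≤ c / (c + j) := by
    rw [div_div, div_le_div_iff₀ (by positivity) (by positivity)]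
    field_simp
    linarith
  set x : ℝ := (c : ℝ) / (j + 2) with hx
  have hx0 : 0 ≤ x := by positivity
  rw [h2]
  calc x * (1 + x) / (4 * (1 + x) ^ 4) = 1 / (2 * (1 + x)) * (1 / (2 * (1 + x)) * (x / (1 + x))) := by
        field_simp; ring
    _ ≤ _ := by
        have := bbw_nonneg j c 0
        gcongr

/-! ### The characteristic function of the weights -/

/-- Characteristic function of the weights `bbw j c`. -/
noncomputable def chi (j c : ℕ) (θ : ℝ) : ℂ :=
  ∑ v ∈ Finset.range (c + 1), (bbw j c v : ℂ) * Complex.exp (Complex.I * θ) ^ v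

theorem norm_cexp_I (θ : ℝ) : ‖Complex.exp (Complex.I * θ)‖ = 1 := by
  rw [mul_comm]; exact Complex.norm_exp_ofReal_mul_I θ

theorem norm_chi_le_one (j c : ℕ) (θ : ℝ) : ‖chi j c θ‖ ≤ 1 := by
  unfold chi
  refine (norm_sum_le _ _).trans ?_
  rw [← sum_bbw j c]
  apply Finset.sum_le_sum
  intro v _
  rw [norm_mul, norm_pow, norm_cexp_I, one_pow, mul_one, Complex.norm_real, Real.norm_eq_abs,
    abs_of_nonneg (bbw_nonneg _ _ _)]

/-- `1 - |χ(θ)|²` as a double sum. -/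
theorem one_sub_norm_chi_sq (j c : ℕ) (θ : ℝ) :
    1 - ‖chi j c θ‖ ^ 2 = ∑ u ∈ Finset.range (c + 1), ∑ v ∈ Finset.range (c + 1),
      bbw j c u * bbw j c v * (1 - Real.cos (((u : ℝ) - v) * θ)) := by
  have h1 : ∑ u ∈ Finset.range (c + 1), ∑ v ∈ Finset.range (c + 1), bbw j c u * bbw j c v = 1 := by
    rw [← Finset.sum_mul_sum, sum_bbw, one_mul]
  have h2 : ‖chi j c θ‖ ^ 2 = ∑ u ∈ Finset.range (c + 1), ∑ v ∈ Finset.range (c + 1),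
      bbw j c u * bbw j c v * Real.cos (((u : ℝ) - v) * θ) := by
    have hre : (chi j c θ).re = ∑ v ∈ Finset.range (c + 1), bbw j c v * Real.cos (v * θ) := by
      unfold chi
      rw [Complex.re_sum]
      apply Finset.sum_congr rfl
      intro v _
      rw [Complex.re_ofReal_mul, ← Complex.exp_nat_mul,
        show (v : ℂ) * (Complex.I * θ) = ((v * θ : ℝ) : ℂ) * Complex.I by push_cast; ring,
        Complex.exp_ofReal_mul_I_re]
    have him : (chi j c θ).im = ∑ v ∈ Finset.range (c + 1), bbw j c v * Real.sin (v * θ) := by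
      unfold chi
      rw [Complex.im_sum]
      apply Finset.sum_congr rfl
      intro v _
      rw [Complex.im_ofReal_mul, ← Complex.exp_nat_mul,
        show (v : ℂ) * (Complex.I * θ) = ((v * θ : ℝ) : ℂ) * Complex.I by push_cast; ring,
        Complex.exp_ofReal_mul_I_im]
    rw [Complex.sq_norm, Complex.normSq_apply, hre, him, Finset.sum_mul_sum, Finset.sum_mul_sum,
      ← Finset.sum_add_distrib]
    apply Finset.sum_congr rfl
    intro u _
    rw [← Finset.sum_add_distrib]
    apply Finset.sum_congr rfl
    intro v _
    rw [sub_mul, Real.cos_sub]; ring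
  rw [h2]
  nth_rewrite 1 [← h1]
  rw [← Finset.sum_sub_distrib]
  apply Finset.sum_congr rfl
  intro u _
  rw [← Finset.sum_sub_distrib]
  apply Finset.sum_congr rfl
  intro v _
  ring

theorem one_sub_norm_chi_sq_double (j c : ℕ) (θ : ℝ) :
    1 - ‖chi j c (2 * θ)‖ ^ 2 ≤ 4 * (1 - ‖chi j c θ‖ ^ 2) := by
  rw [one_sub_norm_chi_sq, one_sub_norm_chi_sq, Finset.mul_sum]
  apply Finset.sum_le_sum
  intro u _
  rw [Finset.mul_sum]
  apply Finset.sum_le_sum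
  intro v _
  have h : 1 - Real.cos (((u : ℝ) - v) * (2 * θ)) ≤ 4 * (1 - Real.cos (((u : ℝ) - v) * θ)) := by
    rw [show ((u : ℝ) - v) * (2 * θ) = 2 * (((u : ℝ) - v) * θ) by ring, Real.cos_two_mul]
    nlinarith [Real.cos_le_one (((u : ℝ) - v) * θ), Real.neg_one_le_cos (((u : ℝ) - v) * θ)]
  have := mul_le_mul_of_nonneg_left h (mul_nonneg (bbw_nonneg j c u) (bbw_nonneg j c v))
  linarith

theorem one_sub_norm_chi_sq_ge (j c : ℕ) (hc : 1 ≤ c) (θ : ℝ) :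
    2 * (bbw j c 0 * bbw j c 1) * (1 - Real.cos θ) ≤ 1 - ‖chi j c θ‖ ^ 2 := by
  rw [one_sub_norm_chi_sq]
  have hnn : ∀ u v : ℕ, 0 ≤ bbw j c u * bbw j c v * (1 - Real.cos (((u : ℝ) - v) * θ)) := fun u v =>
    mul_nonneg (mul_nonneg (bbw_nonneg _ _ _) (bbw_nonneg _ _ _))
      (sub_nonneg.2 (Real.cos_le_one _))
  have hsub : Finset.range 2 ⊆ Finset.range (c + 1) := by
    intro v; simp only [Finset.mem_range]; omega
  refine le_trans ?_ (Finset.sum_le_sum_of_subset_of_nonneg hsub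
    (fun u _ _ => Finset.sum_nonneg (fun v _ => hnn u v)))
  refine le_trans ?_ (Finset.sum_le_sum (fun u _ =>
    Finset.sum_le_sum_of_subset_of_nonneg hsub (fun v _ _ => hnn u v)))
  simp [Finset.sum_range_succ]
  linarith

theorem norm_chi_mul_le (j c : ℕ) (θ : ℝ) :
    ‖chi j c θ‖ * ‖1 - Complex.exp (Complex.I * θ)‖ ≤ 2 * bbw j c 0 := by
  rw [← norm_mul]
  set z := Complex.exp (Complex.I * θ) with hz
  have hz1 : ‖z‖ = 1 := norm_cexp_I θ
  have key : ∀ N : ℕ, (∑ v ∈ Finset.range (N + 1), (bbw j c v : ℂ) * z ^ v) * (1 - z)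
      = bbw j c 0 - bbw j c N * z ^ (N + 1)
        - ∑ v ∈ Finset.range N, ((bbw j c v - bbw j c (v + 1) : ℝ) : ℂ) * z ^ (v + 1) := by
    intro N
    induction N with
    | zero => simp; ring
    | succ N ih =>
      rw [Finset.sum_range_succ, add_mul, ih, Finset.sum_range_succ]
      push_cast; ring
  unfold chi
  rw [← hz, key]
  have hs : ‖∑ v ∈ Finset.range c, ((bbw j c v - bbw j c (v + 1) : ℝ) : ℂ) * z ^ (v + 1)‖
      ≤ bbw j c 0 - bbw j c c := by
    refine (norm_sum_le _ _).trans ?_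
    rw [← Finset.sum_range_sub' (fun v => bbw j c v)]
    apply Finset.sum_le_sum
    intro v _
    rw [norm_mul, norm_pow, hz1, one_pow, mul_one, Complex.norm_real, Real.norm_eq_abs,
      abs_of_nonneg (sub_nonneg.2 (bbw_succ_le _ _ _))]
  refine (norm_sub_le _ _).trans ?_
  have h1 : ‖(bbw j c 0 : ℂ) - bbw j c c * z ^ (c + 1)‖ ≤ bbw j c 0 + bbw j c c := by
    refine (norm_sub_le _ _).trans ?_
    rw [norm_mul, norm_pow, hz1, one_pow, mul_one, Complex.norm_real, Complex.norm_real,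
      Real.norm_eq_abs, Real.norm_eq_abs, abs_of_nonneg (bbw_nonneg _ _ _),
      abs_of_nonneg (bbw_nonneg _ _ _)]
  linarith

theorem norm_one_sub_cexp_sq (θ : ℝ) :
    ‖1 - Complex.exp (Complex.I * θ)‖ ^ 2 = 2 * (1 - Real.cos θ) := by
  rw [mul_comm Complex.I, Complex.sq_norm, Complex.normSq_apply]
  simp only [Complex.sub_re, Complex.sub_im, Complex.one_re, Complex.one_im,
    Complex.exp_ofReal_mul_I_re, Complex.exp_ofReal_mul_I_im]
  nlinarith [Real.sin_sq_add_cos_sq θ]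

theorem two_div_pi_sq_mul_le {θ : ℝ} (h : |θ| ≤ π) : 2 / π ^ 2 * θ ^ 2 ≤ 1 - Real.cos θ := by
  have := Real.cos_le_one_sub_mul_cos_sq h
  linarith

/-- Large angles. -/
theorem norm_chi_sq_mul_le (j c : ℕ) {θ : ℝ} (h : |θ| ≤ π) :
    ‖chi j c θ‖ ^ 2 * ((c : ℝ) / (j + 2) * (1 + (c : ℝ) / (j + 2)) * θ ^ 2) ≤ π ^ 2 := by
  have h1 := norm_chi_mul_le j c θ
  have h2 := bbw_zero_le j c
  set x : ℝ := (c : ℝ) / (j + 2) with hx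
  have hx0 : 0 ≤ x := by positivity
  have h3 : ‖chi j c θ‖ ^ 2 * (2 * (1 - Real.cos θ)) ≤ (2 * (1 / (1 + x))) ^ 2 := by
    rw [← norm_one_sub_cexp_sq, ← mul_pow]
    exact pow_le_pow_left₀ (by positivity) (h1.trans (by linarith)) 2
  have h4 := two_div_pi_sq_mul_le h
  have h5 : ‖chi j c θ‖ ^ 2 * (2 * (2 / π ^ 2 * θ ^ 2)) ≤ (2 * (1 / (1 + x))) ^ 2 := by
    refine le_trans ?_ h3
    gcongr
  have h6 : ‖chi j c θ‖ ^ 2 * θ ^ 2 * (1 + x) ^ 2 ≤ π ^ 2 := by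
    have hp := Real.pi_pos
    have : ‖chi j c θ‖ ^ 2 * (2 * (2 / π ^ 2 * θ ^ 2)) * (π ^ 2 * (1 + x) ^ 2)
        ≤ (2 * (1 / (1 + x))) ^ 2 * (π ^ 2 * (1 + x) ^ 2) := by gcongr
    field_simp at this
    nlinarith
  refine le_trans ?_ h6
  have : x * (1 + x) ≤ (1 + x) ^ 2 := by nlinarith
  calc _ = ‖chi j c θ‖ ^ 2 * θ ^ 2 * (x * (1 + x)) := by ring
    _ ≤ _ := by gcongr

end Good

namespace Good

theorem one_sub_norm_chi_sq_two_pow (j c : ℕ) (θ : ℝ) (k : ℕ) :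
    1 - ‖chi j c (2 ^ k * θ)‖ ^ 2 ≤ 4 ^ k * (1 - ‖chi j c θ‖ ^ 2) := by
  induction k with
  | zero => simp
  | succ k ih =>
    have := one_sub_norm_chi_sq_double j c (2 ^ k * θ)
    rw [pow_succ (2 : ℝ), mul_comm ((2 : ℝ) ^ k) 2, mul_assoc, pow_succ (4 : ℝ)]
    linarith

/-- Uniform decay of the characteristic function. -/
theorem norm_chi_sq_le (j c : ℕ) {θ : ℝ} (h : |θ| ≤ π) :
    ‖chi j c θ‖ ^ 2
      ≤ 1 / (1 + (c : ℝ) / (j + 2) * (1 + (c : ℝ) / (j + 2)) * θ ^ 2 / 4096) := by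
  have hbig := norm_chi_sq_mul_le j c h
  set x : ℝ := (c : ℝ) / (j + 2) with hx
  have hx0 : 0 ≤ x := by positivity
  have hp := Real.pi_pos
  have hp4 := Real.pi_lt_four
  have hpi : π ^ 2 < 16 := by nlinarith
  set T : ℝ := x * (1 + x) * θ ^ 2 with hT
  have hT0 : 0 ≤ T := by positivity
  rw [le_div_iff₀ (by positivity)]
  rcases le_or_gt (2 * π ^ 2) T with hTb | hTs
  · have hTp : 0 < T := by nlinarith [sq_nonneg π, pow_pos hp 2]
    have : 2 * ‖chi j c θ‖ ^ 2 ≤ 1 := by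
      by_contra hcon
      push Not at hcon
      nlinarith [pow_pos hp 2]
    nlinarith
  · have suff : T / 4096 ≤ 1 - ‖chi j c θ‖ ^ 2 := by
      rcases hT0.eq_or_lt with h0 | hTp
      · rw [← h0]
        have := norm_chi_le_one j c θ
        have h2 : 0 ≤ ‖chi j c θ‖ := norm_nonneg _
        nlinarith
      have hxp : 0 < x := by
        rcases hx0.eq_or_lt with h0 | h0
        · rw [hT, ← h0] at hTp; simp at hTp
        · exact h0
      have hc : 1 ≤ c := by
        rcases Nat.eq_zero_or_pos c with h0 | h0
        · rw [hx, h0] at hxp; simp at hxp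
        · exact h0
      rcases le_or_gt 8 (x * (1 + x)) with hx8 | hx8
      · obtain ⟨k, hk1, hk2⟩ := exists_nat_pow_near (x := 8 * π ^ 2 / T) (y := 4)
          (by rw [le_div_iff₀ hTp]; nlinarith [pow_pos hp 2]) (by norm_num)
        rw [le_div_iff₀ hTp] at hk1
        rw [div_lt_iff₀ hTp, pow_succ (4 : ℝ)] at hk2
        have hk0 : (0 : ℝ) < 4 ^ k := by positivity
        have h44 : ((2 : ℝ) ^ k) ^ 2 = 4 ^ k := by rw [← pow_mul, mul_comm, pow_mul]; norm_num
        have hang : |2 ^ k * θ| ≤ π := by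
          apply abs_le_of_sq_le_sq _ hp.le
          rw [mul_pow, h44]
          have : 4 ^ k * θ ^ 2 * 8 ≤ 4 ^ k * θ ^ 2 * (x * (1 + x)) := by gcongr
          nlinarith
        have h1 := norm_chi_sq_mul_le j c hang
        rw [← hx, mul_pow, h44] at h1
        have h1' : ‖chi j c (2 ^ k * θ)‖ ^ 2 * (4 ^ k * T) ≤ π ^ 2 := by
          rw [hT]; linarith
        have h2 : 2 * ‖chi j c (2 ^ k * θ)‖ ^ 2 ≤ 1 := by
          by_contra hcon
          push Not at hcon
          nlinarith [pow_pos hp 2]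
        have h3 := one_sub_norm_chi_sq_two_pow j c θ k
        have h4 : 4 ^ k * (T / 4096) ≤ 4 ^ k * (1 - ‖chi j c θ‖ ^ 2) := by
          nlinarith
        exact le_of_mul_le_mul_left h4 hk0
      · have hx3 : x < 3 := by nlinarith
        have h1 := one_sub_norm_chi_sq_ge j c hc θ
        have h2 := bbw_zero_mul_one j c hc
        rw [← hx] at h2
        have h3 := two_div_pi_sq_mul_le h
        have h4 : x * (1 + x) / 1024 ≤ bbw j c 0 * bbw j c 1 := by
          refine le_trans ?_ h2
          apply div_le_div_of_nonneg_left (by positivity) (by positivity)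
          have : (1 + x) ^ 4 ≤ 4 ^ 4 := by gcongr; linarith
          linarith
        have h5 : 1 / 8 * θ ^ 2 ≤ 1 - Real.cos θ := by
          refine le_trans ?_ h3
          apply mul_le_mul_of_nonneg_right _ (sq_nonneg _)
          rw [div_le_div_iff₀ (by norm_num) (by positivity)]
          linarith
        have h6 : 2 * (x * (1 + x) / 1024) * (1 / 8 * θ ^ 2) ≤ 1 - ‖chi j c θ‖ ^ 2 := by
          have := mul_nonneg (bbw_nonneg j c 0) (bbw_nonneg j c 1)
          refine le_trans ?_ h1
          gcongr
        rw [hT]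
        linarith
    have h1 : 0 ≤ ‖chi j c θ‖ ^ 2 := by positivity
    have e : x * (1 + x) * θ ^ 2 / 4096 = T / 4096 := rfl
    nlinarith

/-! ### The generating function of the weights -/

theorem chi_eq_sum_fm (j c : ℕ) (θ : ℝ) :
    chi j c θ = ∑ q ∈ Finset.range (c + 1),
      (fm (j + 1) c q : ℂ) * (Complex.exp (Complex.I * θ) - 1) ^ q := by
  unfold chi
  set y := Complex.exp (Complex.I * θ) - 1 with hy
  have he : Complex.exp (Complex.I * θ) = y + 1 := by rw [hy]; ring
  have h1 : ∀ v ∈ Finset.range (c + 1), (bbw j c v : ℂ) * Complex.exp (Complex.I * θ) ^ v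
      = ∑ q ∈ Finset.range (c + 1), (bbw j c v : ℂ) * (v.choose q : ℂ) * y ^ q := by
    intro v hv
    rw [he, add_pow, Finset.mul_sum]
    have hsub : Finset.range (v + 1) ⊆ Finset.range (c + 1) := by
      intro q; simp only [Finset.mem_range] at *; omega
    rw [← Finset.sum_subset hsub]
    · apply Finset.sum_congr rfl
      intro q _
      simp; ring
    · intro q _ hq
      simp only [Finset.mem_range, not_lt] at hq
      rw [Nat.choose_eq_zero_of_lt (by omega)]; simp
  rw [Finset.sum_congr rfl h1, Finset.sum_comm]
  apply Finset.sum_congr rfl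
  intro q _
  rw [← Finset.sum_mul, ← sum_bbw_choose j c q]
  push_cast
  rfl

/-- The correction term measuring how far the weights are from being geometric. -/
noncomputable def corr (j c : ℕ) (y : ℂ) : ℂ :=
  ∑ q ∈ Finset.range (c + 1),
    ((fm (j + 1) c q * (q * (1 + (c : ℝ) / (j + 2)) / (j + 2 + q)) : ℝ) : ℂ) * y ^ (q + 1)

theorem chi_mul (j c : ℕ) (θ : ℝ) :
    chi j c θ * (1 - ((c : ℝ) / (j + 2) : ℝ) * (Complex.exp (Complex.I * θ) - 1))
      = 1 - corr j c (Complex.exp (Complex.I * θ) - 1) := by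
  rw [chi_eq_sum_fm]
  set y := Complex.exp (Complex.I * θ) - 1 with hy
  unfold corr
  set x : ℝ := (c : ℝ) / (j + 2) with hx
  have key : ∀ N ≤ c, (∑ q ∈ Finset.range (N + 1), (fm (j + 1) c q : ℂ) * y ^ q) * (1 - x * y)
      = 1 - (fm (j + 1) c (N + 1) : ℂ) * y ^ (N + 1)
        - ∑ q ∈ Finset.range (N + 1),
          ((fm (j + 1) c q * (q * (1 + x) / (j + 2 + q)) : ℝ) : ℂ) * y ^ (q + 1) := by
    intro N
    induction N with
    | zero =>
      intro _
      simp [fm_zero, fm_one]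
      left; rw [hx]; push_cast; ring
    | succ N ih =>
      intro hN
      rw [Finset.sum_range_succ, add_mul, ih (by omega), Finset.sum_range_succ _ (N + 1)]
      rw [fm_succ (j + 1) c (N + 1) hN]
      have h2 : fm (j + 1) c (N + 1) * (((c : ℝ) - (N + 1 : ℕ)) / ((j + 1 : ℕ) + 1 + (N + 1 : ℕ)))
          = fm (j + 1) c (N + 1) * x
            - fm (j + 1) c (N + 1) * ((N + 1 : ℕ) * (1 + x) / (j + 2 + (N + 1 : ℕ))) := by
        rw [hx]; push_cast; field_simp; ring
      rw [h2]
      push_cast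
      ring
  rw [key c le_rfl, fm_eq_zero (j + 1) c (c + 1) (by omega)]
  simp

end Good

namespace Good

/-! ### Revealing the matrix row by row -/

variable {n : ℕ}

/-- Vectors below `c` with entry sum `s`. -/
def comp (s : ℕ) (c : Fin n → ℕ) : Finset (Fin n → ℕ) :=
  (Fintype.piFinset fun k => Finset.range (c k + 1)).filter (fun v => ∑ k, v k = s)

theorem mem_comp {s : ℕ} {c v : Fin n → ℕ} : v ∈ comp s c ↔ (∀ k, v k ≤ c k) ∧ ∑ k, v k = s := by
  simp [comp, Fintype.mem_piFinset]

/-- Number of matrices with `i` rows of sum `s` and column sums `c`, computed row by row. -/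
def cnt (s : ℕ) : ℕ → (Fin n → ℕ) → ℕ
  | 0, c => if c = 0 then 1 else 0
  | i + 1, c => ∑ v ∈ comp s c, cnt s i (c - v)

/-- Matrices with row sums `s` and column sums `c`. -/
abbrev Mats (s i : ℕ) (c : Fin n → ℕ) : Type :=
  {A : Fin i → Fin n → ℕ // (∀ j, ∑ k, A j k = s) ∧ (∀ k, ∑ j, A j k = c k)}

instance finite_mats (s i : ℕ) (c : Fin n → ℕ) : Finite (Mats s i c) := by
  have : (Set.Iic (fun _ : Fin i => c)).Finite := Set.finite_Iic _
  apply Set.Finite.subset this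
  rintro A ⟨_, hA⟩ j k
  simp only
  rw [← hA k]
  exact Finset.single_le_sum (f := fun j => A j k) (fun _ _ => Nat.zero_le _) (Finset.mem_univ j)

/-- Splitting off the first row. -/
def matsSuccEquiv (s i : ℕ) (c : Fin n → ℕ) :
    Mats s (i + 1) c ≃ Σ v : {v // v ∈ comp s c}, Mats s i (c - v.1) where
  toFun A := ⟨⟨A.1 0, mem_comp.2 ⟨fun k => by
      rw [← A.2.2 k]
      exact Finset.single_le_sum (f := fun j => A.1 j k) (fun _ _ => Nat.zero_le _)
        (Finset.mem_univ 0), A.2.1 0⟩⟩,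
    ⟨fun j => A.1 j.succ, fun j => A.2.1 j.succ, fun k => by
      have := A.2.2 k
      rw [Fin.sum_univ_succ] at this
      simp only [Pi.sub_apply]
      omega⟩⟩
  invFun p := ⟨Fin.cons p.1.1 p.2.1, fun j => by
      refine Fin.cases ?_ (fun j => ?_) j
      · simpa using (mem_comp.1 p.1.2).2
      · simpa using p.2.2.1 j, fun k => by
      have h1 := p.2.2.2 k
      have h2 := (mem_comp.1 p.1.2).1 k
      rw [Fin.sum_univ_succ]
      simp only [Fin.cons_zero, Fin.cons_succ]
      simp only [Pi.sub_apply] at h1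
      omega⟩
  left_inv A := by
    apply Subtype.ext
    simp only
    exact Fin.cons_self_tail A.1
  right_inv p := by
    rcases p with ⟨⟨v, hv⟩, ⟨A, hA⟩⟩
    rfl

theorem card_mats (s : ℕ) : ∀ (i : ℕ) (c : Fin n → ℕ), Nat.card (Mats s i c) = cnt s i c := by
  intro i
  induction i with
  | zero =>
    intro c
    unfold cnt
    split_ifs with h
    · subst h
      have : Unique (Mats s 0 (0 : Fin n → ℕ)) :=
        { default := ⟨fun j => j.elim0, fun j => j.elim0, fun k => by simp⟩
          uniq := fun A => Subtype.ext (funext fun j => j.elim0) }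
      exact Nat.card_unique
    · rw [Nat.card_eq_zero]
      left
      constructor
      intro A
      apply h
      funext k
      have := A.2.2 k
      simpa using this.symm
  | succ i ih =>
    intro c
    rw [Nat.card_congr (matsSuccEquiv s i c), Nat.card_sigma]
    simp only [ih]
    rw [cnt]
    exact Finset.sum_coe_sort (comp s c) (fun v => cnt s i (c - v))

/-- Weighted sum over the possible first rows. -/
noncomputable def OP (s j : ℕ) (c : Fin n → ℕ) (Q : (Fin n → ℕ) → ℝ) : ℝ :=
  ∑ v ∈ comp s c, (∏ k, bbw j (c k) (v k)) * Q v

/-- Probability that, with independent uniformly random compositions of the column sums into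
`j + 1` parts, all row sums are `s`. -/
noncomputable def FF (s j : ℕ) (c : Fin n → ℕ) : ℝ :=
  (cnt s (j + 1) c : ℝ) / ∏ k, ((c k + j).choose j : ℝ)

theorem FF_nonneg (s j : ℕ) (c : Fin n → ℕ) : 0 ≤ FF s j c := by unfold FF; positivity

theorem FF_succ (s j : ℕ) (c : Fin n → ℕ) :
    FF s (j + 1) c = OP s j c (fun v => FF s j (c - v)) := by
  unfold FF OP
  rw [cnt]
  push_cast
  rw [Finset.sum_div]
  apply Finset.sum_congr rfl
  intro v _
  unfold bbw
  rw [Finset.prod_div_distrib]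
  have h : (∏ k, ((c k - v k + j).choose j : ℝ)) ≠ 0 := by
    apply Finset.prod_ne_zero_iff.2
    intro k _
    have : 0 < (c k - v k + j).choose j := Nat.choose_pos (by omega)
    positivity
  simp only [Pi.sub_apply]
  have e : ∀ k, ((c k + j + 1).choose (j + 1) : ℝ) = ((c k + (j + 1)).choose (j + 1) : ℝ) := by
    intro k; rfl
  simp only [e]
  have h' : (∏ k, ((c k + (j + 1)).choose (j + 1) : ℝ)) ≠ 0 := by
    apply Finset.prod_ne_zero_iff.2
    intro k _
    have : 0 < (c k + (j + 1)).choose (j + 1) := Nat.choose_pos (by omega)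
    positivity
  field_simp

theorem FF_zero (s : ℕ) (c : Fin n → ℕ) (h : ∑ k, c k = s) : FF s 0 c = 1 := by
  unfold FF
  simp only [Nat.choose_zero_right, Nat.cast_one, Finset.prod_const_one, div_one]
  rw [cnt, Finset.sum_eq_single c]
  · simp [cnt]
  · intro v hv hvc
    simp only [cnt]
    rw [if_neg]
    intro h0
    apply hvc
    funext k
    have h1 := congrFun h0 k
    have h2 := (mem_comp.1 hv).1 k
    simp only [Pi.sub_apply, Pi.zero_apply] at h1
    omega
  · intro hc
    exact absurd (mem_comp.2 ⟨fun k => le_rfl, h⟩) hc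

theorem OP_congr {s j : ℕ} {c : Fin n → ℕ} {Q Q' : (Fin n → ℕ) → ℝ}
    (h : ∀ v ∈ comp s c, Q v = Q' v) : OP s j c Q = OP s j c Q' :=
  Finset.sum_congr rfl (fun v hv => by rw [h v hv])

theorem OP_mono {s j : ℕ} {c : Fin n → ℕ} {Q Q' : (Fin n → ℕ) → ℝ}
    (h : ∀ v ∈ comp s c, Q v ≤ Q' v) : OP s j c Q ≤ OP s j c Q' :=
  Finset.sum_le_sum (fun v hv => mul_le_mul_of_nonneg_left (h v hv)
    (Finset.prod_nonneg (fun _ _ => bbw_nonneg _ _ _)))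

theorem OP_add (s j : ℕ) (c : Fin n → ℕ) (Q Q' : (Fin n → ℕ) → ℝ) :
    OP s j c (fun v => Q v + Q' v) = OP s j c Q + OP s j c Q' := by
  unfold OP; rw [← Finset.sum_add_distrib]; apply Finset.sum_congr rfl; intros; ring

theorem OP_sub (s j : ℕ) (c : Fin n → ℕ) (Q Q' : (Fin n → ℕ) → ℝ) :
    OP s j c (fun v => Q v - Q' v) = OP s j c Q - OP s j c Q' := by
  unfold OP; rw [← Finset.sum_sub_distrib]; apply Finset.sum_congr rfl; intros; ring

theorem OP_mul_left (s j : ℕ) (c : Fin n → ℕ) (a : ℝ) (Q : (Fin n → ℕ) → ℝ) :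
    OP s j c (fun v => a * Q v) = a * OP s j c Q := by
  unfold OP; rw [Finset.mul_sum]; apply Finset.sum_congr rfl; intros; ring

theorem OP_sum {ι : Type*} (s j : ℕ) (c : Fin n → ℕ) (S : Finset ι) (Q : ι → (Fin n → ℕ) → ℝ) :
    OP s j c (fun v => ∑ a ∈ S, Q a v) = ∑ a ∈ S, OP s j c (Q a) := by
  unfold OP; rw [Finset.sum_comm]; apply Finset.sum_congr rfl; intros; rw [Finset.mul_sum]

theorem OP_abs_le (s j : ℕ) (c : Fin n → ℕ) (Q : (Fin n → ℕ) → ℝ) :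
    |OP s j c Q| ≤ OP s j c (fun v => |Q v|) := by
  unfold OP
  refine (Finset.abs_sum_le_sum_abs _ _).trans (le_of_eq ?_)
  apply Finset.sum_congr rfl
  intro v _
  rw [abs_mul, abs_of_nonneg (Finset.prod_nonneg (fun _ _ => bbw_nonneg _ _ _))]

theorem OP_nonneg {s j : ℕ} {c : Fin n → ℕ} {Q : (Fin n → ℕ) → ℝ}
    (h : ∀ v ∈ comp s c, 0 ≤ Q v) : 0 ≤ OP s j c Q :=
  Finset.sum_nonneg (fun v hv => mul_nonneg (Finset.prod_nonneg (fun _ _ => bbw_nonneg _ _ _))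
    (h v hv))

/-- The entries outside one column determine the row. -/
theorem OP_one_le (s j : ℕ) (c : Fin n → ℕ) (k₀ : Fin n) :
    OP s j c (fun _ => 1) ≤ bbw j (c k₀) 0 := by
  classical
  set ω : Fin n → ℕ → ℝ := fun k v => if k = k₀ then 1 else bbw j (c k) v with hω
  set R : Fin n → Finset ℕ := fun k => if k = k₀ then {0} else Finset.range (c k + 1) with hR
  have hω0 : ∀ k v, 0 ≤ ω k v := by
    intro k v; simp only [hω]; split_ifs
    · exact zero_le_one
    · exact bbw_nonneg _ _ _
  have hprod : ∏ k, ∑ v ∈ R k, ω k v = 1 := by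
    apply Finset.prod_eq_one
    intro k _
    simp only [hω, hR]
    split_ifs
    · simp
    · exact sum_bbw _ _
  set φ : (Fin n → ℕ) → (Fin n → ℕ) := fun v => Function.update v k₀ 0 with hφ
  have hmaps : ∀ v ∈ comp s c, φ v ∈ Fintype.piFinset R := by
    intro v hv
    rw [Fintype.mem_piFinset]
    intro k
    have := (mem_comp.1 hv).1 k
    simp only [hR, hφ]
    split_ifs with h
    · subst h; simp
    · rw [Function.update_of_ne h]; simp; omega
  have hinj : Set.InjOn φ (comp s c) := by
    intro v hv w hw hvw
    have hne : ∀ k, k ≠ k₀ → v k = w k := by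
      intro k hk
      have := congrFun hvw k
      simpa [hφ, Function.update_of_ne hk] using this
    funext k
    by_cases hk : k = k₀
    · subst hk
      have h1 := (mem_comp.1 hv).2
      have h2 := (mem_comp.1 hw).2
      rw [← Finset.add_sum_erase _ _ (Finset.mem_univ k)] at h1 h2
      have h3 : ∑ x ∈ Finset.univ.erase k, v x = ∑ x ∈ Finset.univ.erase k, w x :=
        Finset.sum_congr rfl (fun x hx => hne x (Finset.ne_of_mem_erase hx))
      omega
    · exact hne k hk
  have hterm : ∀ v ∈ comp s c, (∏ k, bbw j (c k) (v k)) * 1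
      ≤ bbw j (c k₀) 0 * ∏ k, ω k (φ v k) := by
    intro v _
    rw [mul_one, ← Finset.mul_prod_erase _ _ (Finset.mem_univ k₀),
      ← Finset.mul_prod_erase _ (fun k => ω k (φ v k)) (Finset.mem_univ k₀)]
    have h1 : ω k₀ (φ v k₀) = 1 := by simp [hω]
    have h2 : ∏ k ∈ Finset.univ.erase k₀, ω k (φ v k)
        = ∏ k ∈ Finset.univ.erase k₀, bbw j (c k) (v k) := by
      apply Finset.prod_congr rfl
      intro k hk
      have := Finset.ne_of_mem_erase hk
      simp [hω, hφ, this]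
    rw [h1, h2, one_mul]
    exact mul_le_mul_of_nonneg_right (bbw_le_zero _ _ _)
      (Finset.prod_nonneg (fun _ _ => bbw_nonneg _ _ _))
  unfold OP
  refine (Finset.sum_le_sum hterm).trans ?_
  rw [← Finset.mul_sum]
  have h3 : ∑ v ∈ comp s c, ∏ k, ω k (φ v k) ≤ 1 := by
    rw [← hprod, Finset.prod_univ_sum, ← Finset.sum_image (f := fun v => ∏ k, ω k (v k)) hinj]
    apply Finset.sum_le_sum_of_subset_of_nonneg
    · intro w hw
      obtain ⟨v, hv, rfl⟩ := Finset.mem_image.1 hw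
      exact hmaps v hv
    · intro w _ _
      exact Finset.prod_nonneg (fun k _ => hω0 k _)
  calc _ ≤ bbw j (c k₀) 0 * 1 := mul_le_mul_of_nonneg_left h3 (bbw_nonneg _ _ _)
    _ = _ := mul_one _

/-! ### Fourier inversion -/

theorem integral_cexp_int (N : ℤ) :
    ∫ θ in (-π)..π, Complex.exp (Complex.I * θ) ^ N = if N = 0 then 2 * π else 0 := by
  split_ifs with h
  · subst h
    simp; ring
  · have h1 : ∀ θ : ℝ, Complex.exp (Complex.I * θ) ^ N = Complex.exp ((N * Complex.I) * θ) := by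
      intro θ
      rw [← Complex.exp_int_mul]; congr 1; ring
    have h2 : (N : ℂ) * Complex.I ≠ 0 := by simp [h]
    simp only [h1]
    rw [integral_exp_mul_complex h2]
    have h3 : Complex.exp (N * Complex.I * (π : ℝ)) = Complex.exp (N * Complex.I * ((-π : ℝ) : ℂ)) := by
      rw [Complex.exp_eq_exp_iff_exists_int]
      refine ⟨N, ?_⟩
      push_cast; ring
    rw [h3, sub_self, zero_div]
    push_cast; rfl

/-- Fourier inversion for the constraint on the row sum. -/
theorem sum_comp_prod (s : ℕ) (c : Fin n → ℕ) (ω : Fin n → ℕ → ℝ) :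
    ((∑ v ∈ comp s c, ∏ k, ω k (v k) : ℝ) : ℂ)
      = 1 / (2 * π) * ∫ θ in (-π)..π, Complex.exp (Complex.I * θ) ^ (-(s : ℤ))
        * ∏ k, ∑ v ∈ Finset.range (c k + 1), (ω k v : ℂ) * Complex.exp (Complex.I * θ) ^ v := by
  have h1 : ∀ θ : ℝ, Complex.exp (Complex.I * θ) ^ (-(s : ℤ))
        * ∏ k, ∑ v ∈ Finset.range (c k + 1), (ω k v : ℂ) * Complex.exp (Complex.I * θ) ^ v
      = ∑ v ∈ Fintype.piFinset fun k => Finset.range (c k + 1),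
        ((∏ k, ω k (v k) : ℝ) : ℂ) * Complex.exp (Complex.I * θ) ^ (((∑ k, v k : ℕ) : ℤ) - s) := by
    intro θ
    rw [Finset.prod_univ_sum, Finset.mul_sum]
    apply Finset.sum_congr rfl
    intro v _
    rw [Finset.prod_mul_distrib, Finset.prod_pow_eq_pow_sum, sub_eq_add_neg,
      zpow_add₀ (Complex.exp_ne_zero _), zpow_natCast]
    push_cast; ring
  simp only [h1]
  rw [intervalIntegral.integral_finsetSum]
  · simp only [intervalIntegral.integral_const_mul, integral_cexp_int]
    rw [comp, Finset.sum_filter, Finset.mul_sum]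
    push_cast
    apply Finset.sum_congr rfl
    intro v _
    have hp : (π : ℂ) ≠ 0 := by exact_mod_cast Real.pi_ne_zero
    by_cases h : ∑ k, v k = s
    · have h' : (∑ k, (v k : ℤ)) - (s : ℤ) = 0 := by
        have := congrArg (Nat.cast (R := ℤ)) h
        push_cast at this; omega
      rw [if_pos h, if_pos h']
      push_cast
      field_simp
    · have h' : ¬ (∑ k, (v k : ℤ)) - (s : ℤ) = 0 := by
        intro h2
        apply h
        have : ((∑ k, v k : ℕ) : ℤ) = s := by push_cast; omega
        exact_mod_cast this
      rw [if_neg h, if_neg h']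
      simp
  · intro v _
    apply Continuous.intervalIntegrable
    apply Continuous.mul continuous_const
    apply Continuous.zpow₀ (by fun_prop)
    intro θ
    exact Or.inl (Complex.exp_ne_zero _)

end Good

namespace Good

variable {n : ℕ}

/-- Centred weighted characteristic function. -/
noncomputable def psi (j c : ℕ) (h : ℕ → ℝ) (θ : ℝ) : ℂ :=
  ∑ v ∈ Finset.range (c + 1), ((bbw j c v * h v : ℝ) : ℂ)
    * Complex.exp (Complex.I * ((θ * ((v : ℝ) - (c : ℝ) / (j + 2)) : ℝ) : ℂ))

theorem continuous_psi (j c : ℕ) (h : ℕ → ℝ) : Continuous (psi j c h) := by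
  unfold psi
  fun_prop

theorem norm_psi_le (j c : ℕ) (h : ℕ → ℝ) (θ : ℝ) : ‖psi j c h θ‖ ≤ EE j c (fun v => |h v|) := by
  unfold psi EE
  refine (norm_sum_le _ _).trans (le_of_eq ?_)
  apply Finset.sum_congr rfl
  intro v _
  rw [norm_mul, norm_cexp_I, mul_one, Complex.norm_real, Real.norm_eq_abs, abs_mul,
    abs_of_nonneg (bbw_nonneg _ _ _)]

theorem psi_eq_mul (j c : ℕ) (h : ℕ → ℝ) (θ : ℝ) :
    psi j c h θ = Complex.exp (Complex.I * ((-((c : ℝ) / (j + 2) * θ) : ℝ) : ℂ))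
      * ∑ v ∈ Finset.range (c + 1), ((bbw j c v * h v : ℝ) : ℂ)
        * Complex.exp (Complex.I * θ) ^ v := by
  unfold psi
  rw [Finset.mul_sum]
  apply Finset.sum_congr rfl
  intro v _
  rw [← Complex.exp_nat_mul, mul_left_comm, ← Complex.exp_add]
  congr 2
  push_cast; ring

theorem psi_one_eq (j c : ℕ) (θ : ℝ) :
    psi j c (fun _ => 1) θ
      = Complex.exp (Complex.I * ((-((c : ℝ) / (j + 2) * θ) : ℝ) : ℂ)) * chi j c θ := by
  rw [psi_eq_mul]; simp [chi]

theorem norm_psi_one (j c : ℕ) (θ : ℝ) : ‖psi j c (fun _ => 1) θ‖ = ‖chi j c θ‖ := by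
  rw [psi_one_eq, norm_mul, norm_cexp_I, one_mul]

theorem OP_prod (s j : ℕ) (c : Fin n → ℕ) (hc : ∑ k, c k = (j + 2) * s) (h : Fin n → ℕ → ℝ) :
    ((OP s j c (fun v => ∏ k, h k (v k)) : ℝ) : ℂ)
      = 1 / (2 * π) * ∫ θ in (-π)..π, ∏ k, psi j (c k) (h k) θ := by
  have h1 : OP s j c (fun v => ∏ k, h k (v k))
      = ∑ v ∈ comp s c, ∏ k, (bbw j (c k) (v k) * h k (v k)) := by
    unfold OP; simp only [Finset.prod_mul_distrib]
  rw [h1, sum_comp_prod s c (fun k v => bbw j (c k) v * h k v)]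
  congr 2
  funext θ
  simp only [psi_eq_mul]
  rw [Finset.prod_mul_distrib]
  congr 1
  rw [← Complex.exp_sum, ← Finset.mul_sum, ← Complex.exp_int_mul]
  congr 1
  have hs : ∑ k, (c k : ℝ) / (j + 2) = s := by
    rw [← Finset.sum_div]
    have := congrArg (Nat.cast (R := ℝ)) hc
    push_cast at this
    rw [this]; field_simp
  rw [← Complex.ofReal_sum, Finset.sum_neg_distrib, ← Finset.sum_mul, hs]
  push_cast; ring

/-- Differences of products of numbers that are at most slightly larger than one. -/
theorem norm_prod_sub_prod_le {ι : Type*} (S : Finset ι) (f g : ι → ℂ) (η : ℝ) (hη : 0 ≤ η)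
    (hf : ∀ k ∈ S, ‖f k‖ ≤ 1) (hg : ∀ k ∈ S, ‖g k‖ ≤ 1 + η) :
    ‖∏ k ∈ S, f k - ∏ k ∈ S, g k‖ ≤ (1 + η) ^ S.card * ∑ k ∈ S, ‖f k - g k‖ := by
  classical
  induction S using Finset.induction_on with
  | empty => simp
  | insert a S ha ih =>
    rw [Finset.prod_insert ha, Finset.prod_insert ha, Finset.sum_insert ha,
      Finset.card_insert_of_notMem ha]
    have h1 := ih (fun k hk => hf k (Finset.mem_insert_of_mem hk))
      (fun k hk => hg k (Finset.mem_insert_of_mem hk))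
    have h2 : ‖∏ k ∈ S, f k‖ ≤ 1 := by
      rw [norm_prod]
      exact Finset.prod_le_one (fun _ _ => norm_nonneg _)
        (fun k hk => hf k (Finset.mem_insert_of_mem hk))
    have h3 : f a * ∏ k ∈ S, f k - g a * ∏ k ∈ S, g k
        = (f a - g a) * ∏ k ∈ S, f k + g a * (∏ k ∈ S, f k - ∏ k ∈ S, g k) := by ring
    rw [h3]
    refine (norm_add_le _ _).trans ?_
    rw [norm_mul, norm_mul]
    have h4 : 1 ≤ (1 + η) ^ (S.card + 1) := one_le_pow₀ (by linarith)
    have h5 := hg a (Finset.mem_insert_self _ _)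
    calc ‖f a - g a‖ * ‖∏ k ∈ S, f k‖ + ‖g a‖ * ‖∏ k ∈ S, f k - ∏ k ∈ S, g k‖
        ≤ ‖f a - g a‖ * (1 + η) ^ (S.card + 1)
          + (1 + η) * ((1 + η) ^ S.card * ∑ k ∈ S, ‖f k - g k‖) := by
          gcongr
          exact h2.trans h4
      _ = _ := by rw [pow_succ]; ring

/-! ### The geometric model -/

/-- Centred characteristic function of the geometric distribution with mean `l`. -/
noncomputable def geo (l θ : ℝ) : ℂ :=
  Complex.exp (Complex.I * ((-(l * θ) : ℝ) : ℂ)) * (1 - l * (Complex.exp (Complex.I * θ) - 1))⁻¹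

theorem norm_one_sub_geo_sq (l θ : ℝ) :
    ‖1 - l * (Complex.exp (Complex.I * θ) - 1)‖ ^ 2 = 1 + 2 * (l * (1 + l)) * (1 - Real.cos θ) := by
  rw [mul_comm Complex.I, Complex.sq_norm, Complex.normSq_apply]
  simp only [Complex.sub_re, Complex.sub_im, Complex.one_re, Complex.one_im, Complex.mul_re,
    Complex.mul_im, Complex.ofReal_re, Complex.ofReal_im,
    Complex.exp_ofReal_mul_I_re, Complex.exp_ofReal_mul_I_im]
  linear_combination l ^ 2 * (Real.sin_sq_add_cos_sq θ)

theorem one_le_norm_one_sub_geo {l : ℝ} (hl : 0 ≤ l) (θ : ℝ) :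
    1 ≤ ‖1 - l * (Complex.exp (Complex.I * θ) - 1)‖ := by
  have h := norm_one_sub_geo_sq l θ
  have h2 : 0 ≤ 2 * (l * (1 + l)) * (1 - Real.cos θ) :=
    mul_nonneg (by positivity) (sub_nonneg.2 (Real.cos_le_one _))
  by_contra hc
  nlinarith [norm_nonneg (1 - l * (Complex.exp (Complex.I * θ) - 1))]

theorem norm_geo (l θ : ℝ) : ‖geo l θ‖ = ‖1 - l * (Complex.exp (Complex.I * θ) - 1)‖⁻¹ := by
  unfold geo
  rw [norm_mul, norm_cexp_I, one_mul, norm_inv]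

theorem norm_geo_sq_le {l : ℝ} (hl : 0 ≤ l) {θ : ℝ} (h : |θ| ≤ π) :
    ‖geo l θ‖ ^ 2 ≤ 1 / (1 + l * (1 + l) * θ ^ 2 / 4096) := by
  rw [norm_geo, inv_pow, norm_one_sub_geo_sq, one_div]
  have h1 := two_div_pi_sq_mul_le h
  have h2 : 1 / 4096 * θ ^ 2 ≤ 2 * (1 - Real.cos θ) := by
    have : 1 / 8 * θ ^ 2 ≤ 2 / π ^ 2 * θ ^ 2 := by
      apply mul_le_mul_of_nonneg_right _ (sq_nonneg _)
      rw [div_le_div_iff₀ (by norm_num) (by positivity)]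
      nlinarith [Real.pi_lt_four, Real.pi_pos]
    nlinarith [sq_nonneg θ]
  apply inv_anti₀ (by positivity)
  have := mul_le_mul_of_nonneg_left h2 (show 0 ≤ l * (1 + l) by positivity)
  linarith

theorem continuous_geo {l : ℝ} (hl : 0 ≤ l) : Continuous (geo l) := by
  unfold geo
  apply Continuous.mul (by fun_prop)
  apply Continuous.inv₀ (by fun_prop)
  intro θ h
  have := one_le_norm_one_sub_geo hl θ
  rw [h] at this
  simp at this
  linarith

/-- Probability that `n` geometric variables of mean `s / n` have sum `s`. -/
noncomputable def gg (n s : ℕ) : ℝ :=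
  ((n + s - 1).choose s : ℝ) * ((s : ℝ) / n) ^ s / (1 + (s : ℝ) / n) ^ (n + s)

/-- Negative binomial expansion behind the geometric model. -/
theorem hasSum_geo_pow (N s : ℕ) (l r : ℝ) (hl0 : 0 ≤ l) (hls : ((N : ℝ) + 1) * l = s)
    (hr : r = l / (1 + l)) (θ : ℝ) :
    HasSum (fun k : ℕ => ((((k + N).choose N : ℝ) * r ^ k : ℝ) : ℂ)
      * Complex.exp (Complex.I * θ) ^ ((k : ℤ) - s))
      (((1 + l : ℝ) : ℂ) ^ (N + 1) * geo l θ ^ (N + 1)) := by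
  have hr0 : 0 ≤ r := by rw [hr]; positivity
  have hr1 : r < 1 := by rw [hr, div_lt_one (by positivity)]; linarith
  have hz1 := norm_cexp_I θ
  have hz0 := Complex.exp_ne_zero (Complex.I * θ)
  have h2 : Complex.exp (Complex.I * θ) ^ (-(s : ℤ))
      = Complex.exp (Complex.I * ((-(l * θ) : ℝ) : ℂ)) ^ (N + 1) := by
    rw [← Complex.exp_int_mul, ← Complex.exp_nat_mul]
    congr 1
    have hls' : ((N : ℂ) + 1) * l = s := by exact_mod_cast hls
    push_cast
    linear_combination (Complex.I * θ) * hls'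
  unfold geo
  generalize Complex.exp (Complex.I * θ) = z at hz1 hz0 h2 ⊢
  generalize Complex.exp (Complex.I * ((-(l * θ) : ℝ) : ℂ)) = w at h2 ⊢
  have hrz : ‖(r : ℂ) * z‖ < 1 := by
    rw [norm_mul, hz1, mul_one, Complex.norm_real, Real.norm_eq_abs, abs_of_nonneg hr0]
    exact hr1
  have h := (hasSum_choose_mul_geometric_of_norm_lt_one N hrz).mul_left (z ^ (-(s : ℤ)))
  have e1 : (fun k : ℕ => ((((k + N).choose N : ℝ) * r ^ k : ℝ) : ℂ) * z ^ ((k : ℤ) - s))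
      = fun i : ℕ => z ^ (-(s : ℤ)) * (((i + N).choose N : ℂ) * (r * z) ^ i) := by
    funext k
    rw [sub_eq_add_neg, zpow_add₀ hz0, zpow_natCast, mul_pow]
    push_cast; ring
  have hl1 : (1 + (l : ℂ)) ≠ 0 := by
    have : (1 + l) ≠ 0 := by positivity
    exact_mod_cast this
  have h1 : (1 : ℂ) - r * z = (1 - l * (z - 1)) / (1 + l) := by
    rw [hr]; push_cast; field_simp; ring
  have e2 : ((1 + l : ℝ) : ℂ) ^ (N + 1) * (w * (1 - l * (z - 1))⁻¹) ^ (N + 1)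
      = z ^ (-(s : ℤ)) * (1 / (1 - r * z) ^ (N + 1)) := by
    rw [h1, h2, mul_pow, div_pow, inv_pow]
    push_cast
    rw [one_div_div]
    ring
  rw [e1, e2]
  exact h

theorem hasSum_integral_geo_pow (N s : ℕ) (l r : ℝ) (hl0 : 0 ≤ l)
    (hls : ((N : ℝ) + 1) * l = s) (hr : r = l / (1 + l)) :
    HasSum (fun k : ℕ => ∫ θ in (-π)..π, ((((k + N).choose N : ℝ) * r ^ k : ℝ) : ℂ)
      * Complex.exp (Complex.I * θ) ^ ((k : ℤ) - s))
      (∫ θ in (-π)..π, ((1 + l : ℝ) : ℂ) ^ (N + 1) * geo l θ ^ (N + 1)) := by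
  have hr0 : 0 ≤ r := by rw [hr]; positivity
  have hr1 : r < 1 := by rw [hr, div_lt_one (by positivity)]; linarith
  apply intervalIntegral.hasSum_integral_of_dominated_convergence
    (fun k _ => ((k + N).choose N : ℝ) * r ^ k)
  · intro k
    apply Continuous.aestronglyMeasurable
    apply Continuous.mul continuous_const
    apply Continuous.zpow₀ (by fun_prop)
    intro θ
    exact Or.inl (Complex.exp_ne_zero _)
  · intro k
    refine Filter.Eventually.of_forall (fun θ _ => ?_)
    rw [norm_mul, norm_zpow, norm_cexp_I, one_zpow, mul_one, Complex.norm_real, Real.norm_eq_abs,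
      abs_of_nonneg (by positivity)]
  · refine Filter.Eventually.of_forall (fun θ _ => ?_)
    exact (hasSum_choose_mul_geometric_of_norm_lt_one N
      (by rwa [Real.norm_eq_abs, abs_of_nonneg hr0])).summable
  · simp
  · exact Filter.Eventually.of_forall (fun θ _ => hasSum_geo_pow N s l r hl0 hls hr θ)

theorem gg_eq_integral (n s : ℕ) (hn : 0 < n) :
    ((gg n s : ℝ) : ℂ) = 1 / (2 * π) * ∫ θ in (-π)..π, geo ((s : ℝ) / n) θ ^ n := by
  obtain ⟨N, rfl⟩ : ∃ N, n = N + 1 := ⟨n - 1, by omega⟩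
  unfold gg
  have hl0 : 0 ≤ (s : ℝ) / (N + 1 : ℕ) := by positivity
  have hls : ((N : ℝ) + 1) * ((s : ℝ) / (N + 1 : ℕ)) = s := by push_cast; field_simp
  generalize (s : ℝ) / (N + 1 : ℕ) = l at hl0 hls ⊢
  obtain ⟨r, hr⟩ : ∃ r, r = l / (1 + l) := ⟨_, rfl⟩
  have hInt := hasSum_integral_geo_pow N s l r hl0 hls hr
  have hval : ∀ k : ℕ, ∫ θ in (-π)..π, ((((k + N).choose N : ℝ) * r ^ k : ℝ) : ℂ)
      * Complex.exp (Complex.I * θ) ^ ((k : ℤ) - s)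
      = if k = s then ((((s + N).choose N : ℝ) * r ^ s : ℝ) : ℂ) * (2 * π) else 0 := by
    intro k
    rw [intervalIntegral.integral_const_mul, integral_cexp_int]
    by_cases h : k = s
    · subst h
      rw [if_pos rfl, if_pos (by omega)]; push_cast; ring
    · rw [if_neg h, if_neg (by omega), Complex.ofReal_zero, mul_zero]
  simp only [hval] at hInt
  have huniq := hInt.unique (hasSum_ite_eq s _)
  rw [intervalIntegral.integral_const_mul] at huniq
  have hp : (π : ℂ) ≠ 0 := by exact_mod_cast Real.pi_ne_zero
  have hl1 : (1 + (l : ℂ)) ≠ 0 := by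
    have : (1 + l) ≠ 0 := by positivity
    exact_mod_cast this
  have hI : ∫ θ in (-π)..π, geo l θ ^ (N + 1)
      = ((((s + N).choose N : ℝ) * r ^ s : ℝ) : ℂ) * (2 * π) / ((1 + l : ℝ) : ℂ) ^ (N + 1) := by
    rw [eq_div_iff (by push_cast; exact pow_ne_zero _ hl1), ← huniq]
    ring
  rw [hI]
  have hch : (N + 1 + s - 1).choose s = (s + N).choose N := by
    rw [show N + 1 + s - 1 = s + N by omega, ← Nat.choose_symm_add]
  rw [hch, hr]
  push_cast
  rw [div_pow, pow_add]
  field_simp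

end Good

namespace Good

/-! ### Expansions near the origin -/

theorem norm_exp_sub_quadratic_le {x : ℂ} (hx : ‖x‖ ≤ 1) :
    ‖Complex.exp x - (1 + x + x ^ 2 / 2)‖ ≤ ‖x‖ ^ 3 := by
  have h := Complex.exp_bound hx (n := 3) (by norm_num)
  simp only [Finset.sum_range_succ, Finset.sum_range_zero, Nat.factorial, pow_zero, pow_one,
    Nat.cast_one, Nat.cast_ofNat, div_one, zero_add] at h
  norm_num [Nat.factorial] at h
  refine h.trans ?_
  have := pow_nonneg (norm_nonneg x) 3
  linarith

theorem norm_cexp_sub_quadratic_le {θ : ℝ} (hθ : |θ| ≤ 1) :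
    ‖Complex.exp (Complex.I * θ) - 1 - (Complex.I * θ - θ ^ 2 / 2)‖ ≤ |θ| ^ 3 := by
  have h1 : ‖Complex.I * (θ : ℂ)‖ = |θ| := by simp
  have h := norm_exp_sub_quadratic_le (x := Complex.I * θ) (by rwa [h1])
  rw [h1] at h
  refine le_trans (le_of_eq ?_) h
  congr 1
  rw [mul_pow, Complex.I_sq]; ring

theorem norm_cexp_sub_one_le (θ : ℝ) : ‖Complex.exp (Complex.I * θ) - 1‖ ≤ |θ| := by
  have := Real.norm_exp_I_mul_ofReal_sub_one_le (x := θ)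
  simpa using this

theorem norm_pow_sub_one_le (r : ℂ) (n : ℕ) (ρ : ℝ) (hρ : ‖r - 1‖ ≤ ρ) (hn : n * ρ ≤ 1) :
    ‖r ^ n - 1‖ ≤ 3 * (n * ρ) := by
  have hρ0 : 0 ≤ ρ := (norm_nonneg _).trans hρ
  have h := norm_prod_sub_prod_le (Finset.range n) (fun _ => 1) (fun _ => r) ρ hρ0 (by simp)
    (fun k _ => by
      calc ‖r‖ = ‖1 + (r - 1)‖ := by ring_nf
        _ ≤ ‖(1 : ℂ)‖ + ‖r - 1‖ := norm_add_le _ _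
        _ ≤ 1 + ρ := by rw [norm_one]; linarith)
  simp only [Finset.prod_const, Finset.card_range, Finset.sum_const, nsmul_eq_mul, one_pow] at h
  rw [norm_sub_rev]
  refine h.trans ?_
  have h2 : (1 + ρ) ^ n ≤ 3 := by
    calc (1 + ρ) ^ n ≤ (Real.exp ρ) ^ n := by
          gcongr
          linarith [Real.add_one_le_exp ρ]
      _ = Real.exp (n * ρ) := by rw [← Real.exp_nat_mul]
      _ ≤ Real.exp 1 := Real.exp_le_exp.2 hn
      _ ≤ 3 := by linarith [Real.exp_one_lt_d9]
  rw [norm_sub_rev]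
  gcongr

/-- The regime of parameters: `n` columns of mean `l`, with `L` a slowly growing bound. -/
structure Reg (L : ℝ) (n : ℕ) (l : ℝ) : Prop where
  hL : (10 : ℝ) ^ 6 ≤ L
  hl : 1 ≤ L * l
  hn : L ^ 100 ≤ n
  hlog : 2 * 10 ^ 7 * Real.log n ≤ L

namespace Reg

variable {L l : ℝ} {n : ℕ}

theorem L_pos (h : Reg L n l) : 0 < L := lt_of_lt_of_le (by norm_num) h.hL

theorem l_pos (h : Reg L n l) : 0 < l := by
  have := h.hl
  have := h.L_pos
  by_contra hc
  nlinarith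

theorem one_le_L (h : Reg L n l) : 1 ≤ L := le_trans (by norm_num) h.hL

theorem n_pos (h : Reg L n l) : (0 : ℝ) < n :=
  lt_of_lt_of_le (by have := h.L_pos; positivity) h.hn

theorem A_pos (h : Reg L n l) : 0 < l * (1 + l) := by
  have := h.l_pos
  positivity

theorem a_pos (h : Reg L n l) : 0 < n * (l * (1 + l)) := mul_pos h.n_pos h.A_pos

theorem pow_le_pow (h : Reg L n l) {p q : ℕ} (hpq : p ≤ q) : L ^ p ≤ L ^ q :=
  pow_le_pow_right₀ h.one_le_L hpq

theorem one_le_pow (h : Reg L n l) (p : ℕ) : 1 ≤ L ^ p := one_le_pow₀ h.one_le_L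

/-- Absorbing numerical constants in a further power of `L`. -/
theorem mul_pow_le (h : Reg L n l) {p : ℕ} {C : ℝ} (hC : C ≤ 10 ^ 6) :
    C * L ^ p ≤ L ^ (p + 1) := by
  rw [pow_succ, mul_comm]
  have := h.L_pos
  gcongr
  exact hC.trans h.hL

theorem pow_le_sqrt (h : Reg L n l) {p : ℕ} (hp : p ≤ 50) : L ^ p ≤ √n := by
  apply Real.le_sqrt_of_sq_le
  rw [← pow_mul]
  exact (h.pow_le_pow (by omega)).trans h.hn

end Reg

/-- `t` is the angle `θ` measured in standard deviations of one column. -/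
structure Ang (L l θ t : ℝ) : Prop where
  t0 : 0 ≤ t
  ht : t ^ 2 = l * (1 + l) * θ ^ 2
  hs : L ^ 20 * t ≤ 1

theorem Ang.mul_abs_le {L l θ t : ℝ} {n : ℕ} (h : Reg L n l) (ha : Ang L l θ t) :
    (1 + l) * |θ| ≤ L * t := by
  have hl := h.l_pos
  apply abs_le_of_sq_le_sq' _ (by have := h.L_pos; have := ha.t0; positivity) |>.2
  rw [mul_pow, mul_pow, sq_abs, ha.ht]
  have h1 : 1 + l ≤ L ^ 2 * l := by
    have := h.hl
    have := h.hL
    nlinarith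
  nlinarith [mul_le_mul_of_nonneg_right h1 (show 0 ≤ (1 + l) * θ ^ 2 by positivity)]

theorem Ang.abs_le {L l θ t : ℝ} {n : ℕ} (h : Reg L n l) (ha : Ang L l θ t) :
    |θ| ≤ L * t := by
  have hl := h.l_pos
  have := ha.mul_abs_le h
  nlinarith [abs_nonneg θ]

theorem Ang.l_mul_abs_le {L l θ t : ℝ} {n : ℕ} (h : Reg L n l) (ha : Ang L l θ t) :
    l * |θ| ≤ t := by
  have hl := h.l_pos
  apply abs_le_of_sq_le_sq' _ ha.t0 |>.2
  rw [mul_pow, sq_abs, ha.ht]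
  nlinarith [sq_nonneg θ]

theorem Ang.t_le {L l θ t : ℝ} {n : ℕ} (h : Reg L n l) (ha : Ang L l θ t) {p : ℕ} (hp : p ≤ 20) :
    L ^ p * t ≤ 1 :=
  (mul_le_mul_of_nonneg_right (h.pow_le_pow hp) ha.t0).trans ha.hs

theorem Ang.norm_geo_mul_exp_sub_one_le {L l θ t : ℝ} {n : ℕ} (h : Reg L n l)
    (ha : Ang L l θ t) :
    ‖geo l θ * Real.exp (l * (1 + l) * θ ^ 2 / 2) - 1‖ ≤ L ^ 2 * t ^ 3 := by
  have hl := h.l_pos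
  have hL := h.L_pos
  have hL6 := h.hL
  have t0 := ha.t0
  have ht1 : t ≤ 1 / 4 := by
    have := ha.t_le h (p := 1) (by norm_num)
    nlinarith
  have hth := ha.abs_le h
  have hlth := ha.l_mul_abs_le h
  have hth1 : |θ| ≤ 1 := by
    have := ha.t_le h (p := 1) (by norm_num)
    rw [pow_one] at this
    linarith
  set y := Complex.exp (Complex.I * θ) - 1 with hy
  have hR' := norm_cexp_sub_quadratic_le hth1
  rw [← hy] at hR'
  set z : ℂ := Complex.I * ((-(l * θ) : ℝ) : ℂ) + ((l * (1 + l) * θ ^ 2 / 2 : ℝ) : ℂ) with hz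
  have hz1 : ‖z‖ ≤ 2 * t := by
    rw [hz]
    refine (norm_add_le _ _).trans ?_
    rw [norm_mul, Complex.norm_I, one_mul, Complex.norm_real, Complex.norm_real, Real.norm_eq_abs,
      Real.norm_eq_abs, abs_neg, abs_mul, abs_of_pos hl, ← ha.ht,
      abs_of_nonneg (show 0 ≤ t ^ 2 / 2 by positivity)]
    nlinarith
  have hz2 := norm_exp_sub_quadratic_le (x := z) (by linarith)
  have hz3 : ‖z‖ ^ 3 ≤ 8 * t ^ 3 := by
    calc ‖z‖ ^ 3 ≤ (2 * t) ^ 3 := by gcongr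
      _ = _ := by ring
  have hne : (1 : ℂ) - l * y ≠ 0 := by
    intro h0
    have := one_le_norm_one_sub_geo hl.le θ
    rw [← hy, h0] at this
    simp at this
    linarith
  have heq : geo l θ * Real.exp (l * (1 + l) * θ ^ 2 / 2) - 1
      = (Complex.exp z - (1 - l * y)) * (1 - l * y)⁻¹ := by
    rw [hz, Complex.exp_add]
    unfold geo
    rw [← hy, sub_mul, mul_inv_cancel₀ hne, Complex.ofReal_exp]
    ring
  rw [heq, norm_mul, norm_inv]
  have hinv : ‖(1 : ℂ) - l * y‖⁻¹ ≤ 1 := inv_le_one_of_one_le₀ (one_le_norm_one_sub_geo hl.le θ)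
  have hdec : Complex.exp z - (1 - l * y)
      = (Complex.exp z - (1 + z + z ^ 2 / 2)) + l * (y - (Complex.I * θ - θ ^ 2 / 2))
        + (((l * (1 + l) * θ ^ 2) ^ 2 / 8 : ℝ) : ℂ)
        - Complex.I * ((l * θ * (l * (1 + l) * θ ^ 2) / 2 : ℝ) : ℂ) := by
    rw [hz]
    push_cast
    linear_combination ((l : ℂ) ^ 2 * θ ^ 2 / 2) * Complex.I_sq
  have e2 : ‖(l : ℂ) * (y - (Complex.I * θ - θ ^ 2 / 2))‖ ≤ L * t ^ 3 := by
    rw [norm_mul, Complex.norm_real, Real.norm_eq_abs, abs_of_pos hl]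
    calc l * ‖y - (Complex.I * θ - θ ^ 2 / 2)‖ ≤ l * |θ| ^ 3 := by gcongr
      _ = (l * θ ^ 2) * |θ| := by rw [← sq_abs]; ring
      _ ≤ t ^ 2 * (L * t) := by
        gcongr
        rw [ha.ht]
        nlinarith [mul_nonneg (sq_nonneg l) (sq_nonneg θ)]
      _ = _ := by ring
  have e3 : ‖(((l * (1 + l) * θ ^ 2) ^ 2 / 8 : ℝ) : ℂ)‖ ≤ t ^ 3 := by
    rw [Complex.norm_real, ← ha.ht, Real.norm_eq_abs, abs_of_nonneg (by positivity)]
    nlinarith [pow_nonneg t0 3]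
  have e4 : ‖Complex.I * ((l * θ * (l * (1 + l) * θ ^ 2) / 2 : ℝ) : ℂ)‖ ≤ t ^ 3 := by
    rw [norm_mul, Complex.norm_I, one_mul, Complex.norm_real, ← ha.ht, Real.norm_eq_abs, abs_div,
      abs_mul, abs_mul, abs_of_pos hl, abs_of_nonneg (sq_nonneg t)]
    norm_num
    nlinarith [mul_le_mul_of_nonneg_right hlth (sq_nonneg t), pow_nonneg t0 3]
  calc ‖Complex.exp z - (1 - l * y)‖ * ‖(1 : ℂ) - l * y‖⁻¹
      ≤ ‖Complex.exp z - (1 - l * y)‖ * 1 := by gcongr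
    _ ≤ 8 * t ^ 3 + L * t ^ 3 + t ^ 3 + t ^ 3 := by
      rw [mul_one, hdec]
      refine (norm_sub_le _ _).trans (add_le_add ((norm_add_le _ _).trans (add_le_add
        ((norm_add_le _ _).trans (add_le_add (hz2.trans hz3) e2)) e3)) e4)
    _ = (10 + L) * t ^ 3 := by ring
    _ ≤ L ^ 2 * t ^ 3 := by gcongr; nlinarith

end Good

namespace Good

theorem sum_mul_pow_le {u : ℝ} (h0 : 0 ≤ u) (h1 : u ≤ 1 / 4) (N : ℕ) :
    ∑ q ∈ Finset.range N, ((q : ℝ) + 2) * u ^ (q + 2) ≤ 4 * u ^ 2 := by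
  have h2 : ∀ q : ℕ, ((q : ℝ) + 2) * u ^ (q + 2) ≤ 2 * u ^ 2 * (1 / 2) ^ q := by
    intro q
    have h3 : (q : ℝ) + 2 ≤ 2 * 2 ^ q := by
      have : q + 2 ≤ 2 * 2 ^ q := by
        have := Nat.lt_two_pow_self (n := q)
        omega
      exact_mod_cast this
    calc ((q : ℝ) + 2) * u ^ (q + 2) ≤ (2 * 2 ^ q) * u ^ (q + 2) := by gcongr
      _ = 2 * u ^ 2 * (2 * u) ^ q := by rw [pow_add, mul_pow]; ring
      _ ≤ 2 * u ^ 2 * (1 / 2) ^ q := by gcongr; linarith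
  refine (Finset.sum_le_sum fun q _ => h2 q).trans ?_
  rw [← Finset.mul_sum]
  have h4 := sum_geometric_two_le N
  nlinarith [sq_nonneg u]

theorem norm_corr_sub_le (j c : ℕ) (y : ℂ) (hy : (c : ℝ) / (j + 2) * ‖y‖ ≤ 1 / 4) :
    ‖corr j c y - (((c : ℝ) / (j + 2) * (1 + (c : ℝ) / (j + 2)) / (j + 3) : ℝ) : ℂ) * y ^ 2‖
      ≤ 4 * ((1 + (c : ℝ) / (j + 2)) * ‖y‖) * ((c : ℝ) / (j + 2) * ‖y‖) ^ 2 / (j + 3) := by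
  have hx0 : 0 ≤ (c : ℝ) / (j + 2) := by positivity
  have e1 : corr j c y = ∑ q ∈ Finset.range (c + 2),
      ((fm (j + 1) c q * (q * (1 + (c : ℝ) / (j + 2)) / (j + 2 + q)) : ℝ) : ℂ) * y ^ (q + 1) := by
    unfold corr
    rw [Finset.sum_range_succ _ (c + 1), fm_eq_zero (j + 1) c (c + 1) (by omega)]
    simp
  rw [e1, Finset.sum_range_succ', Finset.sum_range_succ', zero_add, fm_one]
  set x : ℝ := (c : ℝ) / (j + 2) with hx
  have hpow : ∀ q, fm (j + 1) c q ≤ x ^ q := by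
    intro q
    have := fm_le_pow (j + 1) c q
    rw [hx]
    convert this using 3
    push_cast; ring
  have hc1 : (c : ℝ) / ((j + 1 : ℕ) + 1) = x := by rw [hx]; push_cast; ring
  rw [hc1]
  have e2 : ∀ S : ℂ, S + ((x * ((1 : ℕ) * (1 + x) / (j + 2 + (1 : ℕ))) : ℝ) : ℂ) * y ^ (1 + 1)
      + ((fm (j + 1) c 0 * ((0 : ℕ) * (1 + x) / (j + 2 + (0 : ℕ))) : ℝ) : ℂ) * y ^ (0 + 1)
      - ((x * (1 + x) / (j + 3) : ℝ) : ℂ) * y ^ 2 = S := by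
    intro S
    have : x * (((1 : ℕ) : ℝ) * (1 + x) / (j + 2 + (1 : ℕ))) = x * (1 + x) / (j + 3) := by
      push_cast
      rw [one_mul, mul_div_assoc, add_assoc]; norm_num
    rw [this]
    simp
  rw [e2]
  refine (norm_sum_le _ _).trans ?_
  have e3 : ∀ q ∈ Finset.range c,
      ‖((fm (j + 1) c (q + 1 + 1) * (((q + 1 + 1 : ℕ) : ℝ) * (1 + x) / (j + 2 + (q + 1 + 1 : ℕ))) : ℝ) : ℂ)
        * y ^ (q + 1 + 1 + 1)‖
      ≤ (1 + x) * ‖y‖ / (j + 3) * (((q : ℝ) + 2) * (x * ‖y‖) ^ (q + 2)) := by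
    intro q _
    rw [norm_mul, Complex.norm_real, norm_pow, Real.norm_eq_abs,
      abs_of_nonneg (mul_nonneg (fm_nonneg _ _ _) (by positivity))]
    have hq : ((q + 1 + 1 : ℕ) : ℝ) * (1 + x) / (j + 2 + (q + 1 + 1 : ℕ))
        ≤ ((q : ℝ) + 2) * (1 + x) / (j + 3) := by
      have h1 : ((q + 1 + 1 : ℕ) : ℝ) = q + 2 := by push_cast; ring
      rw [h1]
      apply div_le_div_of_nonneg_left (by positivity) (by positivity)
      linarith [Nat.cast_nonneg (α := ℝ) q]
    calc fm (j + 1) c (q + 1 + 1) * (((q + 1 + 1 : ℕ) : ℝ) * (1 + x) / (j + 2 + (q + 1 + 1 : ℕ)))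
          * ‖y‖ ^ (q + 1 + 1 + 1)
        ≤ x ^ (q + 1 + 1) * (((q : ℝ) + 2) * (1 + x) / (j + 3)) * ‖y‖ ^ (q + 1 + 1 + 1) := by
          gcongr
          exact hpow _
      _ = _ := by rw [mul_pow]; ring
  refine (Finset.sum_le_sum e3).trans ?_
  rw [← Finset.mul_sum]
  have := sum_mul_pow_le (u := x * ‖y‖) (by positivity) hy c
  calc _ ≤ (1 + x) * ‖y‖ / (j + 3) * (4 * (x * ‖y‖) ^ 2) := by gcongr
    _ = _ := by ring

end Good

namespace Good

theorem norm_one_sub_mul_exp_sub_le {b : ℂ} {δ : ℝ} (hb : ‖b‖ ≤ 1 / 4) (hδ : |δ| ≤ 1 / 4) :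
    ‖(1 - b) * Complex.exp (b + δ) - (1 + δ - b ^ 2 / 2)‖ ≤ 7 * (|δ| ^ 2 + ‖b‖ ^ 3) := by
  have hδ' : ‖(δ : ℂ)‖ = |δ| := by rw [Complex.norm_real, Real.norm_eq_abs]
  have hs : ‖b + δ‖ ≤ ‖b‖ + |δ| := by rw [← hδ']; exact norm_add_le _ _
  have h := norm_exp_sub_quadratic_le (x := b + δ) (by linarith)
  have hb0 := norm_nonneg b
  have hd0 := abs_nonneg δ
  have hdec : (1 - b) * Complex.exp (b + δ) - (1 + δ - b ^ 2 / 2)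
      = (1 - b) * (Complex.exp (b + δ) - (1 + (b + δ) + (b + δ) ^ 2 / 2))
        + δ ^ 2 / 2 - b * (b + δ) ^ 2 / 2 := by ring
  have h1 : ‖1 - b‖ ≤ 5 / 4 := by
    have := norm_sub_le (1 : ℂ) b
    rw [norm_one] at this
    linarith
  have e1 : ‖(1 - b) * (Complex.exp (b + δ) - (1 + (b + δ) + (b + δ) ^ 2 / 2))‖
      ≤ 5 / 4 * (‖b‖ + |δ|) ^ 3 := by
    rw [norm_mul]
    gcongr
    exact h.trans (by gcongr)
  have e2 : ‖(δ : ℂ) ^ 2 / 2‖ = |δ| ^ 2 / 2 := by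
    rw [norm_div, norm_pow, hδ']; norm_num
  have e3 : ‖b * (b + δ) ^ 2 / 2‖ ≤ ‖b‖ * (‖b‖ + |δ|) ^ 2 / 2 := by
    rw [norm_div, norm_mul, norm_pow]
    norm_num
    gcongr
  rw [hdec]
  refine (norm_sub_le _ _).trans ?_
  have := norm_add_le ((1 - b) * (Complex.exp (b + δ) - (1 + (b + δ) + (b + δ) ^ 2 / 2)))
    ((δ : ℂ) ^ 2 / 2)
  generalize ‖b‖ = β at *
  generalize |δ| = e at *
  have h3 : (β + e) ^ 3 ≤ 4 * (β ^ 3 + e ^ 3) := by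
    nlinarith [mul_nonneg (add_nonneg hb0 hd0) (sq_nonneg (β - e))]
  have h4 : β * (β + e) ^ 2 ≤ (β + e) ^ 3 := by
    nlinarith [mul_nonneg hd0 (sq_nonneg (β + e))]
  have h5 : e ^ 3 ≤ e ^ 2 / 4 := by nlinarith [sq_nonneg e]
  nlinarith [sq_nonneg e, pow_nonneg hb0 3]

/-- Quadratic correction to the logarithm of a column factor. -/
noncomputable def dlt (j c : ℕ) (l θ : ℝ) : ℝ :=
  -((((c : ℝ) / (j + 2) - l) ^ 2 - 2 * ((c : ℝ) / (j + 2) * (1 + (c : ℝ) / (j + 2))) / (j + 3))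
    * θ ^ 2 / 2)

/-- Approximation of a column factor. -/
noncomputable def apx (j c : ℕ) (l θ : ℝ) : ℂ :=
  Complex.exp (Complex.I * ((-((c : ℝ) / (j + 2) * θ) : ℝ) : ℂ))
    * (1 - l * (Complex.exp (Complex.I * θ) - 1))⁻¹
    * Complex.exp ((((c : ℝ) / (j + 2) - l : ℝ) : ℂ)
        * ((Complex.exp (Complex.I * θ) - 1) / (1 - l * (Complex.exp (Complex.I * θ) - 1)))
        + dlt j c l θ)

theorem one_sub_geo_ne_zero {l : ℝ} (hl : 0 ≤ l) (θ : ℝ) :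
    (1 : ℂ) - l * (Complex.exp (Complex.I * θ) - 1) ≠ 0 := by
  intro h0
  have := one_le_norm_one_sub_geo hl θ
  rw [h0, norm_zero] at this
  linarith

theorem norm_psi_sub_apx_le_aux (j c : ℕ) {l : ℝ} (hl : 0 ≤ l) (θ : ℝ) :
    ‖psi j c (fun _ => 1) θ - apx j c l θ‖
      ≤ ‖(1 - corr j c (Complex.exp (Complex.I * θ) - 1))
        - (1 - (((c : ℝ) / (j + 2) - l : ℝ) : ℂ)
          * ((Complex.exp (Complex.I * θ) - 1) / (1 - l * (Complex.exp (Complex.I * θ) - 1))))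
          * Complex.exp ((((c : ℝ) / (j + 2) - l : ℝ) : ℂ)
            * ((Complex.exp (Complex.I * θ) - 1) / (1 - l * (Complex.exp (Complex.I * θ) - 1)))
            + dlt j c l θ)‖ := by
  have h1 := chi_mul j c θ
  have hne := one_sub_geo_ne_zero hl θ
  have hx0 : 0 ≤ (c : ℝ) / (j + 2) := by positivity
  have hne2 := one_sub_geo_ne_zero hx0 θ
  have hge := one_le_norm_one_sub_geo hx0 θ
  rw [psi_one_eq]
  unfold apx
  generalize Complex.exp (Complex.I * θ) - 1 = y at *
  set x : ℝ := (c : ℝ) / (j + 2) with hx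
  set ζ := y / (1 - l * y) with hζ
  have hw : ‖Complex.exp (Complex.I * ((-(x * θ) : ℝ) : ℂ))‖ = 1 := norm_cexp_I _
  generalize Complex.exp (Complex.I * ((-(x * θ) : ℝ) : ℂ)) = w at *
  generalize Complex.exp (((x - l : ℝ) : ℂ) * ζ + dlt j c l θ) = E at *
  have hfac : (1 : ℂ) - x * y = (1 - l * y) * (1 - ((x - l : ℝ) : ℂ) * ζ) := by
    have hy : y = ζ * (1 - l * y) := by rw [hζ, div_mul_cancel₀ _ hne]
    push_cast
    linear_combination (-((x : ℂ) - l)) * hy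
  have hq : (1 : ℂ) - ((x - l : ℝ) : ℂ) * ζ ≠ 0 := by
    intro h0
    rw [h0, mul_zero] at hfac
    exact hne2 hfac
  have heq : w * chi j c θ - w * (1 - l * y)⁻¹ * E
      = w * (1 - x * y)⁻¹ * ((1 - corr j c y) - (1 - ((x - l : ℝ) : ℂ) * ζ) * E) := by
    rw [← h1, hfac]
    generalize 1 - ((x - l : ℝ) : ℂ) * ζ = p at *
    field_simp
  rw [heq, norm_mul, norm_mul, hw, one_mul, norm_inv]
  have := inv_le_one_of_one_le₀ hge
  exact mul_le_of_le_one_left (norm_nonneg _) this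

set_option maxHeartbeats 2000000 in
theorem norm_psi_sub_apx_le {L l θ t : ℝ} {n : ℕ} (h : Reg L n l) (ha : Ang L l θ t) (j c : ℕ)
    (hc : (c : ℝ) / (j + 2) ≤ L * l) :
    ‖psi j c (fun _ => 1) θ - apx j c l θ‖
      ≤ L ^ 5 * t ^ 3 * (((c : ℝ) / (j + 2) - l) ^ 2 / (l * (1 + l)) + 1 / (j + 3)) := by
  refine (norm_psi_sub_apx_le_aux j c h.l_pos.le θ).trans ?_
  have hl := h.l_pos
  have hL := h.L_pos
  have hL1 := h.one_le_L
  have hL6 := h.hL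
  have t0 := ha.t0
  have hA := h.A_pos
  have hx0 : 0 ≤ (c : ℝ) / (j + 2) := by positivity
  have hth := ha.abs_le h
  have hlth := ha.l_mul_abs_le h
  have hlth1 := ha.mul_abs_le h
  have hLt : L ^ 4 * t ≤ 1 / 16 := by
    have := ha.t_le h (p := 5) (by norm_num)
    have h4 : 0 ≤ L ^ 4 * t := by positivity
    have : L * (L ^ 4 * t) ≤ 1 := by rw [← mul_assoc, ← pow_succ']; exact this
    nlinarith
  have hLt2 : L ^ 2 * t ≤ 1 / 16 :=
    le_trans (mul_le_mul_of_nonneg_right (h.pow_le_pow (by norm_num)) t0) hLt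
  have hLt1 : L * t ≤ 1 / 16 := by
    refine le_trans (mul_le_mul_of_nonneg_right ?_ t0) hLt
    simpa using h.pow_le_pow (p := 1) (q := 4) (by norm_num)
  have ht1 : t ≤ 1 / 16 := by nlinarith
  have hth1 : |θ| ≤ 1 / 16 := by linarith
  have hy1 := norm_cexp_sub_one_le θ
  have hy2 := norm_cexp_sub_quadratic_le (θ := θ) (by linarith)
  have hge := one_le_norm_one_sub_geo hl.le θ
  have hne := one_sub_geo_ne_zero hl.le θ
  have hcorr := norm_corr_sub_le j c (Complex.exp (Complex.I * θ) - 1)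
  have hdl : dlt j c l θ = -((((c : ℝ) / (j + 2) - l) ^ 2
      - 2 * ((c : ℝ) / (j + 2) * (1 + (c : ℝ) / (j + 2))) / (j + 3)) * θ ^ 2 / 2) := rfl
  generalize dlt j c l θ = δ at *
  generalize Complex.exp (Complex.I * θ) - 1 = y at *
  generalize corr j c y = S at *
  generalize (c : ℝ) / (j + 2) = x at *
  set d := x - l with hd
  set ζ := y / (1 - l * y) with hζ
  have hi : (3 : ℝ) ≤ j + 3 := by linarith [Nat.cast_nonneg (α := ℝ) j]
  generalize (j : ℝ) + 3 = i at *
  have hi0 : 0 < i := by linarith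
  set D := d ^ 2 / (l * (1 + l)) with hD
  have hD0 : 0 ≤ D := by positivity
  have hdD : d ^ 2 = D * (l * (1 + l)) := by rw [hD]; field_simp
  have hI : 0 ≤ 1 / i := by positivity
  have habsd : |d| ≤ L * l := by
    have : l ≤ L * l := le_mul_of_one_le_left hl.le hL1
    rw [abs_le]; constructor <;> linarith
  have hDL : D ≤ L ^ 2 := by
    rw [hD, div_le_iff₀ hA, ← sq_abs]
    calc |d| ^ 2 ≤ (L * l) ^ 2 := by gcongr
      _ ≤ _ := by linarith [mul_pos (pow_pos hL 2) hl]
  have hxx : x * (1 + x) ≤ L ^ 2 * (l * (1 + l)) := by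
    calc x * (1 + x) ≤ (L * l) * (1 + L * l) := by gcongr
      _ ≤ (L * l) * (L * (1 + l)) := by gcongr; linarith
      _ = _ := by ring
  have hθ0 := abs_nonneg θ
  have hθ2 : θ ^ 2 = |θ| ^ 2 := (sq_abs θ).symm
  -- size of `y`, `ζ`
  have hζ1 : ‖ζ‖ ≤ |θ| := by
    rw [hζ, norm_div]
    exact (div_le_self (norm_nonneg _) hge).trans hy1
  have hyI : ‖y - Complex.I * θ‖ ≤ |θ| ^ 2 := by
    have e : y - Complex.I * θ = (y - (Complex.I * θ - θ ^ 2 / 2)) - ((θ ^ 2 / 2 : ℝ) : ℂ) := by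
      push_cast; ring
    rw [e]
    refine (norm_sub_le _ _).trans ?_
    rw [Complex.norm_real, Real.norm_eq_abs, abs_of_nonneg (by positivity), hθ2]
    have := mul_le_mul_of_nonneg_left hth1 (sq_nonneg |θ|)
    linarith [sq_nonneg |θ|]
  have hIθ : ‖Complex.I * (θ : ℂ)‖ = |θ| := by simp
  have hysq : ‖y ^ 2 + (θ : ℂ) ^ 2‖ ≤ 2 * |θ| ^ 3 := by
    have e : y ^ 2 + (θ : ℂ) ^ 2 = (y - Complex.I * θ) * (y + Complex.I * θ) := by
      linear_combination ((θ : ℂ) ^ 2) * Complex.I_sq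
    rw [e, norm_mul]
    have : ‖y + Complex.I * θ‖ ≤ 2 * |θ| := by
      refine (norm_add_le _ _).trans ?_
      rw [hIθ]; linarith
    calc _ ≤ |θ| ^ 2 * (2 * |θ|) := by gcongr
      _ = _ := by ring
  have hζI : ‖ζ - Complex.I * θ‖ ≤ (1 + l) * |θ| ^ 2 := by
    have e : ζ - Complex.I * θ = (y - Complex.I * θ + l * ((Complex.I * θ) * y)) / (1 - l * y) := by
      have hy : y = ζ * (1 - l * y) := by rw [hζ, div_mul_cancel₀ _ hne]
      rw [eq_div_iff hne]
      linear_combination -hy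
    rw [e, norm_div]
    refine (div_le_self (norm_nonneg _) hge).trans ((norm_add_le _ _).trans ?_)
    rw [norm_mul, norm_mul, hIθ, Complex.norm_real, Real.norm_eq_abs, abs_of_pos hl]
    have : l * (|θ| * ‖y‖) ≤ l * (|θ| * |θ|) := by gcongr
    calc _ ≤ |θ| ^ 2 + l * (|θ| * |θ|) := add_le_add hyI this
      _ = _ := by ring
  have hζsq : ‖ζ ^ 2 + (θ : ℂ) ^ 2‖ ≤ 2 * (1 + l) * |θ| ^ 3 := by
    have e : ζ ^ 2 + (θ : ℂ) ^ 2 = (ζ - Complex.I * θ) * (ζ + Complex.I * θ) := by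
      linear_combination ((θ : ℂ) ^ 2) * Complex.I_sq
    rw [e, norm_mul]
    have : ‖ζ + Complex.I * θ‖ ≤ 2 * |θ| := by
      refine (norm_add_le _ _).trans ?_
      rw [hIθ]; linarith
    calc _ ≤ ((1 + l) * |θ| ^ 2) * (2 * |θ|) := by gcongr
      _ = _ := by ring
  have ht2 : (l * (1 + l)) * |θ| ^ 2 = t ^ 2 := by rw [ha.ht, sq_abs]
  -- size of `b`
  have hb : ‖(d : ℂ) * ζ‖ ≤ |d| * |θ| := by
    rw [norm_mul, Complex.norm_real, Real.norm_eq_abs]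
    gcongr
  have hdθ : |d| * |θ| ≤ L * t := by
    calc |d| * |θ| ≤ (L * l) * |θ| := by gcongr
      _ = L * (l * |θ|) := by ring
      _ ≤ L * t := by gcongr
  have hdθ2 : (|d| * |θ|) ^ 2 = D * t ^ 2 := by
    rw [mul_pow, sq_abs, hdD, ← ht2]; ring
  have hb3 : ‖(d : ℂ) * ζ‖ ^ 3 ≤ L * t ^ 3 * D := by
    calc ‖(d : ℂ) * ζ‖ ^ 3 ≤ (|d| * |θ|) ^ 3 := by gcongr
      _ = (|d| * |θ|) ^ 2 * (|d| * |θ|) := by ring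
      _ ≤ D * t ^ 2 * (L * t) := by rw [hdθ2]; gcongr
      _ = _ := by ring
  -- size of `δ`
  have hδ1 : |δ| ≤ (D + L ^ 2 * (1 / i)) * t ^ 2 := by
    have e : δ = -(D * t ^ 2 / 2) + x * (1 + x) * θ ^ 2 * (1 / i) := by
      rw [hdl, hdD, ← ht2, hθ2]; field_simp; ring
    rw [e]
    have e1 : 0 ≤ x * (1 + x) * θ ^ 2 * (1 / i) := by positivity
    have e2 : x * (1 + x) * θ ^ 2 * (1 / i) ≤ L ^ 2 * t ^ 2 * (1 / i) := by
      rw [← ht2, hθ2]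
      calc _ ≤ L ^ 2 * (l * (1 + l)) * |θ| ^ 2 * (1 / i) := by gcongr
        _ = _ := by ring
    have e3 : 0 ≤ D * t ^ 2 := by positivity
    have e4 : 0 ≤ L ^ 2 * t ^ 2 * (1 / i) := by positivity
    rw [abs_le]; constructor <;> linarith
  have hDI : D + L ^ 2 * (1 / i) ≤ 2 * L ^ 2 := by
    have : 1 / i ≤ 1 := by rw [div_le_one hi0]; linarith
    have := mul_le_mul_of_nonneg_left this (sq_nonneg L)
    linarith
  have hδ2 : |δ| ≤ 1 / 16 := by
    refine hδ1.trans ?_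
    calc _ ≤ 2 * L ^ 2 * t ^ 2 := by gcongr
      _ = 2 * (L ^ 2 * t) * t := by ring
      _ ≤ 2 * (1 / 16) * (1 / 16) := by gcongr
      _ ≤ _ := by norm_num
  have hδsq : |δ| ^ 2 ≤ L ^ 4 * t ^ 3 * (D + 1 / i) := by
    calc |δ| ^ 2 ≤ ((D + L ^ 2 * (1 / i)) * t ^ 2) ^ 2 := by gcongr
      _ = (D + L ^ 2 * (1 / i)) * (D + L ^ 2 * (1 / i)) * t * t ^ 3 := by ring
      _ ≤ (2 * L ^ 2) * (L ^ 2 * (D + 1 / i)) * (1 / 16) * t ^ 3 := by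
        gcongr
        have := mul_le_mul_of_nonneg_right (one_le_pow₀ (n := 2) hL1) hD0
        linarith
      _ ≤ _ := by
        have : 0 ≤ L ^ 4 * t ^ 3 * (D + 1 / i) := by positivity
        linarith
  have hE := norm_one_sub_mul_exp_sub_le (b := (d : ℂ) * ζ) (δ := δ) (by linarith) (by linarith)
  -- the correction series
  have hx1 : x * ‖y‖ ≤ L * t := by
    calc x * ‖y‖ ≤ (L * l) * |θ| := by gcongr
      _ = L * (l * |θ|) := by ring
      _ ≤ L * t := by gcongr
  have hx2 : (1 + x) * ‖y‖ ≤ L ^ 2 * t := by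
    calc (1 + x) * ‖y‖ ≤ (1 + L * l) * |θ| := by gcongr
      _ ≤ L * (1 + l) * |θ| := by gcongr; linarith
      _ = L * ((1 + l) * |θ|) := by ring
      _ ≤ L * (L * t) := by gcongr
      _ = _ := by ring
  have hcorr2 : ‖S - ((x * (1 + x) / i : ℝ) : ℂ) * y ^ 2‖ ≤ 4 * L ^ 4 * t ^ 3 * (1 / i) := by
    refine (hcorr (by linarith)).trans ?_
    calc _ ≤ 4 * (L ^ 2 * t) * (L * t) ^ 2 / i := by gcongr
      _ = _ := by ring
  have hA1 : ‖((x * (1 + x) / i : ℝ) : ℂ) * (y ^ 2 + θ ^ 2)‖ ≤ 2 * L ^ 3 * t ^ 3 * (1 / i) := by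
    rw [norm_mul, Complex.norm_real, Real.norm_eq_abs, abs_of_nonneg (by positivity)]
    calc _ ≤ (L ^ 2 * (l * (1 + l)) / i) * (2 * |θ| ^ 3) := by gcongr
      _ = 2 * L ^ 2 * ((l * (1 + l)) * |θ| ^ 2) * |θ| * (1 / i) := by ring
      _ ≤ 2 * L ^ 2 * t ^ 2 * (L * t) * (1 / i) := by rw [ht2]; gcongr
      _ = _ := by ring
  have hA2 : ‖((d ^ 2 / 2 : ℝ) : ℂ) * (ζ ^ 2 + θ ^ 2)‖ ≤ L * t ^ 3 * D := by
    rw [norm_mul, Complex.norm_real, Real.norm_eq_abs, abs_of_nonneg (by positivity)]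
    calc _ ≤ (d ^ 2 / 2) * (2 * (1 + l) * |θ| ^ 3) := by gcongr
      _ = D * ((l * (1 + l)) * |θ| ^ 2) * ((1 + l) * |θ|) := by rw [hdD]; ring
      _ ≤ D * t ^ 2 * (L * t) := by rw [ht2]; gcongr
      _ = _ := by ring
  have hdec : (1 - S) - (1 - (d : ℂ) * ζ) * Complex.exp ((d : ℂ) * ζ + δ)
      = -(S - ((x * (1 + x) / i : ℝ) : ℂ) * y ^ 2)
        - ((x * (1 + x) / i : ℝ) : ℂ) * (y ^ 2 + θ ^ 2)
        + ((d ^ 2 / 2 : ℝ) : ℂ) * (ζ ^ 2 + θ ^ 2)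
        - ((1 - (d : ℂ) * ζ) * Complex.exp ((d : ℂ) * ζ + δ) - (1 + δ - ((d : ℂ) * ζ) ^ 2 / 2)) := by
    rw [hdl]; push_cast; field_simp; ring
  rw [hdec]
  refine (norm_sub_le _ _).trans ((add_le_add ((norm_add_le _ _).trans (add_le_add
    ((norm_sub_le _ _).trans (add_le_add ((norm_neg _).le.trans hcorr2) hA1)) hA2))
    (hE.trans (mul_le_mul_of_nonneg_left (add_le_add hδsq hb3) (by norm_num)))).trans ?_)
  have hX : 0 ≤ t ^ 3 * D := by positivity
  have hY : 0 ≤ t ^ 3 * (1 / i) := by positivity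
  have p1 : L ≤ L ^ 4 := by simpa using h.pow_le_pow (p := 1) (q := 4) (by norm_num)
  have p3 : L ^ 3 ≤ L ^ 4 := h.pow_le_pow (by norm_num)
  have p5 : 30 * L ^ 4 ≤ L ^ 5 := h.mul_pow_le (by norm_num)
  have q1 := mul_le_mul_of_nonneg_right p1 hX
  have q5 := mul_le_mul_of_nonneg_right p5 hX
  have r3 := mul_le_mul_of_nonneg_right p3 hY
  have r5 := mul_le_mul_of_nonneg_right p5 hY
  have s4 : 0 ≤ L ^ 4 * (t ^ 3 * D) := by positivity
  have s4' : 0 ≤ L ^ 4 * (t ^ 3 * (1 / i)) := by positivity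
  linarith

end Good

namespace Good

variable {n : ℕ}

namespace Reg

variable {L : ℝ} {s : ℕ}

theorem ang (h : Reg L n ((s : ℝ) / n)) {θ : ℝ}
    (hθ : n * ((s : ℝ) / n * (1 + (s : ℝ) / n)) * θ ^ 2 ≤ L ^ 2) :
    Ang L ((s : ℝ) / n) θ (√((s : ℝ) / n * (1 + (s : ℝ) / n)) * |θ|) := by
  have hA := h.A_pos
  have hn := h.n_pos
  have hL := h.L_pos
  generalize (s : ℝ) / n = l at *
  have e : (√(l * (1 + l)) * |θ|) ^ 2 = l * (1 + l) * θ ^ 2 := by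
    rw [mul_pow, Real.sq_sqrt hA.le, sq_abs]
  refine ⟨by positivity, e, ?_⟩
  apply abs_le_of_sq_le_sq' _ zero_le_one |>.2
  rw [mul_pow, e, one_pow, ← pow_mul]
  have h1 : L ^ 42 ≤ n := (h.pow_le_pow (by norm_num)).trans h.hn
  have h2 : L ^ 40 * (n * (l * (1 + l)) * θ ^ 2) ≤ n := by
    refine le_trans ?_ h1
    calc _ ≤ L ^ 40 * L ^ 2 := by gcongr
      _ = _ := by ring
  have h3 : n * (L ^ 40 * (l * (1 + l) * θ ^ 2)) ≤ n * 1 := by linarith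
  exact le_of_mul_le_mul_left h3 hn

theorem t_le (h : Reg L n ((s : ℝ) / n)) {θ : ℝ}
    (hθ : n * ((s : ℝ) / n * (1 + (s : ℝ) / n)) * θ ^ 2 ≤ L ^ 2) :
    √((s : ℝ) / n * (1 + (s : ℝ) / n)) * |θ| ≤ L / √n := by
  have hA := h.A_pos
  have hn := h.n_pos
  have hL := h.L_pos
  apply abs_le_of_sq_le_sq' _ (by positivity) |>.2
  rw [mul_pow, Real.sq_sqrt hA.le, sq_abs, div_pow, Real.sq_sqrt hn.le, le_div_iff₀ hn]
  linarith

theorem n_mul_t_cube_le (h : Reg L n ((s : ℝ) / n)) {θ : ℝ}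
    (hθ : n * ((s : ℝ) / n * (1 + (s : ℝ) / n)) * θ ^ 2 ≤ L ^ 2) :
    n * (√((s : ℝ) / n * (1 + (s : ℝ) / n)) * |θ|) ^ 3 ≤ L ^ 3 / √n := by
  have hn := h.n_pos
  calc _ ≤ n * (L / √n) ^ 3 := by
        gcongr
        exact h.t_le hθ
    _ = L ^ 3 / √n * (n / √n ^ 2) := by ring
    _ = _ := by rw [Real.sq_sqrt hn.le, div_self hn.ne', mul_one]

theorem norm_geo_pow_sub_le (h : Reg L n ((s : ℝ) / n)) {θ : ℝ}
    (hθ : n * ((s : ℝ) / n * (1 + (s : ℝ) / n)) * θ ^ 2 ≤ L ^ 2) :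
    ‖geo ((s : ℝ) / n) θ ^ n
        - Real.exp (-(n * ((s : ℝ) / n * (1 + (s : ℝ) / n)) * θ ^ 2 / 2))‖
      ≤ Real.exp (-(n * ((s : ℝ) / n * (1 + (s : ℝ) / n)) * θ ^ 2 / 2)) * (L ^ 6 / √n) := by
  have ha := h.ang hθ
  have ht3 := h.n_mul_t_cube_le hθ
  have hL := h.L_pos
  have hn := h.n_pos
  have hA := h.A_pos
  set t := √((s : ℝ) / n * (1 + (s : ℝ) / n)) * |θ| with ht
  have t0 := ha.t0
  have h1 := ha.norm_geo_mul_exp_sub_one_le h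
  have h2 : n * (L ^ 2 * t ^ 3) ≤ L ^ 5 / √n := by
    calc n * (L ^ 2 * t ^ 3) = L ^ 2 * (n * t ^ 3) := by ring
      _ ≤ L ^ 2 * (L ^ 3 / √n) := by gcongr
      _ = _ := by ring
  have h3 := norm_pow_sub_one_le _ n _ h1 (h2.trans (by
    rw [div_le_one (by positivity)]
    exact h.pow_le_sqrt (by norm_num)))
  generalize (s : ℝ) / n = l at *
  have e : geo l θ ^ n - Real.exp (-(n * (l * (1 + l)) * θ ^ 2 / 2))
      = Real.exp (-(n * (l * (1 + l)) * θ ^ 2 / 2))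
        * ((geo l θ * Real.exp (l * (1 + l) * θ ^ 2 / 2)) ^ n - 1) := by
    have h4 : Real.exp (-(n * (l * (1 + l)) * θ ^ 2 / 2))
        * Real.exp (l * (1 + l) * θ ^ 2 / 2) ^ n = 1 := by
      rw [← Real.exp_nat_mul, ← Real.exp_add, ← Real.exp_zero]; congr 1; ring
    have h5 := congrArg (Complex.ofReal) h4
    rw [Complex.ofReal_mul, Complex.ofReal_pow, Complex.ofReal_one] at h5
    rw [mul_pow]
    linear_combination -geo l θ ^ n * h5
  rw [e, norm_mul, Complex.norm_real, Real.norm_eq_abs, abs_of_pos (Real.exp_pos _)]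
  gcongr
  refine h3.trans ?_
  calc 3 * (n * (L ^ 2 * t ^ 3)) ≤ 3 * (L ^ 5 / √n) := by gcongr
    _ = 3 * L ^ 5 / √n := by ring
    _ ≤ _ := by
      gcongr
      exact h.mul_pow_le (by norm_num)

end Reg

/-- The normalized second moment of the column sums around their mean. -/
noncomputable def ww (s j : ℕ) (c : Fin n → ℕ) : ℝ :=
  (∑ k, ((c k : ℝ) / (j + 2) - (s : ℝ) / n) ^ 2) / (n * ((s : ℝ) / n * (1 + (s : ℝ) / n)))

/-- Total variance of a row given the remaining column sums. -/
noncomputable def VV (j : ℕ) (c : Fin n → ℕ) : ℝ :=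
  ((j : ℝ) + 1) / (j + 3) * ∑ k, (c k : ℝ) / (j + 2) * (1 + (c k : ℝ) / (j + 2))

/-- One row is removed from `j + 2` remaining rows with column sums `c`, none too large. -/
structure Step (L : ℝ) (s j : ℕ) (c : Fin n → ℕ) : Prop where
  reg : Reg L n ((s : ℝ) / n)
  hc : ∑ k, c k = (j + 2) * s
  hx : ∀ k, (c k : ℝ) / (j + 2) ≤ L * ((s : ℝ) / n)
  hj : (j : ℝ) + 3 ≤ L * n

namespace Step

variable {L : ℝ} {s j : ℕ} {c : Fin n → ℕ}

theorem sum_x (h : Step L s j c) : ∑ k, (c k : ℝ) / (j + 2) = n * ((s : ℝ) / n) := by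
  rw [← Finset.sum_div]
  have := congrArg (Nat.cast (R := ℝ)) h.hc
  push_cast at this
  rw [this]
  have := h.reg.n_pos.ne'
  field_simp

theorem sum_d (h : Step L s j c) : ∑ k, ((c k : ℝ) / (j + 2) - (s : ℝ) / n) = 0 := by
  rw [Finset.sum_sub_distrib, h.sum_x]; simp

theorem sum_xx (h : Step L s j c) :
    ∑ k, (c k : ℝ) / (j + 2) * (1 + (c k : ℝ) / (j + 2))
      = n * ((s : ℝ) / n * (1 + (s : ℝ) / n)) * (1 + ww s j c) := by
  have h1 : n * ((s : ℝ) / n * (1 + (s : ℝ) / n)) * (1 + ww s j c)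
      = n * ((s : ℝ) / n * (1 + (s : ℝ) / n))
        + ∑ k, ((c k : ℝ) / (j + 2) - (s : ℝ) / n) ^ 2 := by
    have := h.reg.a_pos.ne'
    unfold ww; rw [mul_add, mul_div_cancel₀ _ this, mul_one]
  rw [h1]
  have h2 := h.sum_d
  generalize (s : ℝ) / n = l at *
  have h3 : ∀ k, (c k : ℝ) / (j + 2) * (1 + (c k : ℝ) / (j + 2))
      = ((c k : ℝ) / (j + 2) - l) ^ 2 + (1 + 2 * l) * ((c k : ℝ) / (j + 2) - l)
        + l * (1 + l) := by
    intro k; ring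
  simp only [h3]
  rw [Finset.sum_add_distrib, Finset.sum_add_distrib, ← Finset.mul_sum, h2]
  simp
  ring

theorem ww_nonneg (h : Step L s j c) : 0 ≤ ww s j c :=
  div_nonneg (Finset.sum_nonneg fun _ _ => sq_nonneg _) h.reg.a_pos.le

theorem abs_d_le (h : Step L s j c) (k : Fin n) :
    |(c k : ℝ) / (j + 2) - (s : ℝ) / n| ≤ L * ((s : ℝ) / n) := by
  have h1 := h.hx k
  have h2 : 0 ≤ (c k : ℝ) / (j + 2) := by positivity
  have h3 := h.reg.l_pos
  have : (s : ℝ) / n ≤ L * ((s : ℝ) / n) := le_mul_of_one_le_left h3.le h.reg.one_le_L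
  rw [abs_le]; constructor <;> linarith

theorem sq_d_le (h : Step L s j c) (k : Fin n) :
    ((c k : ℝ) / (j + 2) - (s : ℝ) / n) ^ 2 ≤ L ^ 2 * ((s : ℝ) / n * (1 + (s : ℝ) / n)) := by
  have h3 := h.reg.l_pos
  have h4 := h.reg.L_pos
  rw [← sq_abs]
  calc _ ≤ (L * ((s : ℝ) / n)) ^ 2 := by gcongr; exact h.abs_d_le k
    _ ≤ _ := by nlinarith [mul_pos (pow_pos h4 2) h3]

theorem ww_le (h : Step L s j c) : ww s j c ≤ L ^ 2 := by
  unfold ww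
  rw [div_le_iff₀ h.reg.a_pos]
  refine (Finset.sum_le_sum fun k _ => h.sq_d_le k).trans (le_of_eq ?_)
  simp; ring

theorem VV_eq (h : Step L s j c) :
    VV j c = ((j : ℝ) + 1) / (j + 3)
      * (n * ((s : ℝ) / n * (1 + (s : ℝ) / n)) * (1 + ww s j c)) := by
  unfold VV; rw [h.sum_xx]

theorem le_VV (h : Step L s j c) :
    n * ((s : ℝ) / n * (1 + (s : ℝ) / n)) / 3 ≤ VV j c := by
  rw [h.VV_eq]
  have h1 := h.reg.a_pos
  have h2 := h.ww_nonneg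
  have h3 : (1 : ℝ) / 3 ≤ ((j : ℝ) + 1) / (j + 3) := by
    rw [div_le_div_iff₀ (by norm_num) (by positivity)]
    linarith [Nat.cast_nonneg (α := ℝ) j]
  calc _ = 1 / 3 * (n * ((s : ℝ) / n * (1 + (s : ℝ) / n)) * (1 + 0)) := by ring
    _ ≤ _ := by gcongr

theorem prod_apx (h : Step L s j c) (θ : ℝ) :
    ∏ k, apx j (c k) ((s : ℝ) / n) θ
      = geo ((s : ℝ) / n) θ ^ n
        * Real.exp (-(VV j c - n * ((s : ℝ) / n * (1 + (s : ℝ) / n))) * θ ^ 2 / 2) := by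
  unfold apx geo
  rw [Finset.prod_mul_distrib, Finset.prod_mul_distrib, ← Complex.exp_sum, ← Complex.exp_sum,
    Finset.prod_const, Finset.card_univ, Fintype.card_fin, mul_pow, ← Complex.exp_nat_mul]
  have e1 : ∑ k, Complex.I * ((-((c k : ℝ) / (j + 2) * θ) : ℝ) : ℂ)
      = n * (Complex.I * ((-((s : ℝ) / n * θ) : ℝ) : ℂ)) := by
    rw [← Finset.mul_sum, ← Complex.ofReal_sum, Finset.sum_neg_distrib, ← Finset.sum_mul, h.sum_x]
    push_cast; ring
  have e2 : ∑ k, dlt j (c k) ((s : ℝ) / n) θ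
      = -(VV j c - n * ((s : ℝ) / n * (1 + (s : ℝ) / n))) * θ ^ 2 / 2 := by
    unfold dlt
    have hW : ∑ k, ((c k : ℝ) / (j + 2) - (s : ℝ) / n) ^ 2
        = n * ((s : ℝ) / n * (1 + (s : ℝ) / n)) * ww s j c := by
      have := h.reg.a_pos.ne'
      unfold ww; rw [mul_div_cancel₀ _ this]
    rw [Finset.sum_neg_distrib, ← Finset.sum_div, ← Finset.sum_mul, Finset.sum_sub_distrib,
      ← Finset.sum_div, ← Finset.mul_sum, hW, h.sum_xx, h.VV_eq]
    field_simp
    ring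
  rw [e1, Finset.sum_add_distrib, ← Finset.sum_mul, ← Complex.ofReal_sum, h.sum_d,
    ← Complex.ofReal_sum, e2, Complex.ofReal_exp]
  simp

theorem norm_prod_psi_sub_le (h : Step L s j c) {θ : ℝ}
    (hθ : n * ((s : ℝ) / n * (1 + (s : ℝ) / n)) * θ ^ 2 ≤ L ^ 2) :
    ‖∏ k, psi j (c k) (fun _ => 1) θ - geo ((s : ℝ) / n) θ ^ n
        * Real.exp (-(VV j c - n * ((s : ℝ) / n * (1 + (s : ℝ) / n))) * θ ^ 2 / 2)‖
      ≤ L ^ 9 / √n * (ww s j c + 1 / (j + 3)) := by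
  have ha := h.reg.ang hθ
  have ht3 := h.reg.n_mul_t_cube_le hθ
  have hL := h.reg.L_pos
  have hn := h.reg.n_pos
  have hA := h.reg.A_pos
  rw [← h.prod_apx]
  set t := √((s : ℝ) / n * (1 + (s : ℝ) / n)) * |θ| with ht
  have t0 := ha.t0
  have hb : ∀ k, ‖psi j (c k) (fun _ => 1) θ - apx j (c k) ((s : ℝ) / n) θ‖ ≤ L ^ 5 * t ^ 3
      * (((c k : ℝ) / (j + 2) - (s : ℝ) / n) ^ 2 / ((s : ℝ) / n * (1 + (s : ℝ) / n))
        + 1 / (j + 3)) := fun k => norm_psi_sub_apx_le h.reg ha j (c k) (h.hx k)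
  have hone : ∀ k, ‖psi j (c k) (fun _ => 1) θ‖ ≤ 1 := by
    intro k
    rw [norm_psi_one]
    exact norm_chi_le_one _ _ _
  have hη : L ^ 8 * t ^ 3 ≤ 1 / n := by
    rw [le_div_iff₀ hn]
    calc L ^ 8 * t ^ 3 * n = L ^ 8 * (n * t ^ 3) := by ring
      _ ≤ L ^ 8 * (L ^ 3 / √n) := by gcongr
      _ = L ^ 11 / √n := by ring
      _ ≤ 1 := by
        rw [div_le_one (by positivity)]
        exact h.reg.pow_le_sqrt (by norm_num)
  have hη2 : ∀ k, ‖psi j (c k) (fun _ => 1) θ - apx j (c k) ((s : ℝ) / n) θ‖ ≤ 1 / n := by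
    intro k
    refine (hb k).trans (le_trans ?_ hη)
    have h1 : ((c k : ℝ) / (j + 2) - (s : ℝ) / n) ^ 2 / ((s : ℝ) / n * (1 + (s : ℝ) / n))
        ≤ L ^ 2 := by
      rw [div_le_iff₀ hA]; exact h.sq_d_le k
    have h2 : (1 : ℝ) / (j + 3) ≤ L ^ 2 := by
      refine le_trans ?_ (h.reg.one_le_pow 2)
      rw [div_le_one (by positivity)]
      linarith [Nat.cast_nonneg (α := ℝ) j]
    calc _ ≤ L ^ 5 * t ^ 3 * (L ^ 2 + L ^ 2) := by gcongr
      _ = (2 * L ^ 7) * t ^ 3 := by ring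
      _ ≤ L ^ 8 * t ^ 3 := by
        gcongr
        exact h.reg.mul_pow_le (by norm_num)
  have hmain := norm_prod_sub_prod_le Finset.univ (fun k => psi j (c k) (fun _ => 1) θ)
    (fun k => apx j (c k) ((s : ℝ) / n) θ) (1 / n) (by positivity) (fun k _ => hone k)
    (fun k _ => by
      have := norm_sub_le (psi j (c k) (fun _ => 1) θ)
        (psi j (c k) (fun _ => 1) θ - apx j (c k) ((s : ℝ) / n) θ)
      rw [sub_sub_cancel] at this
      linarith [hone k, hη2 k])
  refine hmain.trans ?_
  have hexp : (1 + 1 / (n : ℝ)) ^ (Finset.univ : Finset (Fin n)).card ≤ 3 := by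
    rw [Finset.card_univ, Fintype.card_fin]
    calc (1 + 1 / (n : ℝ)) ^ n ≤ (Real.exp (1 / n)) ^ n := by
          gcongr
          linarith [Real.add_one_le_exp (1 / (n : ℝ))]
      _ = Real.exp (n * (1 / n)) := by rw [← Real.exp_nat_mul]
      _ = Real.exp 1 := by rw [mul_one_div_cancel hn.ne']
      _ ≤ 3 := by linarith [Real.exp_one_lt_d9]
  have hsum : ∑ k, L ^ 5 * t ^ 3
      * (((c k : ℝ) / (j + 2) - (s : ℝ) / n) ^ 2 / ((s : ℝ) / n * (1 + (s : ℝ) / n))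
        + 1 / (j + 3)) = L ^ 5 * (n * t ^ 3) * (ww s j c + 1 / (j + 3)) := by
    rw [← Finset.mul_sum, Finset.sum_add_distrib, ← Finset.sum_div]
    unfold ww
    simp only [Finset.sum_const, Finset.card_univ, Fintype.card_fin, nsmul_eq_mul]
    generalize ∑ k, ((c k : ℝ) / (j + 2) - (s : ℝ) / n) ^ 2 = W
    generalize (s : ℝ) / n * (1 + (s : ℝ) / n) = A at hA ⊢
    have := hn.ne'
    have := hA.ne'
    field_simp
  have hw := h.ww_nonneg
  calc _ ≤ 3 * ∑ k, L ^ 5 * t ^ 3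
      * (((c k : ℝ) / (j + 2) - (s : ℝ) / n) ^ 2 / ((s : ℝ) / n * (1 + (s : ℝ) / n))
        + 1 / (j + 3)) := by
        gcongr with k
        exact hb k
    _ = 3 * (L ^ 5 * (n * t ^ 3) * (ww s j c + 1 / (j + 3))) := by rw [hsum]
    _ ≤ 3 * (L ^ 5 * (L ^ 3 / √n) * (ww s j c + 1 / (j + 3))) := by gcongr
    _ = 3 * L ^ 8 / √n * (ww s j c + 1 / (j + 3)) := by ring
    _ ≤ _ := by
      gcongr
      exact h.reg.mul_pow_le (by norm_num)

theorem norm_prod_psi_sub_exp_le (h : Step L s j c) {θ : ℝ}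
    (hθ : n * ((s : ℝ) / n * (1 + (s : ℝ) / n)) * θ ^ 2 ≤ L ^ 2) :
    ‖∏ k, psi j (c k) (fun _ => 1) θ - Real.exp (-(VV j c * θ ^ 2 / 2))‖ ≤ L ^ 13 / √n := by
  have h1 := h.norm_prod_psi_sub_le hθ
  have h2 := h.reg.norm_geo_pow_sub_le hθ
  have hL := h.reg.L_pos
  have hn := h.reg.n_pos
  have ha := h.reg.a_pos
  have hV := h.le_VV
  have hw : ww s j c + 1 / (j + 3) ≤ 2 * L ^ 2 := by
    have h3 : (1 : ℝ) / (j + 3) ≤ L ^ 2 := by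
      refine le_trans ?_ (h.reg.one_le_pow 2)
      rw [div_le_one (by positivity)]
      linarith [Nat.cast_nonneg (α := ℝ) j]
    linarith [h.ww_le]
  set a := n * ((s : ℝ) / n * (1 + (s : ℝ) / n)) with ha'
  have e : ∏ k, psi j (c k) (fun _ => 1) θ - Real.exp (-(VV j c * θ ^ 2 / 2))
      = (∏ k, psi j (c k) (fun _ => 1) θ - geo ((s : ℝ) / n) θ ^ n
        * Real.exp (-(VV j c - a) * θ ^ 2 / 2))
        + Real.exp (-(VV j c - a) * θ ^ 2 / 2)
          * (geo ((s : ℝ) / n) θ ^ n - Real.exp (-(a * θ ^ 2 / 2))) := by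
    have : Real.exp (-(VV j c * θ ^ 2 / 2))
        = Real.exp (-(VV j c - a) * θ ^ 2 / 2) * Real.exp (-(a * θ ^ 2 / 2)) := by
      rw [← Real.exp_add]; congr 1; ring
    rw [this]; push_cast; ring
  rw [e]
  refine (norm_add_le _ _).trans ?_
  have h4 : ‖(Real.exp (-(VV j c - a) * θ ^ 2 / 2) : ℂ)
      * (geo ((s : ℝ) / n) θ ^ n - Real.exp (-(a * θ ^ 2 / 2)))‖ ≤ L ^ 6 / √n := by
    rw [norm_mul, Complex.norm_real, Real.norm_eq_abs, abs_of_pos (Real.exp_pos _)]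
    calc _ ≤ Real.exp (-(VV j c - a) * θ ^ 2 / 2)
          * (Real.exp (-(a * θ ^ 2 / 2)) * (L ^ 6 / √n)) := by gcongr
      _ = Real.exp (-(VV j c * θ ^ 2 / 2)) * (L ^ 6 / √n) := by
        rw [← mul_assoc, ← Real.exp_add]; congr 2; ring
      _ ≤ 1 * (L ^ 6 / √n) := by
        gcongr
        apply Real.exp_le_one_iff.2
        have : 0 ≤ VV j c * θ ^ 2 := mul_nonneg (le_trans (by positivity) hV) (sq_nonneg _)
        linarith
      _ = _ := one_mul _
  calc _ ≤ L ^ 9 / √n * (2 * L ^ 2) + L ^ 6 / √n := add_le_add (h1.trans (by gcongr)) h4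
    _ = (2 * L ^ 11 + L ^ 6) / √n := by ring
    _ ≤ L ^ 13 / √n := by
      gcongr
      have p1 := h.reg.pow_le_pow (p := 6) (q := 11) (by norm_num)
      have p2 : 3 * L ^ 11 ≤ L ^ 12 := h.reg.mul_pow_le (by norm_num)
      have p3 := h.reg.pow_le_pow (p := 12) (q := 13) (by norm_num)
      linarith

end Step

end Good

namespace Good

variable {n : ℕ}

/-- The Cauchy profile dominating all the integrands. -/
noncomputable def om (a θ : ℝ) : ℝ := 1 / (1 + a * θ ^ 2)

theorem om_pos {a : ℝ} (ha : 0 ≤ a) (θ : ℝ) : 0 < om a θ := by unfold om; positivity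

theorem om_le_one {a : ℝ} (ha : 0 ≤ a) (θ : ℝ) : om a θ ≤ 1 := by
  unfold om
  rw [div_le_one (by positivity)]
  have : 0 ≤ a * θ ^ 2 := by positivity
  linarith

theorem mul_om_le_one {a : ℝ} (ha : 0 ≤ a) (θ : ℝ) : a * θ ^ 2 * om a θ ≤ 1 := by
  unfold om
  rw [mul_one_div, div_le_one (by positivity)]
  linarith

theorem continuous_om {a : ℝ} (ha : 0 ≤ a) : Continuous (om a) := by
  unfold om
  refine continuous_const.div (by fun_prop) fun θ => ?_
  positivity

theorem om_eq {a : ℝ} (ha : 0 ≤ a) : om a = fun θ => (1 + (√a * θ) ^ 2)⁻¹ := by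
  funext θ
  unfold om
  rw [mul_pow, Real.sq_sqrt ha, one_div]

theorem integrable_om {a : ℝ} (ha : 0 < a) : MeasureTheory.Integrable (om a) := by
  rw [om_eq ha.le]
  exact integrable_inv_one_add_sq.comp_mul_left' (Real.sqrt_pos.2 ha).ne'

theorem integral_om {a : ℝ} (ha : 0 < a) : ∫ θ, om a θ = π / √a := by
  rw [om_eq ha.le]
  rw [MeasureTheory.Measure.integral_comp_mul_left (fun x : ℝ => (1 + x ^ 2)⁻¹),
    integral_univ_inv_one_add_sq, abs_of_pos (by positivity), smul_eq_mul]
  ring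

theorem setIntegral_om_le {a : ℝ} (ha : 0 < a) (S : Set ℝ) :
    ∫ θ in S, om a θ ≤ π / √a := by
  rw [← integral_om ha]
  exact MeasureTheory.setIntegral_le_integral (integrable_om ha)
    (Filter.Eventually.of_forall fun θ => (om_pos ha.le θ).le)

theorem norm_integral_le_of_le_om {a B : ℝ} (ha : 0 < a) (hB : 0 ≤ B) (F : ℝ → ℂ)
    (h : ∀ θ, |θ| ≤ π → ‖F θ‖ ≤ B * om a θ) :
    ‖1 / (2 * π) * ∫ θ in (-π)..π, F θ‖ ≤ B / √a := by
  have h1 : ‖∫ θ in (-π)..π, F θ‖ ≤ ∫ θ in (-π)..π, B * om a θ := by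
    apply intervalIntegral.norm_integral_le_of_norm_le (by linarith [Real.pi_pos])
    · refine Filter.Eventually.of_forall fun θ hθ => h θ ?_
      rw [abs_le]; exact ⟨hθ.1.le, hθ.2⟩
    · exact ((continuous_om ha.le).const_mul B |>.intervalIntegrable _ _)
  have h2 := setIntegral_om_le ha (Set.Ioc (-π) π)
  rw [← intervalIntegral.integral_of_le (by linarith [Real.pi_pos])] at h2
  rw [intervalIntegral.integral_const_mul] at h1
  rw [norm_mul]
  have h3 : ‖(1 / (2 * π) : ℂ)‖ = 1 / (2 * π) := by
    rw [show (1 / (2 * π) : ℂ) = ((1 / (2 * π) : ℝ) : ℂ) by push_cast; ring, Complex.norm_real,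
      Real.norm_eq_abs, abs_of_nonneg (by positivity)]
  rw [h3]
  have hpi := Real.pi_pos
  calc _ ≤ 1 / (2 * π) * (B * (π / √a)) := by
        gcongr
        exact h1.trans (by gcongr)
    _ = B / √a / 2 := by field_simp
    _ ≤ B / √a := half_le_self (by positivity)

theorem integral_odd_eq_zero (F : ℝ → ℂ) (hF : ∀ θ, F (-θ) = -F θ) :
    ∫ θ in (-π)..π, F θ = 0 := by
  have h := intervalIntegral.integral_comp_neg (a := -π) (b := π) F
  simp only [hF, neg_neg, intervalIntegral.integral_neg] at h
  linear_combination (-1 / 2 : ℂ) * h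

namespace Reg

variable {L l : ℝ}

theorem one_le_om_mul (h : Reg L n l) {θ : ℝ} (hθ : n * (l * (1 + l)) * θ ^ 2 ≤ L ^ 2) :
    1 ≤ L ^ 3 * om (n * (l * (1 + l))) θ := by
  have ha := h.a_pos
  unfold om
  rw [mul_one_div, le_div_iff₀ (by positivity), one_mul]
  have h1 : 2 * L ^ 2 ≤ L ^ 3 := h.mul_pow_le (by norm_num)
  linarith [h.one_le_pow 2]

theorem pow_le_exp (h : Reg L n l) (p : ℕ) {y : ℝ} (hy : p * (L / (2 * 10 ^ 7)) ≤ y) :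
    (n : ℝ) ^ p ≤ Real.exp y := by
  have hn := h.n_pos
  have : Real.log n ≤ L / (2 * 10 ^ 7) := by
    rw [le_div_iff₀ (by norm_num)]; linarith [h.hlog]
  calc (n : ℝ) ^ p = Real.exp (p * Real.log n) := by rw [Real.exp_nat_mul, Real.exp_log hn]
    _ ≤ Real.exp y := by
      apply Real.exp_le_exp.2
      refine le_trans ?_ hy
      gcongr

theorem exp_mul_le (h : Reg L n l) {V θ : ℝ} (hV : n * (l * (1 + l)) / 3 ≤ V)
    (hθ : L ^ 2 ≤ n * (l * (1 + l)) * θ ^ 2) :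
    Real.exp (-(V * θ ^ 2 / 2)) * (1 + n * (l * (1 + l)) * θ ^ 2) ^ 3 ≤ 1 / (n : ℝ) ^ 14 := by
  have hn := h.n_pos
  have hL := h.hL
  have hL0 := h.L_pos
  have h1 : n * (l * (1 + l)) * θ ^ 2 / 6 ≤ V * θ ^ 2 / 2 := by
    have := mul_le_mul_of_nonneg_right hV (sq_nonneg θ)
    linarith
  generalize n * (l * (1 + l)) * θ ^ 2 = τ at hθ h1 ⊢
  have hLL : (10 : ℝ) ^ 6 * L ≤ L ^ 2 := by rw [pow_two]; gcongr
  have hτ : (10 : ℝ) ^ 12 ≤ τ := by linarith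
  have hτ0 : 0 < τ := by linarith
  have h2 : (1 + τ) ^ 3 ≤ Real.exp (τ / 12) := by
    have := Real.pow_div_factorial_le_exp (τ / 12) (by positivity) 4
    refine le_trans ?_ this
    have h3 : (1 + τ) ^ 3 ≤ (2 * τ) ^ 3 := by gcongr; linarith
    refine h3.trans ?_
    rw [show (Nat.factorial 4 : ℝ) = 24 by norm_num [Nat.factorial]]
    have : 0 ≤ τ ^ 3 * (τ - 10 ^ 12) := mul_nonneg (by positivity) (by linarith)
    nlinarith [pow_pos hτ0 3]
  have h3 : (n : ℝ) ^ 14 ≤ Real.exp (τ / 12) := by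
    apply h.pow_le_exp
    push_cast
    linarith
  have h4 : Real.exp (-(V * θ ^ 2 / 2)) ≤ Real.exp (-(τ / 12)) * Real.exp (-(τ / 12)) := by
    rw [← Real.exp_add]; apply Real.exp_le_exp.2; linarith
  calc _ ≤ (Real.exp (-(τ / 12)) * Real.exp (-(τ / 12))) * Real.exp (τ / 12) := by gcongr
    _ = Real.exp (-(τ / 12)) := by rw [mul_assoc, ← Real.exp_add]; simp
    _ = 1 / Real.exp (τ / 12) := by rw [Real.exp_neg, one_div]
    _ ≤ _ := by gcongr

theorem tail_pow_le (h : Reg L n l) {y : ℝ} {N : ℕ} (hy : L ^ 2 ≤ 16384 * n * y)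
    (hN : n / (4 * L) ≤ N) :
    ((n : ℝ) ^ 14 * (1 + 16384 * n * y) ^ 2) ^ 2 ≤ (1 + y) ^ N := by
  have hn := h.n_pos
  have hL := h.hL
  have hL0 := h.L_pos
  have hn1 : L ^ 3 ≤ n := (h.pow_le_pow (by norm_num)).trans h.hn
  have hnL : (10 : ℝ) ^ 6 * L ^ 2 ≤ n := by
    refine le_trans ?_ hn1
    rw [pow_succ L 2, mul_comm]; gcongr
  have hL2 : (10 : ℝ) ^ 6 * L ≤ L ^ 2 := by rw [pow_two]; gcongr
  have hn16 : (16384 : ℝ) ≤ n := by linarith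
  set u : ℝ := L ^ 2 / (16384 * n) with hu
  have hu0 : 0 < u := by positivity
  have huy : u ≤ y := by rw [hu, div_le_iff₀ (by positivity)]; linarith
  have hu1 : u ≤ 1 := by rw [hu, div_le_one (by positivity)]; linarith
  have hy0 : 0 < y := lt_of_lt_of_le hu0 huy
  have hN4 : n / (8 * L) + 4 ≤ N := by
    refine le_trans ?_ hN
    have : (32 : ℝ) ≤ n / L := by rw [le_div_iff₀ hL0]; linarith
    have e1 : n / (8 * L) = n / L / 8 := by field_simp
    have e2 : n / (4 * L) = n / L / 4 := by field_simp
    rw [e1, e2]; linarith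
  have hN4' : 4 ≤ N := by
    have : (4 : ℝ) ≤ N := le_trans (by linarith [show (0 : ℝ) ≤ n / (8 * L) by positivity]) hN4
    exact_mod_cast this
  obtain ⟨M, rfl⟩ := Nat.exists_eq_add_of_le hN4'
  push_cast at hN4
  have h1 : 1 + 16384 * n * y ≤ 16384 * n * (1 + y) := by
    have : (1 : ℝ) ≤ 16384 * n := by linarith
    linarith
  have h2 : Real.exp (u / 2) ≤ 1 + y := by
    have h3 : Real.exp (u / 2) ≤ 1 + u := by
      have := Real.exp_bound' (x := u / 2) (by positivity) (by linarith) (n := 1) (by norm_num)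
      simp at this
      linarith
    linarith
  have h3 : (n : ℝ) ^ 36 ≤ (1 + y) ^ M := by
    refine (h.pow_le_exp 36 (y := M * (u / 2)) ?_).trans ?_
    · have : n / (8 * L) ≤ M := by linarith
      calc ((36 : ℕ) : ℝ) * (L / (2 * 10 ^ 7)) ≤ L / 262144 := by push_cast; linarith
        _ = n / (8 * L) * (u / 2) := by rw [hu]; field_simp; norm_num
        _ ≤ _ := by gcongr
    · rw [Real.exp_nat_mul]; gcongr
  calc _ ≤ ((n : ℝ) ^ 14 * (16384 * n * (1 + y)) ^ 2) ^ 2 := by gcongr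
    _ = 16384 ^ 4 * (n : ℝ) ^ 32 * (1 + y) ^ 4 := by ring
    _ ≤ (n : ℝ) ^ 4 * (n : ℝ) ^ 32 * (1 + y) ^ 4 := by gcongr
    _ = (n : ℝ) ^ 36 * (1 + y) ^ 4 := by ring
    _ ≤ (1 + y) ^ M * (1 + y) ^ 4 := by gcongr
    _ = _ := by rw [← pow_add, add_comm M]

/-- A product of at least `n / (4 L)` factors of modulus at most `(1 + l (1 + l) θ² / 16384)^(-1/2)`
is negligible in the tail. -/
theorem prod_le (h : Reg L n l) {θ : ℝ} (hθ : L ^ 2 ≤ n * (l * (1 + l)) * θ ^ 2) {ι : Type*}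
    (S : Finset ι) (f : ι → ℝ)
    (hf : ∀ k ∈ S, f k ^ 2 ≤ 1 / (1 + l * (1 + l) * θ ^ 2 / 16384)) (hS : n / (4 * L) ≤ S.card) :
    ∏ k ∈ S, f k ≤ 1 / (n : ℝ) ^ 14 * om (n * (l * (1 + l))) θ ^ 2 := by
  have hn := h.n_pos
  have ha := h.a_pos
  have hA := h.A_pos
  have h1 := h.tail_pow_le (y := l * (1 + l) * θ ^ 2 / 16384) (N := S.card)
    (by rw [show 16384 * (n : ℝ) * (l * (1 + l) * θ ^ 2 / 16384) = n * (l * (1 + l)) * θ ^ 2 by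
      ring]; exact hθ) hS
  rw [show 16384 * (n : ℝ) * (l * (1 + l) * θ ^ 2 / 16384) = n * (l * (1 + l)) * θ ^ 2 by
      ring] at h1
  unfold om
  apply abs_le_of_sq_le_sq' _ (by positivity) |>.2
  rw [← Finset.prod_pow]
  calc ∏ k ∈ S, f k ^ 2 ≤ ∏ k ∈ S, 1 / (1 + l * (1 + l) * θ ^ 2 / 16384) :=
        Finset.prod_le_prod (fun _ _ => sq_nonneg _) hf
    _ = 1 / (1 + l * (1 + l) * θ ^ 2 / 16384) ^ S.card := by
      rw [Finset.prod_const, one_div_pow]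
    _ ≤ 1 / ((n : ℝ) ^ 14 * (1 + n * (l * (1 + l)) * θ ^ 2) ^ 2) ^ 2 := by gcongr
    _ = _ := by simp only [one_div, inv_pow, mul_inv, mul_pow]

theorem norm_geo_pow_le (h : Reg L n l) {θ : ℝ} (hπ : |θ| ≤ π)
    (hθ : L ^ 2 ≤ n * (l * (1 + l)) * θ ^ 2) :
    ‖geo l θ ^ n‖ ≤ 1 / (n : ℝ) ^ 14 * om (n * (l * (1 + l))) θ ^ 2 := by
  have hA := h.A_pos
  have := h.prod_le hθ (Finset.range n) (fun _ => ‖geo l θ‖)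
    (fun _ _ => (norm_geo_sq_le h.l_pos.le hπ).trans (by gcongr; norm_num))
    (by
      rw [Finset.card_range]
      apply div_le_self h.n_pos.le
      linarith [h.one_le_L])
  rwa [Finset.prod_const, Finset.card_range, ← norm_pow] at this

theorem sq_le_of_tail (h : Reg L n l) {θ : ℝ} (hπ : π ≤ |θ|) :
    L ^ 2 ≤ n * (l * (1 + l)) * θ ^ 2 := by
  have hl := h.hl
  have hL := h.hL
  have hn := h.n_pos
  have hl0 := h.l_pos
  have hL0 := h.L_pos
  have h1 : L ^ 3 ≤ n := (h.pow_le_pow (by norm_num)).trans h.hn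
  have h2 : 1 ≤ θ ^ 2 := by
    rw [← sq_abs]
    nlinarith [Real.pi_gt_three]
  calc L ^ 2 ≤ L ^ 2 * (L * l) := le_mul_of_one_le_right (by positivity) hl
    _ = L ^ 3 * (l * 1) * 1 := by ring
    _ ≤ n * (l * (1 + l)) * θ ^ 2 := by gcongr; linarith

theorem abs_integral_exp_sub_le (h : Reg L n l) {V : ℝ} (hV : n * (l * (1 + l)) / 3 ≤ V) :
    |1 / (2 * π) * (∫ θ in (-π)..π, Real.exp (-(V * θ ^ 2 / 2))) - 1 / √(2 * π * V)|
      ≤ 1 / (n : ℝ) ^ 14 / √(n * (l * (1 + l))) := by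
  have ha := h.a_pos
  have hn := h.n_pos
  have hV0 : 0 < V := lt_of_lt_of_le (by positivity) hV
  have hpi := Real.pi_pos
  have e0 : (fun θ : ℝ => Real.exp (-(V * θ ^ 2 / 2))) = fun θ => Real.exp (-(V / 2) * θ ^ 2) := by
    funext θ; congr 1; ring
  have hInt : MeasureTheory.Integrable fun θ : ℝ => Real.exp (-(V * θ ^ 2 / 2)) := by
    rw [e0]; exact integrable_exp_neg_mul_sq (by positivity)
  have hg : ∫ θ : ℝ, Real.exp (-(V * θ ^ 2 / 2)) = √(π / (V / 2)) := by
    rw [e0, integral_gaussian]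
  have hsplit := MeasureTheory.integral_add_compl (measurableSet_Ioc (a := -π) (b := π)) hInt
  have htail : |∫ θ in (Set.Ioc (-π) π)ᶜ, Real.exp (-(V * θ ^ 2 / 2))|
      ≤ 1 / (n : ℝ) ^ 14 * (π / √(n * (l * (1 + l)))) := by
    rw [abs_of_nonneg (MeasureTheory.integral_nonneg fun θ => (Real.exp_pos _).le)]
    calc _ ≤ ∫ θ in (Set.Ioc (-π) π)ᶜ, 1 / (n : ℝ) ^ 14 * om (n * (l * (1 + l))) θ := by
          apply MeasureTheory.setIntegral_mono_on hInt.integrableOn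
            ((integrable_om ha).const_mul _).integrableOn measurableSet_Ioc.compl
          intro θ hθ
          have hπ : π ≤ |θ| := by
            by_contra hc
            push Not at hc
            rw [abs_lt] at hc
            exact hθ ⟨hc.1, hc.2.le⟩
          have h1 := h.exp_mul_le hV (h.sq_le_of_tail hπ)
          unfold om
          rw [mul_one_div, le_div_iff₀ (by positivity)]
          refine le_trans ?_ h1
          gcongr
          apply le_self_pow₀ _ (by norm_num)
          have : 0 ≤ n * (l * (1 + l)) * θ ^ 2 := by positivity
          linarith
      _ = 1 / (n : ℝ) ^ 14 * ∫ θ in (Set.Ioc (-π) π)ᶜ, om (n * (l * (1 + l))) θ := by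
        rw [MeasureTheory.integral_const_mul]
      _ ≤ _ := by
        gcongr
        exact setIntegral_om_le ha _
  rw [intervalIntegral.integral_of_le (by linarith)]
  have e1 : ∫ θ in Set.Ioc (-π) π, Real.exp (-(V * θ ^ 2 / 2))
      = √(π / (V / 2)) - ∫ θ in (Set.Ioc (-π) π)ᶜ, Real.exp (-(V * θ ^ 2 / 2)) := by
    rw [← hg, ← hsplit]; ring
  have e2 : 1 / (2 * π) * √(π / (V / 2)) = 1 / √(2 * π * V) := by
    rw [show π / (V / 2) = (2 * π) ^ 2 / (2 * π * V) by field_simp, Real.sqrt_div (by positivity),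
      Real.sqrt_sq (by positivity)]
    field_simp
  rw [e1, mul_sub, e2, sub_sub_cancel_left, abs_neg, abs_mul, abs_of_pos (by positivity)]
  calc _ ≤ 1 / (2 * π) * (1 / (n : ℝ) ^ 14 * (π / √(n * (l * (1 + l))))) := by gcongr
    _ = 1 / (n : ℝ) ^ 14 / √(n * (l * (1 + l))) / 2 := by field_simp
    _ ≤ _ := half_le_self (by positivity)

end Reg

end Good

namespace Good

variable {n : ℕ}

theorem norm_cexp_sub_linear_le (x : ℝ) :
    ‖Complex.exp (Complex.I * x) - 1 - Complex.I * x‖ ≤ 2 * x ^ 2 := by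
  rcases le_or_gt |x| 1 with h | h
  · have h1 : ‖Complex.I * (x : ℂ)‖ = |x| := by simp
    have := Complex.norm_exp_sub_one_sub_id_le (x := Complex.I * x) (by rwa [h1])
    rw [h1, sq_abs] at this
    linarith [sq_nonneg x]
  · have h1 : ‖Complex.I * (x : ℂ)‖ = |x| := by simp
    have h2 := norm_sub_le (Complex.exp (Complex.I * x) - 1) (Complex.I * x)
    have h3 := norm_cexp_sub_one_le x
    rw [← sq_abs]
    nlinarith

theorem norm_psi_sub_linear_le (j c : ℕ) (q : ℕ → ℝ) (θ : ℝ) :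
    ‖psi j c q θ - EE j c q - Complex.I * ((θ * EE j c (fun v => q v * (v - (c : ℝ) / (j + 2))) : ℝ) : ℂ)‖
      ≤ 2 * θ ^ 2 * EE j c (fun v => |q v| * (v - (c : ℝ) / (j + 2)) ^ 2) := by
  have e : psi j c q θ - EE j c q
        - Complex.I * ((θ * EE j c (fun v => q v * (v - (c : ℝ) / (j + 2))) : ℝ) : ℂ)
      = ∑ v ∈ Finset.range (c + 1), ((bbw j c v * q v : ℝ) : ℂ)
        * (Complex.exp (Complex.I * ((θ * ((v : ℝ) - (c : ℝ) / (j + 2)) : ℝ) : ℂ)) - 1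
          - Complex.I * ((θ * ((v : ℝ) - (c : ℝ) / (j + 2)) : ℝ) : ℂ)) := by
    unfold psi EE
    push_cast
    simp only [Finset.mul_sum, ← Finset.sum_sub_distrib]
    apply Finset.sum_congr rfl
    intro v _
    ring
  rw [e]
  refine (norm_sum_le _ _).trans ?_
  unfold EE
  rw [Finset.mul_sum]
  apply Finset.sum_le_sum
  intro v _
  rw [norm_mul, Complex.norm_real, Real.norm_eq_abs, abs_mul, abs_of_nonneg (bbw_nonneg _ _ _)]
  have hb := bbw_nonneg j c v
  calc _ ≤ bbw j c v * |q v| * (2 * (θ * ((v : ℝ) - (c : ℝ) / (j + 2))) ^ 2) := by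
        gcongr
        exact norm_cexp_sub_linear_le _
    _ = _ := by ring

theorem norm_psi_le_of_mean_zero (j c : ℕ) (q : ℕ → ℝ) (hq : EE j c q = 0) (θ : ℝ) :
    ‖psi j c q θ‖ ≤ |θ| * EE j c (fun v => |q v * (v - (c : ℝ) / (j + 2))|) := by
  have e : psi j c q θ
      = ∑ v ∈ Finset.range (c + 1), ((bbw j c v * q v : ℝ) : ℂ)
        * (Complex.exp (Complex.I * ((θ * ((v : ℝ) - (c : ℝ) / (j + 2)) : ℝ) : ℂ)) - 1) := by
    have h1 : ((EE j c q : ℝ) : ℂ) = 0 := by rw [hq]; simp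
    rw [← sub_zero (psi j c q θ), ← h1]
    unfold psi EE
    push_cast
    simp only [← Finset.sum_sub_distrib]
    apply Finset.sum_congr rfl
    intro v _
    ring
  rw [e]
  refine (norm_sum_le _ _).trans ?_
  unfold EE
  rw [Finset.mul_sum]
  apply Finset.sum_le_sum
  intro v _
  rw [norm_mul, Complex.norm_real, Real.norm_eq_abs, abs_mul, abs_of_nonneg (bbw_nonneg _ _ _)]
  have hb := bbw_nonneg j c v
  calc _ ≤ bbw j c v * |q v| * |θ * ((v : ℝ) - (c : ℝ) / (j + 2))| := by
        gcongr
        exact norm_cexp_sub_one_le _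
    _ = _ := by simp only [abs_mul]; ring

theorem OP_prod_finset (s j : ℕ) (c : Fin n → ℕ) (hc : ∑ k, c k = (j + 2) * s)
    (R : Finset (Fin n)) (q : Fin n → ℕ → ℝ) :
    ((OP s j c (fun v => ∏ k ∈ R, q k (v k)) : ℝ) : ℂ)
      = 1 / (2 * π) * ∫ θ in (-π)..π, (∏ k ∈ R, psi j (c k) (q k) θ)
        * ∏ k ∈ Rᶜ, psi j (c k) (fun _ => 1) θ := by
  have h := OP_prod s j c hc (fun k => if k ∈ R then q k else fun _ => 1)
  have e1 : (fun v : Fin n → ℕ => ∏ k, (if k ∈ R then q k else fun _ => 1) (v k))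
      = fun v => ∏ k ∈ R, q k (v k) := by
    funext v
    rw [← Finset.prod_mul_prod_compl R]
    rw [Finset.prod_congr rfl (g := fun k => q k (v k)) (fun k hk => by rw [if_pos hk]),
      Finset.prod_eq_one (s := Rᶜ) (fun k hk => by rw [if_neg (Finset.mem_compl.1 hk)]), mul_one]
  have e2 : (fun θ : ℝ => ∏ k, psi j (c k) (if k ∈ R then q k else fun _ => 1) θ)
      = fun θ => (∏ k ∈ R, psi j (c k) (q k) θ) * ∏ k ∈ Rᶜ, psi j (c k) (fun _ => 1) θ := by
    funext θ
    rw [← Finset.prod_mul_prod_compl R]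
    rw [Finset.prod_congr rfl (g := fun k => psi j (c k) (q k) θ) (fun k hk => by rw [if_pos hk]),
      Finset.prod_congr (s₁ := Rᶜ) rfl (g := fun k => psi j (c k) (fun _ => 1) θ)
        (fun k hk => by rw [if_neg (Finset.mem_compl.1 hk)])]
  simp only [e1, e2] at h
  exact h

namespace Step

variable {L : ℝ} {s j : ℕ} {c : Fin n → ℕ}

theorem card_large (h : Step L s j c) (R : Finset (Fin n)) (hR : R.card ≤ 2) :
    n / (4 * L) ≤ ((Finset.univ.filter fun k => (s : ℝ) / n / 2 ≤ (c k : ℝ) / (j + 2)) \ R).card := by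
  have hL := h.reg.L_pos
  have hn := h.reg.n_pos
  have hl := h.reg.l_pos
  set S := Finset.univ.filter fun k : Fin n => (s : ℝ) / n / 2 ≤ (c k : ℝ) / (j + 2) with hS
  have h1 := h.sum_x
  have h2 : ∑ k, (c k : ℝ) / (j + 2)
      ≤ ∑ k : Fin n, ((if k ∈ S then L * ((s : ℝ) / n) else 0) + (s : ℝ) / n / 2) := by
    apply Finset.sum_le_sum
    intro k _
    by_cases hk : k ∈ S
    · rw [if_pos hk]; linarith [h.hx k]
    · rw [if_neg hk]
      have : ¬ ((s : ℝ) / n / 2 ≤ (c k : ℝ) / (j + 2)) := by simpa [hS] using hk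
      linarith
  rw [h1, Finset.sum_add_distrib, Finset.sum_ite_mem, Finset.univ_inter] at h2
  simp only [Finset.sum_const, Finset.card_univ, Fintype.card_fin, nsmul_eq_mul] at h2
  have h3 : (n : ℝ) ≤ 2 * L * S.card := by
    have : (n : ℝ) * ((s : ℝ) / n) ≤ (2 * L * S.card) * ((s : ℝ) / n) := by linarith
    exact le_of_mul_le_mul_right this hl
  have h4 : (S.card : ℝ) ≤ (S \ R).card + 2 := by
    have := Finset.le_card_sdiff R S
    have : S.card ≤ (S \ R).card + 2 := by omega
    exact_mod_cast this
  have h5 : 8 * L ≤ n := by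
    have h6 : 8 * L ^ 1 ≤ L ^ 2 := h.reg.mul_pow_le (by norm_num)
    have := (h.reg.pow_le_pow (p := 2) (q := 100) (by norm_num)).trans h.reg.hn
    linarith
  rw [div_le_iff₀ (by positivity)]
  have := mul_le_mul_of_nonneg_left h4 hL.le
  linarith

theorem norm_psi_one_le (k : Fin n) (θ : ℝ) : ‖psi j (c k) (fun _ => 1) θ‖ ≤ 1 := by
  rw [norm_psi_one]; exact norm_chi_le_one _ _ _

theorem norm_prod_psi_tail_le (h : Step L s j c) (R : Finset (Fin n)) (hR : R.card ≤ 2) {θ : ℝ}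
    (hπ : |θ| ≤ π) (hθ : L ^ 2 ≤ n * ((s : ℝ) / n * (1 + (s : ℝ) / n)) * θ ^ 2) :
    ‖∏ k ∈ Rᶜ, psi j (c k) (fun _ => 1) θ‖
      ≤ 1 / (n : ℝ) ^ 14 * om (n * ((s : ℝ) / n * (1 + (s : ℝ) / n))) θ ^ 2 := by
  have hl := h.reg.l_pos
  set S := Finset.univ.filter fun k : Fin n => (s : ℝ) / n / 2 ≤ (c k : ℝ) / (j + 2) with hS
  have h1 := h.reg.prod_le hθ (S \ R) (fun k => ‖psi j (c k) (fun _ => 1) θ‖) (fun k hk => by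
    have hk' : (s : ℝ) / n / 2 ≤ (c k : ℝ) / (j + 2) := by
      simp only [hS, Finset.mem_sdiff, Finset.mem_filter] at hk
      exact hk.1.2
    rw [norm_psi_one]
    refine (norm_chi_sq_le j (c k) hπ).trans ?_
    have h2 : (s : ℝ) / n / 2 * (1 + (s : ℝ) / n / 2)
        ≤ (c k : ℝ) / (j + 2) * (1 + (c k : ℝ) / (j + 2)) := by gcongr
    have h3 : (s : ℝ) / n * (1 + (s : ℝ) / n) ≤ 4 * ((s : ℝ) / n / 2 * (1 + (s : ℝ) / n / 2)) := by
      nlinarith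
    apply one_div_le_one_div_of_le (by positivity)
    have := mul_le_mul_of_nonneg_right (h3.trans (mul_le_mul_of_nonneg_left h2 (by norm_num)))
      (sq_nonneg θ)
    linarith) (h.card_large R hR)
  refine le_trans ?_ h1
  rw [norm_prod]
  have hsub : S \ R ⊆ Rᶜ := by
    intro k hk
    rw [Finset.mem_compl]
    exact (Finset.mem_sdiff.1 hk).2
  rw [← Finset.prod_sdiff hsub]
  exact mul_le_of_le_one_left (Finset.prod_nonneg fun _ _ => norm_nonneg _)
    (Finset.prod_le_one (fun _ _ => norm_nonneg _) fun k _ => norm_psi_one_le k θ)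

theorem norm_prod_psi_le (h : Step L s j c) (R : Finset (Fin n)) (hR : R.card ≤ 2) {θ : ℝ}
    (hπ : |θ| ≤ π) :
    ‖∏ k ∈ Rᶜ, psi j (c k) (fun _ => 1) θ‖
      ≤ L ^ 6 * om (n * ((s : ℝ) / n * (1 + (s : ℝ) / n))) θ ^ 2 := by
  have ha := h.reg.a_pos
  rcases le_or_gt (L ^ 2) (n * ((s : ℝ) / n * (1 + (s : ℝ) / n)) * θ ^ 2) with hθ | hθ
  · refine (h.norm_prod_psi_tail_le R hR hπ hθ).trans ?_
    gcongr
    refine le_trans ?_ (h.reg.one_le_pow 6)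
    rw [div_le_one (pow_pos h.reg.n_pos _)]
    exact one_le_pow₀ ((h.reg.one_le_pow 100).trans h.reg.hn)
  · have h1 := h.reg.one_le_om_mul hθ.le
    have h2 : ‖∏ k ∈ Rᶜ, psi j (c k) (fun _ => 1) θ‖ ≤ 1 := by
      rw [norm_prod]
      exact Finset.prod_le_one (fun _ _ => norm_nonneg _) fun k _ => norm_psi_one_le k θ
    calc _ ≤ (1 : ℝ) ^ 2 := by simpa using h2
      _ ≤ (L ^ 3 * om (n * ((s : ℝ) / n * (1 + (s : ℝ) / n))) θ) ^ 2 := by gcongr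
      _ = _ := by ring

theorem abs_OP_le (h : Step L s j c) (k : Fin n) (q : ℕ → ℝ) :
    |OP s j c (fun v => q (v k))|
      ≤ L ^ 6 * EE j (c k) (fun v => |q v|) / √(n * ((s : ℝ) / n * (1 + (s : ℝ) / n))) := by
  have h1 := OP_prod_finset s j c h.hc {k} (fun _ => q)
  simp only [Finset.prod_singleton] at h1
  have ha := h.reg.a_pos
  have hL := h.reg.L_pos
  have hE : 0 ≤ EE j (c k) (fun v => |q v|) := EE_nonneg fun _ _ => abs_nonneg _
  rw [← Real.norm_eq_abs, ← Complex.norm_real, h1]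
  apply norm_integral_le_of_le_om ha (by positivity)
  intro θ hθ
  have h2 := h.norm_prod_psi_le {k} (by simp) hθ
  have h3 := om_le_one ha.le θ
  have h4 := om_pos ha.le θ
  rw [norm_mul]
  calc _ ≤ EE j (c k) (fun v => |q v|)
        * (L ^ 6 * om (n * ((s : ℝ) / n * (1 + (s : ℝ) / n))) θ ^ 2) :=
        mul_le_mul (norm_psi_le _ _ _ _) h2 (norm_nonneg _) hE
    _ = L ^ 6 * EE j (c k) (fun v => |q v|)
        * om (n * ((s : ℝ) / n * (1 + (s : ℝ) / n))) θ ^ 2 := by ring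
    _ ≤ _ := by
      gcongr
      rw [pow_two]
      exact mul_le_of_le_one_left h4.le h3

theorem abs_OP_mul_le (h : Step L s j c) {k k' : Fin n} (hk : k ≠ k') (q q' : ℕ → ℝ)
    (hq : EE j (c k) q = 0) (hq' : EE j (c k') q' = 0) :
    |OP s j c (fun v => q (v k) * q' (v k'))|
      ≤ L ^ 6 / (n * ((s : ℝ) / n * (1 + (s : ℝ) / n)))
        * (EE j (c k) (fun v => |q v * (v - (c k : ℝ) / (j + 2))|)
          * EE j (c k') (fun v => |q' v * (v - (c k' : ℝ) / (j + 2))|))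
        / √(n * ((s : ℝ) / n * (1 + (s : ℝ) / n))) := by
  have h1 := OP_prod_finset s j c h.hc {k, k'} (fun i => if i = k then q else q')
  simp only [Finset.prod_pair hk, if_true, if_neg hk.symm] at h1
  have ha := h.reg.a_pos
  have hL := h.reg.L_pos
  have hE : 0 ≤ EE j (c k) (fun v => |q v * (v - (c k : ℝ) / (j + 2))|) :=
    EE_nonneg fun _ _ => abs_nonneg _
  have hE' : 0 ≤ EE j (c k') (fun v => |q' v * (v - (c k' : ℝ) / (j + 2))|) :=
    EE_nonneg fun _ _ => abs_nonneg _
  rw [← Real.norm_eq_abs, ← Complex.norm_real, h1]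
  apply norm_integral_le_of_le_om ha (by positivity)
  intro θ hθ
  have h2 := h.norm_prod_psi_le {k, k'} (Finset.card_le_two) hθ
  have h3 := mul_om_le_one ha.le θ
  have h4 := om_pos ha.le θ
  have h5 := norm_psi_le_of_mean_zero _ _ q hq θ
  have h6 := norm_psi_le_of_mean_zero _ _ q' hq' θ
  rw [norm_mul, norm_mul]
  set a := n * ((s : ℝ) / n * (1 + (s : ℝ) / n)) with ha'
  set E := EE j (c k) (fun v => |q v * (v - (c k : ℝ) / (j + 2))|)
  set E' := EE j (c k') (fun v => |q' v * (v - (c k' : ℝ) / (j + 2))|)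
  calc _ ≤ (|θ| * E * (|θ| * E')) * (L ^ 6 * om a θ ^ 2) := by gcongr
    _ = L ^ 6 / a * (E * E') * om a θ * (a * |θ| ^ 2 * om a θ) := by
      field_simp
    _ ≤ L ^ 6 / a * (E * E') * om a θ * 1 := by
      rw [sq_abs]; gcongr
    _ = _ := by ring

end Step

end Good

namespace Good

variable {n : ℕ}

theorem EE_const_mul_sq (j c : ℕ) :
    EE j c (fun v => |(1 : ℝ)| * ((v : ℝ) - (c : ℝ) / (j + 2)) ^ 2)
      ≤ (c : ℝ) / (j + 2) * (1 + (c : ℝ) / (j + 2)) := by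
  simp only [abs_one, one_mul]
  rw [EE_var]
  apply mul_le_of_le_one_right (by positivity)
  rw [div_le_one (by positivity)]
  linarith

theorem abs_EE_mul_le (j c : ℕ) (q : ℕ → ℝ) (y : ℕ → ℝ) {A : ℝ} (hA : 0 < A) :
    EE j c (fun v => |q v * y v|)
      ≤ √A * (EE j c (fun v => |q v|) + EE j c (fun v => |q v| * y v ^ 2) / A) := by
  have e : √A * (EE j c (fun v => |q v|) + EE j c (fun v => |q v| * y v ^ 2) / A)
      = EE j c (fun v => √A * |q v| + √A / A * (|q v| * y v ^ 2)) := by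
    rw [EE_add, EE_mul_left, EE_mul_left]; ring
  rw [e]
  apply EE_mono
  intro v _
  rw [abs_mul]
  have hs := Real.sqrt_pos.2 hA
  have h1 : |y v| ≤ √A + √A / A * y v ^ 2 := by
    have h2 : √A / A = 1 / √A := by
      rw [div_eq_div_iff hA.ne' hs.ne', one_mul, Real.mul_self_sqrt hA.le]
    rw [h2, ← sq_abs, one_div_mul_eq_div]
    have h3 : |y v| * √A ≤ √A * √A + |y v| ^ 2 := by
      nlinarith [sq_nonneg (|y v| - √A), abs_nonneg (y v)]
    calc |y v| = |y v| * √A / √A := by field_simp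
      _ ≤ (√A * √A + |y v| ^ 2) / √A := by gcongr
      _ = _ := by field_simp
  calc |q v| * |y v| ≤ |q v| * (√A + √A / A * y v ^ 2) := by gcongr
    _ = _ := by ring

namespace Reg

variable {L l : ℝ}

theorem one_le_n (h : Reg L n l) : (1 : ℝ) ≤ n := (h.one_le_pow 100).trans h.hn

theorem exp_le_tail (h : Reg L n l) {V θ : ℝ} (hV : n * (l * (1 + l)) / 3 ≤ V)
    (hθ : L ^ 2 ≤ n * (l * (1 + l)) * θ ^ 2) :
    Real.exp (-(V * θ ^ 2 / 2)) * (1 + n * (l * (1 + l)) * θ ^ 2)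
      ≤ 1 / (n : ℝ) ^ 14 * om (n * (l * (1 + l))) θ := by
  have h1 := h.exp_mul_le hV hθ
  have ha := h.a_pos
  have h2 : 0 ≤ n * (l * (1 + l)) * θ ^ 2 := by positivity
  unfold om
  rw [mul_one_div, le_div_iff₀ (by positivity)]
  refine le_trans ?_ h1
  rw [mul_assoc]
  gcongr
  rw [← pow_two]
  exact pow_le_pow_right₀ (by linarith) (by norm_num)

theorem exp_le_tail' (h : Reg L n l) {V θ : ℝ} (hV : n * (l * (1 + l)) / 3 ≤ V)
    (hθ : L ^ 2 ≤ n * (l * (1 + l)) * θ ^ 2) :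
    Real.exp (-(V * θ ^ 2 / 2)) ≤ 1 / (n : ℝ) ^ 14 * om (n * (l * (1 + l))) θ := by
  refine le_trans ?_ (h.exp_le_tail hV hθ)
  have ha := h.a_pos
  have h2 : 0 ≤ n * (l * (1 + l)) * θ ^ 2 := by positivity
  exact le_mul_of_one_le_right (Real.exp_pos _).le (by linarith)

end Reg

namespace Step

variable {L : ℝ} {s j : ℕ} {c : Fin n → ℕ}

theorem var_le (h : Step L s j c) (k : Fin n) :
    (c k : ℝ) / (j + 2) * (1 + (c k : ℝ) / (j + 2)) ≤ L ^ 2 * ((s : ℝ) / n * (1 + (s : ℝ) / n)) := by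
  have h1 := h.hx k
  have hl := h.reg.l_pos
  have hL := h.reg.one_le_L
  have h2 : (c k : ℝ) / (j + 2) ≤ L * ((s : ℝ) / n) := h1
  calc _ ≤ L * ((s : ℝ) / n) * (1 + L * ((s : ℝ) / n)) := by gcongr
    _ ≤ L * ((s : ℝ) / n) * (L * 1 + L * ((s : ℝ) / n)) := by gcongr; linarith
    _ = _ := by ring

theorem norm_prod_erase_sub_exp_le (h : Step L s j c) (k : Fin n) {θ : ℝ}
    (hθ : n * ((s : ℝ) / n * (1 + (s : ℝ) / n)) * θ ^ 2 ≤ L ^ 2) :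
    ‖∏ i ∈ {k}ᶜ, psi j (c i) (fun _ => 1) θ - Real.exp (-(VV j c * θ ^ 2 / 2))‖
      ≤ L ^ 14 / √n := by
  have h1 := h.norm_prod_psi_sub_exp_le hθ
  have hL := h.reg.L_pos
  have hn := h.reg.n_pos
  have hA := h.reg.A_pos
  rw [← Finset.prod_mul_prod_compl {k}, Finset.prod_singleton] at h1
  set P := ∏ i ∈ {k}ᶜ, psi j (c i) (fun _ => 1) θ with hP
  have hP1 : ‖P‖ ≤ 1 := by
    rw [hP, norm_prod]
    exact Finset.prod_le_one (fun _ _ => norm_nonneg _) fun i _ => norm_psi_one_le i θ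
  have h2 : ‖psi j (c k) (fun _ => 1) θ - 1‖ ≤ 2 * L ^ 4 / n := by
    have h3 := norm_psi_sub_linear_le j (c k) (fun _ => 1) θ
    simp only [one_mul] at h3
    rw [EE_sub_mean, EE_const] at h3
    simp only [mul_zero, Complex.ofReal_zero, Complex.ofReal_one, sub_zero] at h3
    refine h3.trans ?_
    have h4 := (EE_const_mul_sq j (c k)).trans (h.var_le k)
    simp only [abs_one, one_mul] at h4
    rw [le_div_iff₀ hn]
    rw [abs_one, ]
    simp only [one_mul]
    calc _ ≤ 2 * θ ^ 2 * (L ^ 2 * ((s : ℝ) / n * (1 + (s : ℝ) / n))) * n := by gcongr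
      _ = 2 * L ^ 2 * (n * ((s : ℝ) / n * (1 + (s : ℝ) / n)) * θ ^ 2) := by ring
      _ ≤ 2 * L ^ 2 * L ^ 2 := by gcongr
      _ = _ := by ring
  have h5 : 2 * L ^ 4 / n ≤ L ^ 5 / √n := by
    rw [div_le_div_iff₀ hn (by positivity)]
    have h6 : 2 * L ^ 4 ≤ L ^ 5 := h.reg.mul_pow_le (by norm_num)
    have h7 : √n ≤ n := by
      rw [Real.sqrt_le_left hn.le]
      exact le_self_pow₀ h.reg.one_le_n (by norm_num)
    gcongr
  have e : P - Real.exp (-(VV j c * θ ^ 2 / 2))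
      = (psi j (c k) (fun _ => 1) θ * P - Real.exp (-(VV j c * θ ^ 2 / 2)))
        - (psi j (c k) (fun _ => 1) θ - 1) * P := by ring
  rw [e]
  refine (norm_sub_le _ _).trans ?_
  rw [norm_mul]
  calc _ ≤ L ^ 13 / √n + 2 * L ^ 4 / n * 1 := by gcongr
    _ ≤ L ^ 13 / √n + L ^ 5 / √n := by rw [mul_one]; gcongr
    _ = (L ^ 13 + L ^ 5) / √n := by ring
    _ ≤ _ := by
      gcongr
      have p1 := h.reg.pow_le_pow (p := 5) (q := 13) (by norm_num)
      have p2 : 2 * L ^ 13 ≤ L ^ 14 := h.reg.mul_pow_le (by norm_num)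
      linarith

theorem abs_OP_le_of_mean_zero (h : Step L s j c) (k : Fin n) (q : ℕ → ℝ)
    (hq : EE j (c k) q = 0) :
    |OP s j c (fun v => q (v k))|
      ≤ L ^ 20 / n * (EE j (c k) (fun v => |q v|)
        + EE j (c k) (fun v => |q v| * (v - (c k : ℝ) / (j + 2)) ^ 2)
          / ((s : ℝ) / n * (1 + (s : ℝ) / n)))
        / √(n * ((s : ℝ) / n * (1 + (s : ℝ) / n))) := by
  have h1 := OP_prod_finset s j c h.hc {k} (fun _ => q)
  simp only [Finset.prod_singleton] at h1
  have ha := h.reg.a_pos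
  have hL := h.reg.L_pos
  have hn := h.reg.n_pos
  have hA := h.reg.A_pos
  have hE : 0 ≤ EE j (c k) (fun v => |q v|) := EE_nonneg fun _ _ => abs_nonneg _
  have hE2 : 0 ≤ EE j (c k) (fun v => |q v| * (v - (c k : ℝ) / (j + 2)) ^ 2) :=
    EE_nonneg fun _ _ => mul_nonneg (abs_nonneg _) (sq_nonneg _)
  have hE1 := abs_EE_mul_le j (c k) q (fun v => v - (c k : ℝ) / (j + 2)) hA
  have hE0 := EE_abs_le j (c k) (fun v => q v * (v - (c k : ℝ) / (j + 2)))
  have hV := h.le_VV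
  have hcont : Continuous fun θ => psi j (c k) q θ * ∏ i ∈ {k}ᶜ, psi j (c i) (fun _ => 1) θ :=
    (continuous_psi _ _ _).mul (continuous_finsetProd _ fun i _ => continuous_psi _ _ _)
  set D := EE j (c k) (fun v => q v * (v - (c k : ℝ) / (j + 2))) with hD
  set E2 := EE j (c k) (fun v => |q v| * (v - (c k : ℝ) / (j + 2)) ^ 2) with hE2'
  set E := EE j (c k) (fun v => |q v|) with hE'
  have hlin : ∀ θ : ℝ, ‖psi j (c k) q θ - Complex.I * ((θ * D : ℝ) : ℂ)‖ ≤ 2 * θ ^ 2 * E2 := by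
    intro θ
    have := norm_psi_sub_linear_le j (c k) q θ
    rwa [hq, Complex.ofReal_zero, sub_zero] at this
  have hct := fun θ hθ => h.norm_prod_erase_sub_exp_le k (θ := θ) hθ
  have htl := fun θ hπ hθ => h.norm_prod_psi_tail_le {k} (by simp) (θ := θ) hπ hθ
  have hP1 : ∀ θ, ‖∏ i ∈ {k}ᶜ, psi j (c i) (fun _ => 1) θ‖ ≤ 1 := by
    intro θ
    rw [norm_prod]
    exact Finset.prod_le_one (fun _ _ => norm_nonneg _) fun i _ => norm_psi_one_le i θ
  have hq1 : ∀ θ, ‖psi j (c k) q θ‖ ≤ E := fun θ => norm_psi_le _ _ _ _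
  have hto := fun θ hθ => h.reg.one_le_om_mul (θ := θ) hθ
  have htt := fun θ hθ => h.reg.t_le (θ := θ) hθ
  set P := fun θ => ∏ i ∈ {k}ᶜ, psi j (c i) (fun _ => 1) θ with hP
  set A := (s : ℝ) / n * (1 + (s : ℝ) / n) with hA'
  have hsA := Real.sqrt_pos.2 hA
  have hsn := Real.sqrt_pos.2 hn
  have hM0 : 0 ≤ E + E2 / A := by positivity
  have hDM : |D| ≤ √A * (E + E2 / A) := hE0.trans hE1
  rw [← Real.norm_eq_abs, ← Complex.norm_real, h1]
  have hodd : ∫ θ in (-π)..π, Complex.I * ((θ * D : ℝ) : ℂ) * Real.exp (-(VV j c * θ ^ 2 / 2)) = 0 := by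
    apply integral_odd_eq_zero
    intro θ
    rw [neg_sq]; push_cast; ring
  have hsub : ∫ θ in (-π)..π, psi j (c k) q θ * P θ = ∫ θ in (-π)..π, (psi j (c k) q θ * P θ
      - Complex.I * ((θ * D : ℝ) : ℂ) * Real.exp (-(VV j c * θ ^ 2 / 2))) := by
    rw [intervalIntegral.integral_sub, hodd, sub_zero]
    · exact hcont.intervalIntegrable _ _
    · apply Continuous.intervalIntegrable
      fun_prop
  rw [hsub]
  apply norm_integral_le_of_le_om ha (by positivity)
  intro θ hπ
  have hom := om_pos ha.le θ
  have hom1 := om_le_one ha.le θ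
  rcases le_or_gt (L ^ 2) (n * A * θ ^ 2) with hθ | hθ
  · have g1 := htl θ hπ hθ
    have g2 := h.reg.exp_le_tail hV hθ
    have g3 : |θ| * |D| ≤ (1 + n * A * θ ^ 2) * (E + E2 / A) := by
      have g4 : |θ| * √A ≤ 1 + n * A * θ ^ 2 := by
        have : 0 ≤ (1 - |θ| * √A) ^ 2 := sq_nonneg _
        have e2 : (|θ| * √A) ^ 2 = A * θ ^ 2 := by rw [mul_pow, sq_abs, Real.sq_sqrt hA.le]; ring
        have e3 : A * θ ^ 2 ≤ n * (A * θ ^ 2) :=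
          le_mul_of_one_le_left (by positivity) h.reg.one_le_n
        have e4 : 0 ≤ |θ| * √A := by positivity
        nlinarith
      calc _ ≤ |θ| * (√A * (E + E2 / A)) := by gcongr
        _ = |θ| * √A * (E + E2 / A) := by ring
        _ ≤ _ := by gcongr
    have g5 : ‖Complex.I * ((θ * D : ℝ) : ℂ) * Real.exp (-(VV j c * θ ^ 2 / 2))‖
        ≤ (E + E2 / A) * (1 / (n : ℝ) ^ 14 * om (n * A) θ) := by
      rw [norm_mul, norm_mul, Complex.norm_I, one_mul, Complex.norm_real, Complex.norm_real,
        Real.norm_eq_abs, Real.norm_eq_abs, abs_mul, abs_of_pos (Real.exp_pos _)]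
      calc _ ≤ (1 + n * A * θ ^ 2) * (E + E2 / A) * Real.exp (-(VV j c * θ ^ 2 / 2)) := by gcongr
        _ = (E + E2 / A) * (Real.exp (-(VV j c * θ ^ 2 / 2)) * (1 + n * A * θ ^ 2)) := by ring
        _ ≤ _ := by gcongr
    have g6 : ‖psi j (c k) q θ * P θ‖ ≤ (E + E2 / A) * (1 / (n : ℝ) ^ 14 * om (n * A) θ) := by
      rw [norm_mul]
      calc _ ≤ (E + E2 / A) * (1 / (n : ℝ) ^ 14 * om (n * A) θ ^ 2) := by
            gcongr
            refine (hq1 θ).trans ?_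
            linarith [show 0 ≤ E2 / A by positivity]
        _ ≤ _ := by
          gcongr
          rw [pow_two]; exact mul_le_of_le_one_left hom.le hom1
    refine (norm_sub_le _ _).trans ((add_le_add g6 g5).trans ?_)
    have g7 : 2 * (1 / (n : ℝ) ^ 14) ≤ L ^ 20 / n := by
      have : 2 ≤ L ^ 20 := le_trans (by linarith [h.reg.hL]) (le_self_pow₀ h.reg.one_le_L (by norm_num))
      rw [mul_one_div]
      gcongr
      exact le_self_pow₀ h.reg.one_le_n (by norm_num)
    calc _ = 2 * (1 / (n : ℝ) ^ 14) * (E + E2 / A) * om (n * A) θ := by ring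
      _ ≤ _ := by gcongr
  · have hθ := hθ.le
    have g1 := hct θ hθ
    have g2 := htt θ hθ
    have g3 := hto θ hθ
    have e : psi j (c k) q θ * P θ
          - Complex.I * ((θ * D : ℝ) : ℂ) * Real.exp (-(VV j c * θ ^ 2 / 2))
        = (psi j (c k) q θ - Complex.I * ((θ * D : ℝ) : ℂ)) * P θ
          + Complex.I * ((θ * D : ℝ) : ℂ) * (P θ - Real.exp (-(VV j c * θ ^ 2 / 2))) := by ring
    have g4 : 2 * θ ^ 2 * E2 ≤ 2 * L ^ 2 / n * (E + E2 / A) := by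
      have : θ ^ 2 ≤ L ^ 2 / (n * A) := by rw [le_div_iff₀ ha]; linarith
      calc _ ≤ 2 * (L ^ 2 / (n * A)) * E2 := by gcongr
        _ = 2 * L ^ 2 / n * (E2 / A) := by field_simp
        _ ≤ _ := by gcongr; linarith
    have g5 : |θ| * |D| * (L ^ 14 / √n) ≤ L ^ 15 / n * (E + E2 / A) := by
      calc _ ≤ |θ| * (√A * (E + E2 / A)) * (L ^ 14 / √n) := by gcongr
        _ = √A * |θ| * (E + E2 / A) * (L ^ 14 / √n) := by ring
        _ ≤ L / √n * (E + E2 / A) * (L ^ 14 / √n) := by gcongr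
        _ = L ^ 15 / (√n * √n) * (E + E2 / A) := by field_simp
        _ = _ := by rw [Real.mul_self_sqrt hn.le]
    rw [e]
    refine (norm_add_le _ _).trans ?_
    rw [norm_mul, norm_mul, norm_mul, Complex.norm_I, one_mul, Complex.norm_real,
      Real.norm_eq_abs, abs_mul]
    have p0 := h.reg.pow_le_pow (p := 2) (q := 15) (by norm_num)
    have p1 : 3 * L ^ 15 ≤ L ^ 16 := h.reg.mul_pow_le (by norm_num)
    have p2 := h.reg.pow_le_pow (p := 16) (q := 17) (by norm_num)
    calc _ ≤ 2 * θ ^ 2 * E2 * 1 + |θ| * |D| * (L ^ 14 / √n) := by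
          gcongr
          · exact hlin θ
          · exact hP1 θ
      _ ≤ 2 * L ^ 2 / n * (E + E2 / A) + L ^ 15 / n * (E + E2 / A) := by
        rw [mul_one]; exact add_le_add g4 g5
      _ = (2 * L ^ 2 + L ^ 15) / n * (E + E2 / A) * 1 := by ring
      _ ≤ L ^ 17 / n * (E + E2 / A) * (L ^ 3 * om (n * A) θ) := by
        gcongr
        linarith
      _ = _ := by ring

end Step

end Good

namespace Good

variable {n : ℕ}

theorem abs_exp_neg_sub_le {x y : ℝ} (hx : 0 ≤ x) (hy : 0 ≤ y) :
    |Real.exp (-x) - Real.exp (-y)| ≤ |x - y| := by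
  wlog hxy : x ≤ y generalizing x y
  · rw [abs_sub_comm, abs_sub_comm x]; exact this hy hx (by linarith)
  have h1 : Real.exp (-y) = Real.exp (-x) * Real.exp (-(y - x)) := by
    rw [← Real.exp_add]; congr 1; ring
  have h2 : Real.exp (-x) ≤ 1 := Real.exp_le_one_iff.2 (by linarith)
  have h3 := Real.add_one_le_exp (-(y - x))
  have h4 : Real.exp (-(y - x)) ≤ 1 := Real.exp_le_one_iff.2 (by linarith)
  rw [abs_of_nonneg (by rw [h1]; nlinarith [Real.exp_pos (-x)]), abs_of_nonpos (by linarith), h1]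
  nlinarith [Real.exp_pos (-x)]

theorem two_pi_sqrt_bounds : (5 : ℝ) / 2 ≤ √(2 * π) ∧ √(2 * π) ≤ 251 / 100 := by
  constructor
  · apply Real.le_sqrt_of_sq_le
    linarith [Real.pi_gt_d2]
  · rw [Real.sqrt_le_left (by norm_num)]
    linarith [Real.pi_lt_d2]

namespace Reg

variable {L : ℝ} {s : ℕ}

theorem inv_pow_le (h : Reg L n ((s : ℝ) / n)) {p : ℕ} (C : ℝ) (hC : C ≤ 10 ^ 6) :
    C * (1 / (n : ℝ) ^ 14) ≤ L ^ (p + 1) / √n := by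
  have hn := h.n_pos
  have hL := h.L_pos
  have h1 : √n ≤ (n : ℝ) ^ 14 := by
    rw [Real.sqrt_le_left (by positivity), ← pow_mul]
    exact le_self_pow₀ h.one_le_n (by norm_num)
  rw [mul_one_div]
  rcases le_or_gt C 0 with h0 | h0
  · exact (div_nonpos_of_nonpos_of_nonneg h0 (by positivity)).trans (by positivity)
  gcongr
  have := h.mul_pow_le (p := p) hC
  refine le_trans ?_ this
  exact le_mul_of_one_le_right h0.le (h.one_le_pow p)

theorem abs_gg_sub_le (h : Reg L n ((s : ℝ) / n)) :
    |gg n s - 1 / √(2 * π * (n * ((s : ℝ) / n * (1 + (s : ℝ) / n))))|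
      ≤ L ^ 10 / √n / √(n * ((s : ℝ) / n * (1 + (s : ℝ) / n))) := by
  have ha := h.a_pos
  have hn := h.n_pos
  have hL := h.L_pos
  have h1 := gg_eq_integral n s (by exact_mod_cast hn)
  have h2 := h.abs_integral_exp_sub_le (V := n * ((s : ℝ) / n * (1 + (s : ℝ) / n))) (by linarith)
  have hct := fun θ hθ => h.norm_geo_pow_sub_le (θ := θ) hθ
  have htl := fun θ hπ hθ => h.norm_geo_pow_le (θ := θ) hπ hθ
  have hto := fun θ hθ => h.one_le_om_mul (θ := θ) hθ
  have htg := fun θ hθ => h.exp_le_tail' (θ := θ)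
    (V := n * ((s : ℝ) / n * (1 + (s : ℝ) / n))) (by linarith) hθ
  have hi := h.inv_pow_le (p := 8) 2 (by norm_num)
  set a := n * ((s : ℝ) / n * (1 + (s : ℝ) / n)) with ha'
  set l := (s : ℝ) / n with hl
  have h3 : ‖1 / (2 * π) * ∫ θ in (-π)..π, (geo l θ ^ n - Real.exp (-(a * θ ^ 2 / 2)))‖
      ≤ L ^ 9 / √n / √a := by
    apply norm_integral_le_of_le_om ha (by positivity)
    intro θ hπ
    have hom := om_pos ha.le θ
    have hom1 := om_le_one ha.le θ
    rcases le_or_gt (L ^ 2) (a * θ ^ 2) with hθ | hθ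
    · have g1 := htl θ hπ hθ
      have g2 := htg θ hθ
      have g3 : om a θ ^ 2 ≤ om a θ := by
        rw [pow_two]; exact mul_le_of_le_one_left hom.le hom1
      refine (norm_sub_le _ _).trans ?_
      rw [Complex.norm_real, Real.norm_eq_abs, abs_of_pos (Real.exp_pos _)]
      calc _ ≤ 1 / (n : ℝ) ^ 14 * om a θ + 1 / (n : ℝ) ^ 14 * om a θ := by
            refine add_le_add (g1.trans ?_) g2
            gcongr
        _ = 2 * (1 / (n : ℝ) ^ 14) * om a θ := by ring
        _ ≤ _ := by gcongr
    · have g3 := hto θ hθ.le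
      have g4 : Real.exp (-(a * θ ^ 2 / 2)) ≤ 1 := Real.exp_le_one_iff.2 (by
        have : 0 ≤ a * θ ^ 2 := by positivity
        linarith)
      calc _ ≤ Real.exp (-(a * θ ^ 2 / 2)) * (L ^ 6 / √n) := hct θ hθ.le
        _ ≤ 1 * (L ^ 6 / √n) * (L ^ 3 * om a θ) := by
          rw [← mul_one (Real.exp (-(a * θ ^ 2 / 2)) * (L ^ 6 / √n))]
          gcongr
        _ = _ := by ring
  have hc5 : Continuous fun θ : ℝ => geo l θ ^ n := (continuous_geo h.l_pos.le).pow n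
  rw [intervalIntegral.integral_sub (hc5.intervalIntegrable _ _)
    (Continuous.intervalIntegrable (by fun_prop) _ _), mul_sub, ← h1] at h3
  have e : (1 / (2 * π) : ℂ) * ∫ θ in (-π)..π, ((Real.exp (-(a * θ ^ 2 / 2)) : ℝ) : ℂ)
      = ((1 / (2 * π) * ∫ θ in (-π)..π, Real.exp (-(a * θ ^ 2 / 2)) : ℝ) : ℂ) := by
    rw [intervalIntegral.integral_ofReal]; push_cast; ring
  rw [e, ← Complex.ofReal_sub, Complex.norm_real, Real.norm_eq_abs] at h3
  have h4 := abs_sub_le (gg n s) (1 / (2 * π) * ∫ θ in (-π)..π, Real.exp (-(a * θ ^ 2 / 2)))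
    (1 / √(2 * π * a))
  have h5 : 2 * L ^ 9 ≤ L ^ 10 := h.mul_pow_le (by norm_num)
  calc _ ≤ L ^ 9 / √n / √a + 1 / (n : ℝ) ^ 14 / √a := by linarith
    _ ≤ L ^ 9 / √n / √a + L ^ 9 / √n / √a := by
      have : 0 ≤ 1 / (n : ℝ) ^ 14 := by positivity
      have h6 : 1 / (n : ℝ) ^ 14 ≤ L ^ 9 / √n := by linarith
      gcongr
    _ = 2 * L ^ 9 / √n / √a := by ring
    _ ≤ _ := by gcongr

theorem gg_bounds (h : Reg L n ((s : ℝ) / n)) :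
    1 / (3 * √(n * ((s : ℝ) / n * (1 + (s : ℝ) / n)))) ≤ gg n s
      ∧ gg n s ≤ 1 / √(n * ((s : ℝ) / n * (1 + (s : ℝ) / n))) := by
  have h1 := h.abs_gg_sub_le
  have ha := h.a_pos
  have hn := h.n_pos
  have hL := h.L_pos
  set a := n * ((s : ℝ) / n * (1 + (s : ℝ) / n)) with ha'
  have hs := Real.sqrt_pos.2 ha
  obtain ⟨b1, b2⟩ := two_pi_sqrt_bounds
  rw [Real.sqrt_mul (by positivity)] at h1
  have h2 : L ^ 10 / √n ≤ 1 / 100 := by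
    rw [div_le_div_iff₀ (by positivity) (by norm_num)]
    have h3 : 100 * L ^ 10 ≤ L ^ 11 := h.mul_pow_le (by norm_num)
    have h4 := h.pow_le_sqrt (p := 11) (by norm_num)
    linarith
  have h3 : L ^ 10 / √n / √a ≤ 1 / 100 * (1 / √a) := by
    rw [mul_one_div]; gcongr
  have h4 : 1 / (√(2 * π) * √a) = 1 / √(2 * π) * (1 / √a) := by rw [one_div_mul_one_div]
  have h5 : 100 / 251 ≤ 1 / √(2 * π) := by
    rw [div_le_div_iff₀ (by norm_num) (by linarith)]; linarith
  have h6 : 1 / √(2 * π) ≤ 2 / 5 := by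
    rw [div_le_div_iff₀ (by linarith) (by norm_num)]; linarith
  rw [h4] at h1
  have h7 : 0 < 1 / √a := by positivity
  have h8 := mul_le_mul_of_nonneg_right h5 h7.le
  have h9 := mul_le_mul_of_nonneg_right h6 h7.le
  rw [abs_le] at h1
  have e : 1 / (3 * √a) = 1 / 3 * (1 / √a) := by rw [one_div_mul_one_div]
  rw [e]
  constructor <;> linarith

theorem gg_pos (h : Reg L n ((s : ℝ) / n)) : 0 < gg n s := by
  have ha := h.a_pos
  exact lt_of_lt_of_le (by positivity) h.gg_bounds.1

end Reg

namespace Step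

variable {L : ℝ} {s j : ℕ} {c : Fin n → ℕ}

theorem abs_VV_sub_le (h : Step L s j c) :
    |VV j c - n * ((s : ℝ) / n * (1 + (s : ℝ) / n))|
      ≤ n * ((s : ℝ) / n * (1 + (s : ℝ) / n)) * (2 * (ww s j c + 1 / (j + 3))) := by
  rw [h.VV_eq]
  have ha := h.reg.a_pos
  have hw := h.ww_nonneg
  set a := n * ((s : ℝ) / n * (1 + (s : ℝ) / n))
  have e : ((j : ℝ) + 1) / (j + 3) * (a * (1 + ww s j c)) - a
      = a * (ww s j c - 2 * (1 / (j + 3)) * (1 + ww s j c)) := by field_simp; ring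
  rw [e, abs_mul, abs_of_pos ha]
  gcongr
  have h1 : 0 < 1 / ((j : ℝ) + 3) := by positivity
  have h2 : 1 / ((j : ℝ) + 3) ≤ 1 / 3 := by
    apply one_div_le_one_div_of_le (by norm_num); linarith [Nat.cast_nonneg (α := ℝ) j]
  generalize 1 / ((j : ℝ) + 3) = τ at *
  rw [abs_le]
  constructor <;> nlinarith

theorem inv_le (h : Step L s j c) : 1 / (n : ℝ) ^ 2 ≤ L * (1 / (j + 3)) := by
  have hn := h.reg.n_pos
  have hj := h.hj
  rw [mul_one_div, div_le_div_iff₀ (by positivity) (by positivity), one_mul]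
  refine hj.trans ?_
  have := h.reg.L_pos
  gcongr
  exact le_self_pow₀ h.reg.one_le_n (by norm_num)

theorem abs_OP_one_sub_le (h : Step L s j c) :
    |OP s j c (fun _ => 1) - √(n * ((s : ℝ) / n * (1 + (s : ℝ) / n)) / VV j c) * gg n s|
      ≤ L ^ 14 / √n * (ww s j c + 1 / (j + 3)) / √(n * ((s : ℝ) / n * (1 + (s : ℝ) / n))) := by
  have ha := h.reg.a_pos
  have hn := h.reg.n_pos
  have hL := h.reg.L_pos
  have hV := h.le_VV
  have hw := h.ww_nonneg
  have hVa := h.abs_VV_sub_le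
  have h0 := OP_prod_finset s j c h.hc ∅ (fun _ _ => 1)
  simp only [Finset.prod_empty, one_mul, Finset.compl_empty] at h0
  have h1 := gg_eq_integral n s (by exact_mod_cast hn)
  have hga := h.reg.abs_integral_exp_sub_le (V := n * ((s : ℝ) / n * (1 + (s : ℝ) / n))) (by linarith)
  have hgV := h.reg.abs_integral_exp_sub_le hV
  have hcta := fun θ hθ => h.reg.norm_geo_pow_sub_le (θ := θ) hθ
  have hctp := fun θ hθ => h.norm_prod_psi_sub_le (θ := θ) hθ
  have htla := fun θ hπ hθ => h.reg.norm_geo_pow_le (θ := θ) hπ hθ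
  have htlp := fun θ hπ hθ => h.norm_prod_psi_tail_le ∅ (by simp) (θ := θ) hπ hθ
  simp only [Finset.compl_empty] at htlp
  have hto := fun θ hθ => h.reg.one_le_om_mul (θ := θ) hθ
  have hta := fun θ hθ => h.reg.exp_le_tail' (θ := θ)
    (V := n * ((s : ℝ) / n * (1 + (s : ℝ) / n))) (by linarith) hθ
  have htV := fun θ hθ => h.reg.exp_le_tail' (θ := θ) hV hθ
  have hinv := h.inv_le
  have hτ : 0 < 1 / ((j : ℝ) + 3) := by positivity
  have hgeo := continuous_geo h.reg.l_pos.le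
  set a := n * ((s : ℝ) / n * (1 + (s : ℝ) / n)) with ha'
  set l := (s : ℝ) / n with hl
  set V := VV j c with hVdef
  set W := ww s j c + 1 / ((j : ℝ) + 3) with hW
  set σ := √(a / V) with hσ
  have hW0 : 0 < W := by positivity
  have hV0 : 0 < V := lt_of_lt_of_le (by positivity) hV
  have haV : a / V ≤ 3 := by rw [div_le_iff₀ hV0]; linarith
  have hσ0 : 0 ≤ σ := Real.sqrt_nonneg _
  have hσ2 : σ ^ 2 = a / V := Real.sq_sqrt (by positivity)
  have hσ2' : σ ≤ 2 := by rw [hσ, Real.sqrt_le_left (by norm_num)]; linarith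
  have hσ1 : |σ - 1| ≤ 6 * W := by
    have g1 : (σ - 1) * (σ + 1) = (a - V) / V := by
      rw [sub_div, div_self hV0.ne', ← hσ2]; ring
    have g2 : |σ - 1| * (σ + 1) = |V - a| / V := by
      rw [← abs_of_nonneg (by positivity : 0 ≤ σ + 1), ← abs_mul, g1, abs_div, abs_of_pos hV0,
        abs_sub_comm]
    have g3 : |V - a| / V ≤ 6 * W := by
      rw [div_le_iff₀ hV0]
      have : a * (2 * W) ≤ 3 * V * (2 * W) := by gcongr; linarith
      linarith
    have g4 : |σ - 1| * 1 ≤ |σ - 1| * (σ + 1) := by gcongr; linarith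
    linarith
  have h3 : ‖1 / (2 * π) * ∫ θ in (-π)..π, ((∏ k, psi j (c k) (fun _ => 1) θ - σ * geo l θ ^ n)
      - (Real.exp (-(V * θ ^ 2 / 2)) - σ * Real.exp (-(a * θ ^ 2 / 2))))‖
      ≤ L ^ 13 / √n * W / √a := by
    apply norm_integral_le_of_le_om ha (by positivity)
    intro θ hπ
    have hom := om_pos ha.le θ
    have hom1 := om_le_one ha.le θ
    rcases le_or_gt (L ^ 2) (a * θ ^ 2) with hθ | hθ
    · have g1 := htla θ hπ hθ
      have g2 := htlp θ hπ hθ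
      have g3 : om a θ ^ 2 ≤ om a θ := by
        rw [pow_two]; exact mul_le_of_le_one_left hom.le hom1
      have g4 : 1 / (n : ℝ) ^ 14 * om a θ ^ 2 ≤ 1 / (n : ℝ) ^ 14 * om a θ := by gcongr
      have g5 := hta θ hθ
      have g6 := htV θ hθ
      have g7 : ‖(∏ k, psi j (c k) (fun _ => 1) θ - σ * geo l θ ^ n)
          - (Real.exp (-(V * θ ^ 2 / 2)) - σ * Real.exp (-(a * θ ^ 2 / 2)))‖
          ≤ (‖∏ k, psi j (c k) (fun _ => 1) θ‖ + σ * ‖geo l θ ^ n‖)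
            + (Real.exp (-(V * θ ^ 2 / 2)) + σ * Real.exp (-(a * θ ^ 2 / 2))) := by
        refine (norm_sub_le _ _).trans (add_le_add ((norm_sub_le _ _).trans (le_of_eq ?_))
          ((norm_sub_le _ _).trans (le_of_eq ?_)))
        · rw [norm_mul, Complex.norm_real, Real.norm_eq_abs, abs_of_nonneg hσ0]
        · rw [norm_mul, Complex.norm_real, Real.norm_eq_abs, abs_of_pos (Real.exp_pos _),
            Complex.norm_real, Real.norm_eq_abs, abs_of_nonneg hσ0, Complex.norm_real,
            Real.norm_eq_abs, abs_of_pos (Real.exp_pos _)]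
      have g8 : σ * ‖geo l θ ^ n‖ ≤ 2 * (1 / (n : ℝ) ^ 14 * om a θ) :=
        mul_le_mul hσ2' (g1.trans g4) (norm_nonneg _) (by norm_num)
      have g9 : σ * Real.exp (-(a * θ ^ 2 / 2)) ≤ 2 * (1 / (n : ℝ) ^ 14 * om a θ) :=
        mul_le_mul hσ2' g5 (Real.exp_pos _).le (by norm_num)
      refine g7.trans ?_
      have g10 : 6 * (1 / (n : ℝ) ^ 14) ≤ L ^ 13 / √n * W := by
        have k1 : √n ≤ (n : ℝ) ^ 12 := by
          rw [Real.sqrt_le_left (by positivity), ← pow_mul]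
          exact le_self_pow₀ h.reg.one_le_n (by norm_num)
        have k2 : 6 * L ≤ L ^ 13 := by
          have := h.reg.mul_pow_le (p := 1) (C := 6) (by norm_num)
          rw [pow_one] at this
          norm_num at this
          have k := h.reg.pow_le_pow (p := 2) (q := 13) (by norm_num)
          linarith
        calc 6 * (1 / (n : ℝ) ^ 14) = 6 / (n : ℝ) ^ 12 * (1 / (n : ℝ) ^ 2) := by field_simp
          _ ≤ 6 / (n : ℝ) ^ 12 * (L * (1 / (j + 3))) := by gcongr
          _ = 6 * L / (n : ℝ) ^ 12 * (1 / (j + 3)) := by ring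
          _ ≤ L ^ 13 / √n * W := by
            gcongr
            rw [hW]; linarith
      calc _ ≤ 6 * (1 / (n : ℝ) ^ 14) * om a θ := by linarith
        _ ≤ _ := by gcongr
    · have hθ := hθ.le
      have g1 := hctp θ hθ
      have g2 := hcta θ hθ
      have g3 := hto θ hθ
      have e : (∏ k, psi j (c k) (fun _ => 1) θ - σ * geo l θ ^ n)
          - (Real.exp (-(V * θ ^ 2 / 2)) - σ * Real.exp (-(a * θ ^ 2 / 2)))
          = (∏ k, psi j (c k) (fun _ => 1) θ - geo l θ ^ n
              * Real.exp (-(V - a) * θ ^ 2 / 2))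
            + (geo l θ ^ n - Real.exp (-(a * θ ^ 2 / 2)))
              * ((Real.exp (-(V - a) * θ ^ 2 / 2) - σ : ℝ) : ℂ) := by
        have : Real.exp (-(V * θ ^ 2 / 2))
            = Real.exp (-(V - a) * θ ^ 2 / 2) * Real.exp (-(a * θ ^ 2 / 2)) := by
          rw [← Real.exp_add]; congr 1; ring
        rw [this]; push_cast; ring
      have g4 : Real.exp (-(a * θ ^ 2 / 2)) * |Real.exp (-(V - a) * θ ^ 2 / 2) - σ|
          ≤ (L ^ 2 + 6) * W := by
        have k1 : Real.exp (-(a * θ ^ 2 / 2)) ≤ 1 := Real.exp_le_one_iff.2 (by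
          have : 0 ≤ a * θ ^ 2 := by positivity
          linarith)
        have k2 : Real.exp (-(a * θ ^ 2 / 2)) * |Real.exp (-(V - a) * θ ^ 2 / 2) - 1|
            = |Real.exp (-(V * θ ^ 2 / 2)) - Real.exp (-(a * θ ^ 2 / 2))| := by
          rw [← abs_of_pos (Real.exp_pos (-(a * θ ^ 2 / 2))), ← abs_mul,
            abs_of_pos (Real.exp_pos (-(a * θ ^ 2 / 2))), mul_sub, ← Real.exp_add, mul_one]
          congr 3; ring
        have k3 := abs_exp_neg_sub_le (x := V * θ ^ 2 / 2) (y := a * θ ^ 2 / 2) (by positivity)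
          (by positivity)
        have k4 : |V * θ ^ 2 / 2 - a * θ ^ 2 / 2| ≤ L ^ 2 * W := by
          have : V * θ ^ 2 / 2 - a * θ ^ 2 / 2 = (V - a) * (θ ^ 2 / 2) := by ring
          rw [this, abs_mul, abs_of_nonneg (by positivity : 0 ≤ θ ^ 2 / 2)]
          calc _ ≤ a * (2 * W) * (θ ^ 2 / 2) := by gcongr
            _ = a * θ ^ 2 * W := by ring
            _ ≤ _ := by gcongr
        have k5 : |Real.exp (-(V - a) * θ ^ 2 / 2) - σ|
            ≤ |Real.exp (-(V - a) * θ ^ 2 / 2) - 1| + |σ - 1| := by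
          rw [abs_sub_comm σ 1]; exact abs_sub_le _ _ _
        calc _ ≤ Real.exp (-(a * θ ^ 2 / 2))
              * (|Real.exp (-(V - a) * θ ^ 2 / 2) - 1| + |σ - 1|) := by gcongr
          _ = Real.exp (-(a * θ ^ 2 / 2)) * |Real.exp (-(V - a) * θ ^ 2 / 2) - 1|
              + Real.exp (-(a * θ ^ 2 / 2)) * |σ - 1| := by ring
          _ ≤ L ^ 2 * W + 1 * (6 * W) := by
            refine add_le_add (by linarith) ?_
            gcongr
          _ = _ := by ring
      rw [e]
      refine (norm_add_le _ _).trans ?_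
      rw [norm_mul, Complex.norm_real, Real.norm_eq_abs]
      have p1 : 2 * L ^ 9 ≤ L ^ 10 := h.reg.mul_pow_le (by norm_num)
      have p2 : L ^ 8 + 6 * L ^ 6 ≤ L ^ 9 := by
        have q1 : 2 * L ^ 8 ≤ L ^ 9 := h.reg.mul_pow_le (by norm_num)
        have q2 : 6 * L ^ 6 ≤ L ^ 7 := h.reg.mul_pow_le (by norm_num)
        have q3 := h.reg.pow_le_pow (p := 7) (q := 8) (by norm_num)
        linarith
      calc _ ≤ L ^ 9 / √n * W + Real.exp (-(a * θ ^ 2 / 2)) * (L ^ 6 / √n)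
              * |Real.exp (-(V - a) * θ ^ 2 / 2) - σ| := by gcongr
        _ = L ^ 9 / √n * W + L ^ 6 / √n * (Real.exp (-(a * θ ^ 2 / 2))
              * |Real.exp (-(V - a) * θ ^ 2 / 2) - σ|) := by ring
        _ ≤ L ^ 9 / √n * W + L ^ 6 / √n * ((L ^ 2 + 6) * W) := by gcongr
        _ = (L ^ 9 + (L ^ 8 + 6 * L ^ 6)) / √n * W * 1 := by ring
        _ ≤ L ^ 10 / √n * W * (L ^ 3 * om a θ) := by
          gcongr
          linarith
        _ = _ := by ring
  have hc1 : Continuous fun θ : ℝ => ∏ k, psi j (c k) (fun _ => 1) θ :=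
    continuous_finsetProd _ fun i _ => continuous_psi _ _ _
  have hc2 : Continuous fun θ : ℝ => (σ : ℂ) * geo l θ ^ n := continuous_const.mul (hgeo.pow n)
  have hc3 : Continuous fun θ : ℝ => ((Real.exp (-(V * θ ^ 2 / 2)) : ℝ) : ℂ) := by fun_prop
  have hc4 : Continuous fun θ : ℝ => (σ : ℂ) * ((Real.exp (-(a * θ ^ 2 / 2)) : ℝ) : ℂ) := by
    fun_prop
  have hc12 : Continuous fun θ : ℝ => (∏ k, psi j (c k) (fun _ => 1) θ) - (σ : ℂ) * geo l θ ^ n :=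
    hc1.sub hc2
  have hc34 : Continuous fun θ : ℝ => ((Real.exp (-(V * θ ^ 2 / 2)) : ℝ) : ℂ)
      - (σ : ℂ) * ((Real.exp (-(a * θ ^ 2 / 2)) : ℝ) : ℂ) := hc3.sub hc4
  rw [intervalIntegral.integral_sub (hc12.intervalIntegrable _ _) (hc34.intervalIntegrable _ _),
    intervalIntegral.integral_sub (hc1.intervalIntegrable _ _) (hc2.intervalIntegrable _ _),
    intervalIntegral.integral_sub (hc3.intervalIntegrable _ _) (hc4.intervalIntegrable _ _),
    intervalIntegral.integral_const_mul, intervalIntegral.integral_const_mul,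
    intervalIntegral.integral_ofReal, intervalIntegral.integral_ofReal] at h3
  set Ia := ∫ θ in (-π)..π, Real.exp (-(a * θ ^ 2 / 2))
  set IV := ∫ θ in (-π)..π, Real.exp (-(V * θ ^ 2 / 2))
  have e : (1 / (2 * π) : ℂ) * (((∫ θ in (-π)..π, ∏ k, psi j (c k) (fun _ => 1) θ)
        - σ * ∫ θ in (-π)..π, geo l θ ^ n) - (IV - σ * Ia))
      = ((OP s j c (fun _ => 1) - σ * gg n s
        - (1 / (2 * π) * IV - σ * (1 / (2 * π) * Ia)) : ℝ) : ℂ) := by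
    push_cast
    rw [h0, h1]
    ring
  rw [e, Complex.norm_real, Real.norm_eq_abs] at h3
  have e2 : 1 / √(2 * π * V) = σ * (1 / √(2 * π * a)) := by
    rw [hσ, Real.sqrt_div ha.le, Real.sqrt_mul (show 0 ≤ 2 * π by positivity) V,
      Real.sqrt_mul (show 0 ≤ 2 * π by positivity) a]
    have := (Real.sqrt_pos.2 ha).ne'
    have := (Real.sqrt_pos.2 hV0).ne'
    field_simp
  rw [e2] at hgV
  have h5 : |1 / (2 * π) * IV - σ * (1 / (2 * π) * Ia)| ≤ 3 * (1 / (n : ℝ) ^ 14) / √a := by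
    have e3 : 1 / (2 * π) * IV - σ * (1 / (2 * π) * Ia)
        = (1 / (2 * π) * IV - σ * (1 / √(2 * π * a)))
          - σ * (1 / (2 * π) * Ia - 1 / √(2 * π * a)) := by ring
    rw [e3]
    refine (abs_sub _ _).trans ?_
    rw [abs_mul, abs_of_nonneg hσ0]
    have : σ * |1 / (2 * π) * Ia - 1 / √(2 * π * a)| ≤ 2 * (1 / (n : ℝ) ^ 14 / √a) :=
      mul_le_mul hσ2' hga (abs_nonneg _) (by norm_num)
    calc _ ≤ 1 / (n : ℝ) ^ 14 / √a + 2 * (1 / (n : ℝ) ^ 14 / √a) := add_le_add hgV this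
      _ = _ := by ring
  have h6 : 3 * (1 / (n : ℝ) ^ 14) ≤ L ^ 13 / √n * W := by
    have k1 : √n ≤ (n : ℝ) ^ 12 := by
      rw [Real.sqrt_le_left (by positivity), ← pow_mul]
      exact le_self_pow₀ h.reg.one_le_n (by norm_num)
    have k2 : 3 * L ≤ L ^ 13 := by
      have := h.reg.mul_pow_le (p := 1) (C := 3) (by norm_num)
      rw [pow_one] at this
      norm_num at this
      have k := h.reg.pow_le_pow (p := 2) (q := 13) (by norm_num)
      linarith
    calc 3 * (1 / (n : ℝ) ^ 14) = 3 / (n : ℝ) ^ 12 * (1 / (n : ℝ) ^ 2) := by field_simp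
      _ ≤ 3 / (n : ℝ) ^ 12 * (L * (1 / (j + 3))) := by gcongr
      _ = 3 * L / (n : ℝ) ^ 12 * (1 / (j + 3)) := by ring
      _ ≤ L ^ 13 / √n * W := by
        gcongr
        rw [hW]; linarith
  have p1 : 2 * L ^ 13 ≤ L ^ 14 := h.reg.mul_pow_le (by norm_num)
  have h7 : |OP s j c (fun _ => 1) - σ * gg n s|
      ≤ |OP s j c (fun _ => 1) - σ * gg n s
        - (1 / (2 * π) * IV - σ * (1 / (2 * π) * Ia))|
        + |1 / (2 * π) * IV - σ * (1 / (2 * π) * Ia)| := by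
    have := abs_add_le (OP s j c (fun _ => 1) - σ * gg n s
        - (1 / (2 * π) * IV - σ * (1 / (2 * π) * Ia))) (1 / (2 * π) * IV - σ * (1 / (2 * π) * Ia))
    rwa [sub_add_cancel] at this
  calc _ ≤ L ^ 13 / √n * W / √a + 3 * (1 / (n : ℝ) ^ 14) / √a := by linarith
    _ ≤ L ^ 13 / √n * W / √a + L ^ 13 / √n * W / √a := by gcongr
    _ = 2 * L ^ 13 / √n * W / √a := by ring
    _ ≤ _ := by gcongr

end Step

end Good

namespace Good

theorem EE_abs_mul_le {j c : ℕ} {q r : ℕ → ℝ} {y z : ℝ} (hy : 0 ≤ y) (hz : 0 ≤ z)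
    (h1 : EE j c (fun v => q v ^ 2) ≤ y ^ 2) (h2 : EE j c (fun v => r v ^ 2) ≤ z ^ 2) :
    EE j c (fun v => |q v * r v|) ≤ y * z := by
  have h3 := EE_mul_sq_le j c (fun v => |q v|) (fun v => |r v|)
  simp only [sq_abs, ← abs_mul] at h3
  refine abs_le_of_sq_le_sq' (h3.trans ?_) (by positivity) |>.2
  rw [mul_pow]
  exact mul_le_mul h1 h2 (EE_nonneg fun _ _ => sq_nonneg _) (by positivity)

theorem EE_abs_le_of_sq {j c : ℕ} {q : ℕ → ℝ} {y : ℝ} (hy : 0 ≤ y)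
    (h1 : EE j c (fun v => q v ^ 2) ≤ y ^ 2) : EE j c (fun v => |q v|) ≤ y := by
  have := EE_abs_mul_le (r := fun _ => 1) (z := 1) hy zero_le_one h1 (by simp [EE_const])
  simpa using this

namespace Step

variable {n : ℕ} {L : ℝ} {s j : ℕ} {c : Fin n → ℕ}

theorem EE_sub_sq_le (h : Step L s j c) (k : Fin n) :
    EE j (c k) (fun v => ((v : ℝ) - (c k : ℝ) / (j + 2)) ^ 2)
      ≤ L ^ 2 * ((s : ℝ) / n * (1 + (s : ℝ) / n)) := by
  rw [EE_var]
  have h1 : ((j : ℝ) + 1) / (j + 3) ≤ 1 := by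
    rw [div_le_one (by positivity)]; linarith
  have h0 : 0 ≤ (c k : ℝ) / (j + 2) * (1 + (c k : ℝ) / (j + 2)) := by positivity
  calc _ ≤ (c k : ℝ) / (j + 2) * (1 + (c k : ℝ) / (j + 2)) * 1 := by gcongr
    _ ≤ _ := by rw [mul_one]; exact h.var_le k

theorem EE_sub_pow_four_le (h : Step L s j c) (k : Fin n) :
    EE j (c k) (fun v => ((v : ℝ) - (c k : ℝ) / (j + 2)) ^ 4)
      ≤ L ^ 5 * ((s : ℝ) / n * (1 + (s : ℝ) / n)) ^ 2 := by
  have h1 := EE_pow_four_le j (c k)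
  have h2 := h.hx k
  set x := (c k : ℝ) / (j + 2) with hx
  have hx0 : 0 ≤ x := by positivity
  have h3 : EE j (c k) (fun v => ((v : ℝ) - x) ^ 4)
      ≤ 8 * (EE j (c k) (fun v => (v : ℝ) ^ 4) + x ^ 4) := by
    rw [← EE_const j (c k) (x ^ 4), ← EE_add, ← EE_mul_left]
    apply EE_mono
    intro v _
    have e1 : ((v : ℝ) - x) ^ 2 ≤ 2 * ((v : ℝ) ^ 2 + x ^ 2) := by
      linarith [sq_nonneg ((v : ℝ) + x)]
    calc ((v : ℝ) - x) ^ 4 = (((v : ℝ) - x) ^ 2) ^ 2 := by ring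
      _ ≤ (2 * ((v : ℝ) ^ 2 + x ^ 2)) ^ 2 := by gcongr
      _ ≤ _ := by linarith [sq_nonneg ((v : ℝ) ^ 2 - x ^ 2)]
  have hl := h.reg.l_pos
  have hL := h.reg.L_pos
  have hl1 := h.reg.hl
  have hLL := h.reg.one_le_L
  set l := (s : ℝ) / n
  set B := (l * (1 + l)) ^ 2 with hB
  have b2 : l ^ 2 ≤ B := by rw [hB]; gcongr; linarith [mul_pos hl hl]
  have b3 : l ^ 3 ≤ B := by
    rw [hB]; linarith [pow_pos hl 2, pow_pos hl 3, pow_pos hl 4,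
      show (l * (1 + l)) ^ 2 = l ^ 2 + 2 * l ^ 3 + l ^ 4 by ring]
  have b4 : l ^ 4 ≤ B := by
    rw [hB]; linarith [pow_pos hl 2, pow_pos hl 3, pow_pos hl 4,
      show (l * (1 + l)) ^ 2 = l ^ 2 + 2 * l ^ 3 + l ^ 4 by ring]
  have hB0 : 0 ≤ B := by positivity
  have c2 : x ^ 2 ≤ L ^ 4 * B := by
    calc x ^ 2 ≤ (L * l) ^ 2 := by gcongr
      _ = L ^ 2 * l ^ 2 := by ring
      _ ≤ L ^ 4 * B := by gcongr; norm_num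
  have c1 : x ≤ L ^ 4 * B := by
    calc x ≤ (L * l) * (L * l) := by
          calc x ≤ (L * l) * 1 := by linarith
            _ ≤ _ := by gcongr
      _ = L ^ 2 * l ^ 2 := by ring
      _ ≤ L ^ 4 * B := by gcongr; norm_num
  have c3 : x ^ 3 ≤ L ^ 4 * B := by
    calc x ^ 3 ≤ (L * l) ^ 3 := by gcongr
      _ = L ^ 3 * l ^ 3 := by ring
      _ ≤ L ^ 4 * B := by gcongr; norm_num
  have c4 : x ^ 4 ≤ L ^ 4 * B := by
    calc x ^ 4 ≤ (L * l) ^ 4 := by gcongr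
      _ = L ^ 4 * l ^ 4 := by ring
      _ ≤ L ^ 4 * B := by gcongr
  have h5 : 608 * L ^ 4 ≤ L ^ 5 := h.reg.mul_pow_le (by norm_num)
  have h6 := mul_le_mul_of_nonneg_right h5 hB0
  linarith

theorem abs_OP_sum_le (h : Step L s j c) (Y : Fin n → ℕ → ℝ) (y : Fin n → ℝ)
    (hy : ∀ k, 0 ≤ y k) (hY : ∀ k, EE j (c k) (Y k) = 0)
    (hY2 : ∀ k, EE j (c k) (fun v => Y k v ^ 2) ≤ y k ^ 2) :
    |OP s j c (fun v => ∑ k, Y k (v k))|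
      ≤ L ^ 24 / n * (∑ k, y k) / √(n * ((s : ℝ) / n * (1 + (s : ℝ) / n))) := by
  have hA := h.reg.A_pos
  have hn := h.reg.n_pos
  have hL := h.reg.L_pos
  have hLL := h.reg.one_le_L
  have h5 : 2 * L ^ 23 ≤ L ^ 24 := h.reg.mul_pow_le (by norm_num)
  have h6 := fun k => h.EE_sub_pow_four_le k
  rw [OP_sum]
  refine (Finset.abs_sum_le_sum_abs _ _).trans ?_
  rw [Finset.mul_sum, Finset.sum_div]
  apply Finset.sum_le_sum
  intro k _
  refine (h.abs_OP_le_of_mean_zero k (Y k) (hY k)).trans ?_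
  set A := (s : ℝ) / n * (1 + (s : ℝ) / n)
  have h1 := EE_abs_le_of_sq (hy k) (hY2 k)
  have h7 : EE j (c k) (fun v => |Y k v| * (v - (c k : ℝ) / (j + 2)) ^ 2) ≤ y k * (L ^ 3 * A) := by
    have := EE_abs_mul_le (r := fun v => ((v : ℝ) - (c k : ℝ) / (j + 2)) ^ 2) (z := L ^ 3 * A)
      (hy k) (by positivity) (hY2 k) (by
        simp only [← pow_mul]
        refine (h6 k).trans ?_
        rw [mul_pow (L ^ 3), ← pow_mul]
        gcongr
        norm_num)
    simpa only [abs_mul, abs_pow, sq_abs] using this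
  have h8 : EE j (c k) (fun v => |Y k v| * (v - (c k : ℝ) / (j + 2)) ^ 2) / A ≤ L ^ 3 * y k := by
    rw [div_le_iff₀ hA]; linarith
  have h9 : y k ≤ L ^ 3 * y k := le_mul_of_one_le_left (hy k) (one_le_pow₀ hLL)
  have h10 := hy k
  calc _ ≤ L ^ 20 / n * (L ^ 3 * y k + L ^ 3 * y k) / √(n * A) := by gcongr; linarith
    _ = (2 * L ^ 23) / n * y k / √(n * A) := by ring
    _ ≤ _ := by gcongr

theorem OP_sum_sq_le (h : Step L s j c) (Y : Fin n → ℕ → ℝ) (y : Fin n → ℝ)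
    (hy : ∀ k, 0 ≤ y k) (hY : ∀ k, EE j (c k) (Y k) = 0)
    (hY2 : ∀ k, EE j (c k) (fun v => Y k v ^ 2) ≤ y k ^ 2) :
    OP s j c (fun v => (∑ k, Y k (v k)) ^ 2)
      ≤ L ^ 9 * (∑ k, y k ^ 2) / √(n * ((s : ℝ) / n * (1 + (s : ℝ) / n))) := by
  have hA := h.reg.A_pos
  have hn := h.reg.n_pos
  have hL := h.reg.L_pos
  have hLL := h.reg.one_le_L
  have h5 : 2 * L ^ 8 ≤ L ^ 9 := h.reg.mul_pow_le (by norm_num)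
  have h6 : L ^ 6 ≤ L ^ 8 := h.reg.pow_le_pow (by norm_num)
  have h4 := fun k => h.EE_sub_sq_le k
  have hd := fun k (q : ℕ → ℝ) => h.abs_OP_le k q
  have hod := fun k k' (hk : k ≠ k') q q' => h.abs_OP_mul_le (k := k) (k' := k') hk q q'
  set A := (s : ℝ) / n * (1 + (s : ℝ) / n)
  have hr : 0 < √(n * A) := by positivity
  have h7 : ∀ k, EE j (c k) (fun v => |Y k v * (v - (c k : ℝ) / (j + 2))|) ≤ y k * (L * √A) := by
    intro k
    refine EE_abs_mul_le (r := fun v => (v : ℝ) - (c k : ℝ) / (j + 2)) (hy k) (by positivity)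
      (hY2 k) ((h4 k).trans ?_)
    rw [mul_pow, Real.sq_sqrt hA.le]
  have key : ∀ k k', OP s j c (fun v => Y k (v k) * Y k' (v k'))
      ≤ (if k = k' then L ^ 6 * y k ^ 2 / √(n * A) else 0)
        + L ^ 8 / n * (y k * y k') / √(n * A) := by
    intro k k'
    have hyk := hy k
    have hyk' := hy k'
    by_cases hk : k = k'
    · subst hk
      rw [if_pos rfl]
      have h8 := (le_abs_self _).trans (hd k (fun v => Y k v * Y k v))
      have h9 : EE j (c k) (fun v => |Y k v * Y k v|) ≤ y k ^ 2 := by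
        refine le_trans (le_of_eq ?_) (hY2 k)
        apply EE_congr; intro v _; rw [abs_mul, abs_mul_abs_self, sq]
      have h10 : 0 ≤ L ^ 8 / n * (y k * y k) / √(n * A) := by positivity
      calc _ ≤ L ^ 6 * EE j (c k) (fun v => |Y k v * Y k v|) / √(n * A) := h8
        _ ≤ L ^ 6 * y k ^ 2 / √(n * A) := by gcongr
        _ ≤ _ := by linarith
    · rw [if_neg hk, zero_add]
      have h8 := (le_abs_self _).trans (hod k k' hk (Y k) (Y k') (hY k) (hY k'))
      refine h8.trans ?_
      have h9 : EE j (c k) (fun v => |Y k v * (v - (c k : ℝ) / (j + 2))|)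
          * EE j (c k') (fun v => |Y k' v * (v - (c k' : ℝ) / (j + 2))|)
          ≤ (y k * (L * √A)) * (y k' * (L * √A)) :=
        mul_le_mul (h7 k) (h7 k') (EE_nonneg fun _ _ => abs_nonneg _) (by positivity)
      calc _ ≤ L ^ 6 / (n * A) * ((y k * (L * √A)) * (y k' * (L * √A))) / √(n * A) := by gcongr
        _ = L ^ 6 / (n * A) * (L ^ 2 * (√A * √A) * (y k * y k')) / √(n * A) := by ring
        _ = _ := by rw [Real.mul_self_sqrt hA.le]; field_simp
  have e1 : OP s j c (fun v => (∑ k, Y k (v k)) ^ 2)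
      = ∑ k, ∑ k', OP s j c (fun v => Y k (v k) * Y k' (v k')) := by
    have e3 : ∀ k, ∑ k', OP s j c (fun v => Y k (v k) * Y k' (v k'))
        = OP s j c (fun v => ∑ k', Y k (v k) * Y k' (v k')) := fun k =>
      (OP_sum s j c _ fun k' v => Y k (v k) * Y k' (v k')).symm
    rw [Finset.sum_congr rfl fun k _ => e3 k,
      ← OP_sum s j c _ fun k v => ∑ k', Y k (v k) * Y k' (v k')]
    apply OP_congr
    intro v _
    rw [sq, Finset.sum_mul_sum]
  rw [e1]
  refine (Finset.sum_le_sum fun k _ => Finset.sum_le_sum fun k' _ => key k k').trans ?_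
  have e2 : ∑ k, ∑ k', ((if k = k' then L ^ 6 * y k ^ 2 / √(n * A) else 0)
        + L ^ 8 / n * (y k * y k') / √(n * A))
      = L ^ 6 * (∑ k, y k ^ 2) / √(n * A) + L ^ 8 / n * (∑ k, y k) ^ 2 / √(n * A) := by
    simp only [Finset.sum_add_distrib, Finset.sum_ite_eq, Finset.mem_univ, if_true]
    rw [← Finset.sum_div, ← Finset.mul_sum, sq (∑ k, y k), Finset.sum_mul_sum]
    simp only [← Finset.sum_div, ← Finset.mul_sum]
  rw [e2]
  have h8 : (∑ k, y k) ^ 2 ≤ n * ∑ k, y k ^ 2 := by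
    have := sq_sum_le_card_mul_sum_sq (s := (Finset.univ : Finset (Fin n))) (f := y)
    simpa using this
  have h9 : 0 ≤ ∑ k, y k ^ 2 := Finset.sum_nonneg fun _ _ => sq_nonneg _
  calc _ ≤ L ^ 8 * (∑ k, y k ^ 2) / √(n * A) + L ^ 8 / n * (n * ∑ k, y k ^ 2) / √(n * A) := by
        gcongr
    _ = 2 * L ^ 8 * (∑ k, y k ^ 2) / √(n * A) := by field_simp; ring
    _ ≤ _ := by gcongr

/-- Expected growth of the penalty terms. -/
theorem OP_fm_le (h : Step L s j c) (k : Fin n) (r : ℕ) :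
    OP s j c (fun v => fm j (c k - v k) r)
      ≤ (OP s j c (fun _ => 1) + L ^ 24 / n / √(n * ((s : ℝ) / n * (1 + (s : ℝ) / n))))
        * fm (j + 1) (c k) r := by
  have hA := h.reg.A_pos
  have hn := h.reg.n_pos
  have hL := h.reg.L_pos
  have hLL := h.reg.one_le_L
  set H : ℕ → ℝ := fun v => fm j (c k - v) r with hH
  set μ := fm (j + 1) (c k) r with hμ
  have hμ0 : 0 ≤ μ := fm_nonneg _ _ _
  have hH0 : ∀ v, 0 ≤ H v := fun v => fm_nonneg _ _ _
  have m0 : EE j (c k) H = μ := by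
    have := sum_bbw_choose_fm j (c k) 0 r
    simpa [EE, hH] using this
  have h1 := h.abs_OP_le_of_mean_zero k (fun v => H v - μ) (by rw [EE_sub, EE_const, m0, sub_self])
  have hvar := h.var_le k
  have hsq := h.EE_sub_sq_le k
  set A := (s : ℝ) / n * (1 + (s : ℝ) / n)
  set x := (c k : ℝ) / (j + 2) with hx
  have hx0 : 0 ≤ x := by positivity
  have m1 : EE j (c k) (fun v => (v : ℝ) ^ 2 * H v) ≤ (2 * x ^ 2 + x) * μ := by
    have e1 : EE j (c k) (fun v => (v : ℝ) ^ 2 * H v)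
        = 2 * fm (j + 1) (c k) (2 + r) + fm (j + 1) (c k) (1 + r) := by
      rw [← sum_bbw_choose_fm, ← sum_bbw_choose_fm, Finset.mul_sum, ← Finset.sum_add_distrib]
      unfold EE
      apply Finset.sum_congr rfl
      intro v _
      rw [Nat.cast_choose_two, Nat.choose_one_right, hH]; ring
    have e2 : fm (j + 1) (c k) (1 + r) ≤ x * μ := by
      have := fm_succ_le (j + 1) (c k) r
      push_cast at this
      rw [add_comm 1 r, hx]
      convert this using 3
      ring
    have e3 : fm (j + 1) (c k) (2 + r) ≤ x * (x * μ) := by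
      have := fm_succ_le (j + 1) (c k) (1 + r)
      push_cast at this
      rw [show 2 + r = 1 + r + 1 by ring]
      refine this.trans ?_
      rw [show (j : ℝ) + 1 + 1 = j + 2 by ring, ← hx]
      gcongr
    rw [e1]; linarith
  have m2 : EE j (c k) (fun v => |H v - μ|) ≤ 2 * μ := by
    calc _ ≤ EE j (c k) (fun v => H v + μ) := by
          apply EE_mono; intro v _
          rw [abs_le]; constructor <;> linarith [hH0 v]
      _ = 2 * μ := by rw [EE_add, EE_const, m0]; ring
  have m3 : EE j (c k) (fun v => |H v - μ| * ((v : ℝ) - x) ^ 2) ≤ 4 * L ^ 2 * A * μ := by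
    calc _ ≤ EE j (c k) (fun v => ((v : ℝ) ^ 2 * H v + x ^ 2 * H v) + μ * ((v : ℝ) - x) ^ 2) := by
          apply EE_mono; intro v _
          have e1 : |H v - μ| ≤ H v + μ := by
            rw [abs_le]; constructor <;> linarith [hH0 v]
          have e2 : ((v : ℝ) - x) ^ 2 ≤ (v : ℝ) ^ 2 + x ^ 2 := by
            have : 0 ≤ (v : ℝ) * x := by positivity
            linarith [show ((v : ℝ) - x) ^ 2 = v ^ 2 + x ^ 2 - 2 * (v * x) by ring]
          have e3 := mul_le_mul_of_nonneg_right e1 (sq_nonneg ((v : ℝ) - x))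
          have e4 := mul_le_mul_of_nonneg_left e2 (hH0 v)
          linarith
      _ ≤ (2 * x ^ 2 + x) * μ + x ^ 2 * μ + μ * (L ^ 2 * A) := by
          rw [EE_add, EE_add, EE_mul_left, EE_mul_left, m0]
          gcongr
      _ ≤ _ := by
          have e1 := mul_le_mul_of_nonneg_right hvar hμ0
          have e2 : 0 ≤ x * μ := by positivity
          linarith [show x * (1 + x) * μ = x * μ + x ^ 2 * μ by ring]
  have h2 : OP s j c (fun v => fm j (c k - v k) r)
      = OP s j c (fun v => H (v k) - μ) + OP s j c (fun _ => 1) * μ := by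
    rw [mul_comm, ← OP_mul_left, ← OP_add]
    apply OP_congr; intro v _; simp [hH]
  rw [h2]
  have h3 : EE j (c k) (fun v => |H v - μ| * ((v : ℝ) - x) ^ 2) / A ≤ 4 * L ^ 2 * μ := by
    rw [div_le_iff₀ hA]; linarith
  have h4 : 2 * μ ≤ 2 * L ^ 2 * μ := by
    gcongr
    exact le_mul_of_one_le_right (by norm_num) (one_le_pow₀ hLL)
  have h5 : 6 * L ^ 22 ≤ L ^ 23 := h.reg.mul_pow_le (by norm_num)
  have h6 : L ^ 23 ≤ L ^ 24 := h.reg.pow_le_pow (by norm_num)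
  have h7 : OP s j c (fun v => H (v k) - μ) ≤ L ^ 24 / n / √(n * A) * μ := by
    calc _ ≤ _ := (le_abs_self _).trans h1
      _ ≤ L ^ 20 / n * (2 * L ^ 2 * μ + 4 * L ^ 2 * μ) / √(n * A) := by gcongr; linarith
      _ = 6 * L ^ 22 / n / √(n * A) * μ := by ring
      _ ≤ _ := by gcongr; linarith
  linarith

end Step

end Good

namespace Good

variable {n : ℕ}

/-- Normalised total variance of `n` geometric variables with means `c k / i`. -/
noncomputable def rr (s i : ℕ) (c : Fin n → ℕ) : ℝ :=
  (∑ k, (c k : ℝ) / i * (1 + (c k : ℝ) / i)) / (n * ((s : ℝ) / n * (1 + (s : ℝ) / n)))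

/-- Centred contribution of one entry to the change of `rr`. -/
noncomputable def yy (s j : ℕ) (c : Fin n → ℕ) (k : Fin n) (v : ℕ) : ℝ :=
  1 / (n * ((s : ℝ) / n * (1 + (s : ℝ) / n)))
    * (-2 * ((c k : ℝ) / (j + 2) - (s : ℝ) / n) / (j + 1) * (v - (c k : ℝ) / (j + 2))
      + 1 / ((j : ℝ) + 1) ^ 2 * ((v - (c k : ℝ) / (j + 2)) ^ 2
        - (c k : ℝ) / (j + 2) * (1 + (c k : ℝ) / (j + 2)) * ((j + 1) / (j + 3))))

theorem EE_yy (s j : ℕ) (c : Fin n → ℕ) (k : Fin n) : EE j (c k) (yy s j c k) = 0 := by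
  unfold yy
  rw [EE_mul_left, EE_add, EE_mul_left, EE_mul_left, EE_sub_mean, EE_sub, EE_var, EE_const]
  ring

namespace Step

variable {L : ℝ} {s j : ℕ} {c : Fin n → ℕ}

theorem rr_eq (h : Step L s j c) : rr s (j + 2) c = 1 + ww s j c := by
  unfold rr
  push_cast
  rw [h.sum_xx, mul_div_cancel_left₀ _ h.reg.a_pos.ne']

theorem rr_sub_eq (h : Step L s j c) {v : Fin n → ℕ} (hv : v ∈ comp s c) :
    rr s (j + 1) (c - v) - rr s (j + 2) c * (((j : ℝ) + 2) ^ 2 / ((j + 1) * (j + 3)))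
      = ∑ k, yy s j c k (v k) := by
  obtain ⟨hv1, hv2⟩ := mem_comp.1 hv
  have ha := h.reg.a_pos
  have h1 : ∑ k, ((v k : ℝ) - (c k : ℝ) / (j + 2)) = 0 := by
    rw [Finset.sum_sub_distrib, h.sum_x, ← Nat.cast_sum, hv2]
    have := h.reg.n_pos.ne'
    field_simp; ring
  have e1 : ∑ k, yy s j c k (v k)
      = (∑ k, ((c k - v k : ℝ) / (j + 1) * (1 + (c k - v k : ℝ) / (j + 1))
          - (c k : ℝ) / (j + 2) * (1 + (c k : ℝ) / (j + 2))
            * (((j : ℝ) + 2) ^ 2 / ((j + 1) * (j + 3)))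
          + ((1 + 2 * ((s : ℝ) / n)) / (j + 1)) * ((v k : ℝ) - (c k : ℝ) / (j + 2))))
        / (n * ((s : ℝ) / n * (1 + (s : ℝ) / n))) := by
    rw [Finset.sum_div]
    apply Finset.sum_congr rfl
    intro k _
    unfold yy
    rw [one_div (n * ((s : ℝ) / n * (1 + (s : ℝ) / n))),
      div_eq_inv_mul _ (n * ((s : ℝ) / n * (1 + (s : ℝ) / n)))]
    congr 1
    generalize (s : ℝ) / n = l
    have : (j : ℝ) + 1 ≠ 0 := by positivity
    have : (j : ℝ) + 2 ≠ 0 := by positivity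
    have : (j : ℝ) + 3 ≠ 0 := by positivity
    field_simp
    ring
  rw [e1, Finset.sum_add_distrib, ← Finset.mul_sum, h1, mul_zero, add_zero, Finset.sum_sub_distrib,
    ← Finset.sum_mul, sub_div]
  unfold rr
  push_cast
  congr 1
  · congr 1
    apply Finset.sum_congr rfl
    intro k _
    rw [Pi.sub_apply, Nat.cast_sub (hv1 k)]
  · ring

/-- Bound for the standard deviation of `yy`. -/
noncomputable def ys (L : ℝ) (s j : ℕ) (c : Fin n → ℕ) (k : Fin n) : ℝ :=
  L ^ 3 / (n * ((s : ℝ) / n * (1 + (s : ℝ) / n)))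
    * (|(c k : ℝ) / (j + 2) - (s : ℝ) / n| * √((s : ℝ) / n * (1 + (s : ℝ) / n)) / (j + 1)
      + (s : ℝ) / n * (1 + (s : ℝ) / n) / ((j : ℝ) + 1) ^ 2)

theorem ys_nonneg (h : Step L s j c) (k : Fin n) : 0 ≤ ys L s j c k := by
  have := h.reg.a_pos
  have := h.reg.A_pos
  have := h.reg.L_pos
  unfold ys
  positivity

theorem EE_yy_sq_le (h : Step L s j c) (k : Fin n) :
    EE j (c k) (fun v => yy s j c k v ^ 2) ≤ ys L s j c k ^ 2 := by
  have ha := h.reg.a_pos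
  have hA := h.reg.A_pos
  have hL := h.reg.L_pos
  have h2 := h.EE_sub_sq_le k
  have h4 := h.EE_sub_pow_four_le k
  have hv := EE_var j (c k)
  unfold yy ys
  set A := (s : ℝ) / n * (1 + (s : ℝ) / n)
  set x := (c k : ℝ) / (j + 2)
  set σ := x * (1 + x) * (((j : ℝ) + 1) / (j + 3))
  set d := x - (s : ℝ) / n
  set a := n * A
  set J := (j : ℝ) + 1 with hJ
  have hJ0 : 0 < J := by positivity
  have h5 : EE j (c k) (fun v => (((v : ℝ) - x) ^ 2 - σ) ^ 2) ≤ L ^ 5 * A ^ 2 := by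
    have e : EE j (c k) (fun v => (((v : ℝ) - x) ^ 2 - σ) ^ 2)
        = EE j (c k) (fun v => ((v : ℝ) - x) ^ 4) - σ ^ 2 := by
      rw [EE_congr (h' := fun v => (((v : ℝ) - x) ^ 4 - 2 * σ * ((v : ℝ) - x) ^ 2) + σ ^ 2)
        (fun v _ => by ring), EE_add, EE_sub, EE_mul_left, hv, EE_const]
      ring
    rw [e]; linarith [sq_nonneg σ]
  have h6 : EE j (c k) (fun v => (1 / a * (-2 * d / J * ((v : ℝ) - x)
        + 1 / J ^ 2 * (((v : ℝ) - x) ^ 2 - σ))) ^ 2)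
      ≤ 1 / a ^ 2 * (8 * d ^ 2 / J ^ 2 * EE j (c k) (fun v => ((v : ℝ) - x) ^ 2)
        + 2 / J ^ 4 * EE j (c k) (fun v => (((v : ℝ) - x) ^ 2 - σ) ^ 2)) := by
    rw [← EE_mul_left, ← EE_mul_left, ← EE_add, ← EE_mul_left]
    apply EE_mono
    intro v _
    rw [mul_pow, div_pow, one_pow]
    gcongr
    have := sq_nonneg (-2 * d / J * ((v : ℝ) - x) - 1 / J ^ 2 * (((v : ℝ) - x) ^ 2 - σ))
    have e : 8 * d ^ 2 / J ^ 2 * ((v : ℝ) - x) ^ 2 + 2 / J ^ 4 * (((v : ℝ) - x) ^ 2 - σ) ^ 2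
      = (-2 * d / J * ((v : ℝ) - x) + 1 / J ^ 2 * (((v : ℝ) - x) ^ 2 - σ)) ^ 2
        + (-2 * d / J * ((v : ℝ) - x) - 1 / J ^ 2 * (((v : ℝ) - x) ^ 2 - σ)) ^ 2 := by ring_nf
    rw [e]; linarith
  refine h6.trans ?_
  have k1 : 8 * L ^ 2 ≤ L ^ 6 :=
    (h.reg.mul_pow_le (by norm_num)).trans (h.reg.pow_le_pow (by norm_num))
  have k2 : 2 * L ^ 5 ≤ L ^ 6 := h.reg.mul_pow_le (by norm_num)
  have hs : √A ^ 2 = A := Real.sq_sqrt hA.le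
  have hd : |d| ^ 2 = d ^ 2 := sq_abs d
  calc _ ≤ 1 / a ^ 2 * (8 * d ^ 2 / J ^ 2 * (L ^ 2 * A) + 2 / J ^ 4 * (L ^ 5 * A ^ 2)) := by gcongr
    _ = 1 / a ^ 2 * ((8 * L ^ 2) * (d ^ 2 * A / J ^ 2) + (2 * L ^ 5) * (A ^ 2 / J ^ 4)) := by ring
    _ ≤ 1 / a ^ 2 * (L ^ 6 * (d ^ 2 * A / J ^ 2) + L ^ 6 * (A ^ 2 / J ^ 4)) := by gcongr
    _ = (L ^ 3 / a) ^ 2 * ((|d| * √A / J) ^ 2 + (A / J ^ 2) ^ 2) := by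
      rw [div_pow (|d| * √A), mul_pow |d|, hs, hd]; ring_nf
    _ ≤ (L ^ 3 / a) ^ 2 * (|d| * √A / J + A / J ^ 2) ^ 2 := by
      gcongr
      have : 0 ≤ (|d| * √A / J) * (A / J ^ 2) := by positivity
      linarith [show (|d| * √A / J + A / J ^ 2) ^ 2 = (|d| * √A / J) ^ 2 + (A / J ^ 2) ^ 2
        + 2 * ((|d| * √A / J) * (A / J ^ 2)) by ring]
    _ = _ := by ring

theorem sum_sq_d (h : Step L s j c) :
    ∑ k, ((c k : ℝ) / (j + 2) - (s : ℝ) / n) ^ 2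
      = n * ((s : ℝ) / n * (1 + (s : ℝ) / n)) * ww s j c := by
  unfold ww
  rw [mul_div_cancel₀ _ h.reg.a_pos.ne']

theorem sum_ys_le (h : Step L s j c) :
    ∑ k, ys L s j c k ≤ L ^ 3 * (√(ww s j c) / (j + 1) + 1 / ((j : ℝ) + 1) ^ 2) := by
  have ha := h.reg.a_pos
  have hA := h.reg.A_pos
  have hL := h.reg.L_pos
  have hn := h.reg.n_pos
  have hw := h.ww_nonneg
  have h1 := h.sum_sq_d
  unfold ys
  set A := (s : ℝ) / n * (1 + (s : ℝ) / n)
  set w := ww s j c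
  set d : Fin n → ℝ := fun k => (c k : ℝ) / (j + 2) - (s : ℝ) / n with hd
  have h2 : (∑ k, |d k|) ≤ n * √A * √w := by
    refine abs_le_of_sq_le_sq' ?_ (by positivity) |>.2
    have := sq_sum_le_card_mul_sum_sq (s := (Finset.univ : Finset (Fin n))) (f := fun k => |d k|)
    simp only [sq_abs, Finset.card_univ, Fintype.card_fin] at this
    rw [mul_pow, mul_pow, Real.sq_sqrt hA.le, Real.sq_sqrt hw]
    refine this.trans (le_of_eq ?_)
    rw [hd, h1]; ring
  rw [← Finset.mul_sum, Finset.sum_add_distrib, ← Finset.sum_div, ← Finset.sum_mul]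
  simp only [Finset.sum_const, Finset.card_univ, Fintype.card_fin, nsmul_eq_mul]
  change L ^ 3 / (n * A) * ((∑ k, |d k|) * √A / (j + 1) + n * (A / ((j : ℝ) + 1) ^ 2)) ≤ _
  calc _ ≤ L ^ 3 / (n * A) * ((n * √A * √w) * √A / (j + 1) + n * (A / ((j : ℝ) + 1) ^ 2)) := by
        gcongr
    _ = L ^ 3 / (n * A) * (n * (√A * √A) * √w / (j + 1) + n * (A / ((j : ℝ) + 1) ^ 2)) := by ring
    _ = _ := by
      rw [Real.mul_self_sqrt hA.le]
      field_simp

theorem sum_ys_sq_le (h : Step L s j c) :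
    ∑ k, ys L s j c k ^ 2
      ≤ L ^ 7 / n * (ww s j c / ((j : ℝ) + 1) ^ 2 + 1 / ((j : ℝ) + 1) ^ 4) := by
  have ha := h.reg.a_pos
  have hA := h.reg.A_pos
  have hL := h.reg.L_pos
  have hn := h.reg.n_pos
  have hw := h.ww_nonneg
  have h1 := h.sum_sq_d
  have h5 : 2 * L ^ 6 ≤ L ^ 7 := h.reg.mul_pow_le (by norm_num)
  unfold ys
  set A := (s : ℝ) / n * (1 + (s : ℝ) / n)
  set w := ww s j c
  set d : Fin n → ℝ := fun k => (c k : ℝ) / (j + 2) - (s : ℝ) / n with hd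
  have hs : √A ^ 2 = A := Real.sq_sqrt hA.le
  have h2 : ∀ k, (L ^ 3 / (n * A) * (|d k| * √A / (j + 1) + A / ((j : ℝ) + 1) ^ 2)) ^ 2
      ≤ 2 * L ^ 6 / (n * A) ^ 2 * (d k ^ 2 * A / ((j : ℝ) + 1) ^ 2 + A ^ 2 / ((j : ℝ) + 1) ^ 4) := by
    intro k
    have e1 : (|d k| * √A / (j + 1)) ^ 2 = d k ^ 2 * A / ((j : ℝ) + 1) ^ 2 := by
      rw [div_pow, mul_pow, hs, sq_abs]
    calc _ = L ^ 6 / (n * A) ^ 2 * (|d k| * √A / (j + 1) + A / ((j : ℝ) + 1) ^ 2) ^ 2 := by ring_nf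
      _ ≤ L ^ 6 / (n * A) ^ 2 * (2 * ((|d k| * √A / (j + 1)) ^ 2 + (A / ((j : ℝ) + 1) ^ 2) ^ 2)) := by
        gcongr
        linarith [sq_nonneg (|d k| * √A / (j + 1) - A / ((j : ℝ) + 1) ^ 2)]
      _ = _ := by rw [e1]; generalize (j : ℝ) + 1 = J; ring
  refine (Finset.sum_le_sum fun k _ => h2 k).trans ?_
  rw [← Finset.mul_sum, Finset.sum_add_distrib, ← Finset.sum_div, ← Finset.sum_mul, hd, h1]
  simp only [Finset.sum_const, Finset.card_univ, Fintype.card_fin, nsmul_eq_mul]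
  calc _ = 2 * L ^ 6 / n * (w / ((j : ℝ) + 1) ^ 2 + 1 / ((j : ℝ) + 1) ^ 4) := by
        field_simp
    _ ≤ _ := by gcongr

/-- The normalised variance has small conditional drift. -/
theorem abs_OP_rr_le (h : Step L s j c) :
    |OP s j c (fun v => rr s (j + 1) (c - v)
        - rr s (j + 2) c * (((j : ℝ) + 2) ^ 2 / ((j + 1) * (j + 3))))|
      ≤ L ^ 27 / n * (√(ww s j c) / (j + 1) + 1 / ((j : ℝ) + 1) ^ 2)
        / √(n * ((s : ℝ) / n * (1 + (s : ℝ) / n))) := by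
  have hL := h.reg.L_pos
  rw [OP_congr fun v hv => h.rr_sub_eq hv]
  refine (h.abs_OP_sum_le (yy s j c) (ys L s j c) h.ys_nonneg (EE_yy s j c) h.EE_yy_sq_le).trans ?_
  calc _ ≤ L ^ 24 / n * (L ^ 3 * (√(ww s j c) / (j + 1) + 1 / ((j : ℝ) + 1) ^ 2))
        / √(n * ((s : ℝ) / n * (1 + (s : ℝ) / n))) := by gcongr; exact h.sum_ys_le
    _ = _ := by ring

/-- The normalised variance has small conditional variance. -/
theorem OP_rr_sq_le (h : Step L s j c) :
    OP s j c (fun v => (rr s (j + 1) (c - v)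
        - rr s (j + 2) c * (((j : ℝ) + 2) ^ 2 / ((j + 1) * (j + 3)))) ^ 2)
      ≤ L ^ 16 / n * (ww s j c / ((j : ℝ) + 1) ^ 2 + 1 / ((j : ℝ) + 1) ^ 4)
        / √(n * ((s : ℝ) / n * (1 + (s : ℝ) / n))) := by
  have hL := h.reg.L_pos
  rw [OP_congr fun v hv => by rw [h.rr_sub_eq hv]]
  refine (h.OP_sum_sq_le (yy s j c) (ys L s j c) h.ys_nonneg (EE_yy s j c) h.EE_yy_sq_le).trans ?_
  calc _ ≤ L ^ 9 * (L ^ 7 / n * (ww s j c / ((j : ℝ) + 1) ^ 2 + 1 / ((j : ℝ) + 1) ^ 4))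
        / √(n * ((s : ℝ) / n * (1 + (s : ℝ) / n))) := by gcongr; exact h.sum_ys_sq_le
    _ = _ := by ring

end Step

end Good

namespace Good

theorem inv_sqrt_bounds {u p : ℝ} (hu : -(1 / 3) ≤ u) (hp : 0 < p) (hpu : p ^ 2 * (1 + u) = 1) :
    |p - 1| ≤ |u| := by
  rcases le_or_gt 0 u with h | h
  · rw [abs_of_nonneg h, abs_le]
    have h1 : p ^ 2 ≤ 1 := by linarith [mul_nonneg (sq_nonneg p) h]
    have h2 : p ≤ 1 := by
      by_contra! h3
      have := one_lt_pow₀ h3 two_ne_zero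
      linarith
    constructor
    · have h3 : 1 ≤ p * (1 + u) := by
        calc (1 : ℝ) = p * (p * (1 + u)) := by linarith
          _ ≤ 1 * (p * (1 + u)) := by gcongr
          _ = _ := one_mul _
      have : p * u ≤ 1 * u := by gcongr
      linarith
    · linarith
  · have h1 : 1 ≤ p ^ 2 := by linarith [mul_nonneg (sq_nonneg p) (neg_nonneg.2 h.le)]
    have h2 : 1 ≤ p := by
      by_contra! h3
      have := pow_lt_one₀ hp.le h3 two_ne_zero
      linarith
    rw [abs_of_neg h, abs_of_nonneg (by linarith)]
    have h4 : p ^ 2 ≤ (1 - u) ^ 2 := by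
      have e : 0 ≤ -u * (1 + u - u ^ 2) := mul_nonneg (by linarith) (by nlinarith)
      have e2 : 1 ≤ (1 - u) ^ 2 * (1 + u) := by linarith
      have e3 : 0 < 1 + u := by linarith
      have e4 : p ^ 2 * (1 + u) ≤ (1 - u) ^ 2 * (1 + u) := by rw [hpu]; exact e2
      exact le_of_mul_le_mul_right e4 e3
    have := abs_le_of_sq_le_sq' h4 (by linarith) |>.2
    linarith

theorem density_ratio_le {u p e i η : ℝ} (hi : 2 ≤ i) (hη : 0 ≤ η) (hη8 : η ≤ 1 / 8)
    (hηu : 4 * η * (1 + u) ≤ 1)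
    (hu : -(1 / (i + 1)) ≤ u) (hpu : p ^ 2 * (1 + u) = 1)
    (he : |e| ≤ η * (1 / i + |u|)) : p + e ≤ 1 + 1 / i := by
  have hi0 : 0 < 1 / i := by positivity
  have hei := (le_abs_self e).trans he
  have hηi : η * (1 / i) ≤ 1 / 8 * (1 / i) := by gcongr
  rcases le_or_gt 0 u with h | h
  · rw [abs_of_nonneg h] at hei
    have h1 : p ≤ 1 - η * u := by
      have e0 : η * u ≤ 1 / 4 := by linarith
      refine abs_le_of_sq_le_sq' ?_ (by linarith) |>.2
      have e1 : 1 ≤ (1 - η * u) ^ 2 * (1 + u) := by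
        have e2 : 0 ≤ u * (1 - 2 * η * (1 + u)) := mul_nonneg h (by
          have : 0 ≤ η * (1 + u) := by positivity
          linarith)
        have e3 : 0 ≤ (η * u) ^ 2 * (1 + u) := by positivity
        linarith
      have e4 : p ^ 2 * (1 + u) ≤ (1 - η * u) ^ 2 * (1 + u) := by rw [hpu]; exact e1
      exact le_of_mul_le_mul_right e4 (by linarith)
    linarith
  · rw [abs_of_neg h] at hei
    have hii : 1 / (i + 1) ≤ 1 / i := by gcongr; linarith
    have h1 : p ≤ 1 + 1 / (2 * i) := by
      refine abs_le_of_sq_le_sq' ?_ (by positivity) |>.2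
      have e0 : i / (i + 1) ≤ 1 + u := by
        have : i / (i + 1) = 1 - 1 / (i + 1) := by field_simp; ring
        linarith
      have e1 : p ^ 2 * (i / (i + 1)) ≤ 1 :=
        (mul_le_mul_of_nonneg_left e0 (sq_nonneg p)).trans hpu.le
      have e2 : p ^ 2 ≤ (i + 1) / i := by
        rw [le_div_iff₀ (by linarith)]
        rw [mul_div_assoc', div_le_one (by linarith)] at e1
        exact e1
      refine e2.trans ?_
      have : (1 + 1 / (2 * i)) ^ 2 = (i + 1) / i + 1 / (4 * i ^ 2) := by field_simp; ring
      rw [this]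
      have : 0 ≤ 1 / (4 * i ^ 2) := by positivity
      linarith
    have h2 : η * -u ≤ 1 / 8 * (1 / i) := by
      calc η * -u ≤ 1 / 8 * -u := by gcongr; linarith
        _ ≤ _ := by gcongr; linarith
    have h3 : 1 / (2 * i) = 1 / 2 * (1 / i) := by field_simp
    linarith

/-- One step of the error recursion. -/
theorem error_step {u p e i η κ v ε : ℝ} (hi : 2 ≤ i) (hη : 0 < η) (hη8 : η ≤ 1 / 8)
    (hηu : 4 * η * (1 + u) ≤ 1)
    (hu : -(1 / (i + 1)) ≤ u) (hp : 0 < p) (hpu : p ^ 2 * (1 + u) = 1)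
    (he : |e| ≤ η * (1 / i + |u|)) (hκ : |κ| ≤ η * (1 / i ^ 2 + |u| / i))
    (hv : v ≤ η ^ 2 * (1 / i ^ 3 + |u| / i ^ 2)) (hε0 : 0 ≤ ε) (hε : ε ≤ 1) :
    |p + e - 1| + ε * (p + e) + (i - 1) ^ 2 / η * (u ^ 2 * (p + e) + 2 * u * κ + v)
      ≤ ε + 20 * η / i + i ^ 2 / η * u ^ 2 := by
  have hi0 : 0 < i := by linarith
  have hi3 : 1 / (i + 1) ≤ 1 / 3 := by
    rw [div_le_div_iff₀ (by linarith) (by norm_num)]; linarith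
  have h1 := inv_sqrt_bounds (by linarith) hp hpu
  have h2 := density_ratio_le hi hη.le hη8 hηu hu hpu he
  have hu0 := abs_nonneg u
  have h3 : |p + e - 1| ≤ 2 * |u| + η / i := by
    calc |p + e - 1| = |(p - 1) + e| := by ring_nf
      _ ≤ |p - 1| + |e| := abs_add_le _ _
      _ ≤ |u| + η * (1 / i + |u|) := add_le_add h1 he
      _ = |u| + η * |u| + η / i := by ring
      _ ≤ |u| + 1 * |u| + η / i := by gcongr; linarith
      _ = _ := by ring
  have h4 : ε * (p + e) ≤ ε + (2 * |u| + η / i) := by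
    have : ε * (p + e - 1) ≤ 1 * (2 * |u| + η / i) := by
      calc _ ≤ ε * |p + e - 1| := by gcongr; exact le_abs_self _
        _ ≤ _ := by gcongr
    linarith
  have hb : 0 ≤ (i - 1) ^ 2 / η := by positivity
  have hbi : (i - 1) ^ 2 / η ≤ i ^ 2 / η := by gcongr <;> linarith
  have h5 : (i - 1) ^ 2 / η * (u ^ 2 * (p + e)) ≤ i ^ 2 / η * u ^ 2 - i / η * u ^ 2 := by
    calc _ ≤ (i - 1) ^ 2 / η * (u ^ 2 * (1 + 1 / i)) := by gcongr
      _ = i ^ 2 / η * u ^ 2 - i / η * u ^ 2 - (i - 1) / (i * η) * u ^ 2 := by field_simp; ring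
      _ ≤ _ := by
        have : 0 ≤ (i - 1) / (i * η) * u ^ 2 :=
          mul_nonneg (div_nonneg (by linarith) (by positivity)) (sq_nonneg _)
        linarith
  have h6 : (i - 1) ^ 2 / η * (2 * u * κ) ≤ 2 * |u| + 2 * i * u ^ 2 := by
    calc _ ≤ (i - 1) ^ 2 / η * (2 * |u| * |κ|) := by
          refine mul_le_mul_of_nonneg_left ?_ hb
          calc _ ≤ |2 * u * κ| := le_abs_self _
            _ = _ := by rw [abs_mul, abs_mul, abs_two]
      _ ≤ i ^ 2 / η * (2 * |u| * (η * (1 / i ^ 2 + |u| / i))) := by gcongr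
      _ = 2 * |u| + 2 * i * |u| ^ 2 := by field_simp
      _ = _ := by rw [sq_abs]
  have h7 : (i - 1) ^ 2 / η * v ≤ η / i + |u| := by
    calc _ ≤ (i - 1) ^ 2 / η * (η ^ 2 * (1 / i ^ 3 + |u| / i ^ 2)) := by gcongr
      _ ≤ i ^ 2 / η * (η ^ 2 * (1 / i ^ 3 + |u| / i ^ 2)) := by gcongr
      _ = η / i + η * |u| := by field_simp
      _ ≤ η / i + 1 * |u| := by gcongr; linarith
      _ = _ := by ring
  have h8 : 2 * i * u ^ 2 ≤ 1 / 4 * (i / η * u ^ 2) := by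
    have : 2 ≤ 1 / 4 * (1 / η) := by
      rw [← div_le_iff₀' (by norm_num), le_div_iff₀ hη]; linarith
    calc 2 * i * u ^ 2 ≤ (1 / 4 * (1 / η)) * i * u ^ 2 := by gcongr
      _ = _ := by ring
  have h9 : 7 * |u| ≤ 3 / 4 * (i / η * u ^ 2) + 17 * (η / i) := by
    have := sq_nonneg (3 * i * |u| - 14 * η)
    rw [← sub_nonneg]
    have e : 3 / 4 * (i / η * u ^ 2) + 17 * (η / i) - 7 * |u|
        = ((3 * i * |u| - 14 * η) ^ 2 + 8 * η ^ 2) / (12 * i * η) := by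
      rw [← sq_abs u]; field_simp; ring
    rw [e]; positivity
  have h10 : 20 * η / i = 20 * (η / i) := by ring
  have e : (i - 1) ^ 2 / η * (u ^ 2 * (p + e) + 2 * u * κ + v)
    = (i - 1) ^ 2 / η * (u ^ 2 * (p + e)) + (i - 1) ^ 2 / η * (2 * u * κ)
      + (i - 1) ^ 2 / η * v := by ring
  rw [e, h10]
  linarith

end Good

namespace Good

variable {n : ℕ}

/-- Deviation of `rr` from its value in a typical situation. -/
noncomputable def uu (m s i : ℕ) (c : Fin n → ℕ) : ℝ :=
  rr s i c * ((1 + 1 / (m : ℝ)) / (1 + 1 / (i : ℝ))) - 1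

/-- Typical probability that one more row has the right sum. -/
noncomputable def kk (g : ℝ) (m j : ℕ) : ℝ :=
  g * √((((j : ℝ) + 2) * (m + 1)) / ((j + 1) * m))

theorem le_kk {g : ℝ} (hg : 0 ≤ g) {m : ℕ} (hm : 0 < m) (j : ℕ) : g ≤ kk g m j := by
  unfold kk
  apply le_mul_of_one_le_right hg
  rw [Real.one_le_sqrt, one_le_div (by positivity)]
  gcongr <;> linarith

namespace Step

variable {L : ℝ} {s j m : ℕ} {c : Fin n → ℕ}

theorem one_add_uu (h : Step L s j c) (hm : 0 < m) :
    1 + uu m s (j + 2) c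
      = (1 + ww s j c) * (((m : ℝ) + 1) * (j + 2) / (m * (j + 3))) := by
  unfold uu
  rw [h.rr_eq]
  push_cast
  have : (m : ℝ) ≠ 0 := by positivity
  have : (j : ℝ) + 3 ≠ 0 := by positivity
  have : (j : ℝ) + 2 + 1 ≠ 0 := by positivity
  field_simp
  ring

theorem uu_ge (h : Step L s j c) (hm : 0 < m) :
    -(1 / ((j : ℝ) + 2 + 1)) ≤ uu m s (j + 2) c := by
  have h1 := h.one_add_uu hm
  have h2 := h.ww_nonneg
  have h3 : ((j : ℝ) + 2) / (j + 3) ≤ ((m : ℝ) + 1) * (j + 2) / (m * (j + 3)) := by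
    rw [div_le_div_iff₀ (by positivity) (by positivity)]
    have : 0 ≤ ((j : ℝ) + 2) * (j + 3) := by positivity
    linarith
  have h4 : ((j : ℝ) + 2) / (j + 3) ≤ (1 + ww s j c) * (((m : ℝ) + 1) * (j + 2) / (m * (j + 3))) := by
    calc _ ≤ 1 * (((m : ℝ) + 1) * (j + 2) / (m * (j + 3))) := by rw [one_mul]; exact h3
      _ ≤ _ := by gcongr; linarith
  have h5 : ((j : ℝ) + 2) / (j + 3) = 1 - 1 / ((j : ℝ) + 2 + 1) := by
    have : (j : ℝ) + 3 ≠ 0 := by positivity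
    have : (j : ℝ) + 2 + 1 ≠ 0 := by positivity
    field_simp; ring
  linarith

theorem one_add_uu_pos (h : Step L s j c) (hm : 0 < m) : 0 < 1 + uu m s (j + 2) c := by
  rw [h.one_add_uu hm]
  have := h.ww_nonneg
  positivity

theorem one_add_uu_le (h : Step L s j c) (hm : 0 < m) : 1 + uu m s (j + 2) c ≤ L ^ 3 := by
  rw [h.one_add_uu hm]
  have h1 := h.ww_nonneg
  have h2 := h.ww_le
  have h3 : ((m : ℝ) + 1) * (j + 2) / (m * (j + 3)) ≤ 2 := by
    have : (1 : ℝ) ≤ m := by exact_mod_cast hm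
    rw [div_le_iff₀ (by positivity)]
    have : ((m : ℝ) + 1) * (j + 2) ≤ (m + m) * (j + 3) := by
      have : ((j : ℝ) + 2) ≤ j + 3 := by linarith
      gcongr
    linarith
  have h4 : 4 * L ^ 2 ≤ L ^ 3 := h.reg.mul_pow_le (by norm_num)
  have h5 : 1 ≤ L ^ 2 := h.reg.one_le_pow 2
  calc _ ≤ (L ^ 2 + L ^ 2) * 2 := by gcongr
    _ ≤ _ := by linarith

theorem ww_le_uu (h : Step L s j c) (hm : 0 < m) :
    ww s j c ≤ 1 / ((j : ℝ) + 2) + 2 * |uu m s (j + 2) c| := by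
  have h1 := h.one_add_uu hm
  have h2 := h.ww_nonneg
  have h0 := h.one_add_uu_pos hm
  set u := uu m s (j + 2) c
  have hm0 : (0 : ℝ) < m := by exact_mod_cast hm
  have h3 : 1 + ww s j c = (1 + u) * (((j : ℝ) + 3) / (j + 2) * (m / (m + 1))) := by
    rw [h1]; field_simp
  have h4 : (m : ℝ) / (m + 1) ≤ 1 := by rw [div_le_one (by positivity)]; linarith
  have h5 : ((j : ℝ) + 3) / (j + 2) = 1 + 1 / (j + 2) := by field_simp; ring
  have h6 : 1 / ((j : ℝ) + 2) ≤ 1 := by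
    rw [div_le_one (by positivity)]; linarith [Nat.cast_nonneg (α := ℝ) j]
  have h7 : 1 + ww s j c ≤ (1 + u) * (1 + 1 / (j + 2)) := by
    rw [h3, h5]
    calc _ ≤ (1 + u) * ((1 + 1 / ((j : ℝ) + 2)) * 1) := by gcongr
      _ = _ := by ring
  have h8 : u * (1 + 1 / ((j : ℝ) + 2)) ≤ |u| * 2 := by
    calc _ ≤ |u| * (1 + 1 / ((j : ℝ) + 2)) := by gcongr; exact le_abs_self u
      _ ≤ _ := by gcongr; linarith
  linarith

theorem uu_sub (s j m : ℕ) (c c' : Fin n → ℕ) :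
    uu m s (j + 1) c' - uu m s (j + 2) c
      = (1 + 1 / (m : ℝ)) * ((j + 1) / (j + 2))
        * (rr s (j + 1) c' - rr s (j + 2) c * (((j : ℝ) + 2) ^ 2 / ((j + 1) * (j + 3)))) := by
  unfold uu
  push_cast
  have : (j : ℝ) + 1 ≠ 0 := by positivity
  have : (j : ℝ) + 2 ≠ 0 := by positivity
  have : (j : ℝ) + 3 ≠ 0 := by positivity
  have : (j : ℝ) + 1 + 1 ≠ 0 := by positivity
  have : (j : ℝ) + 2 + 1 ≠ 0 := by positivity
  have e1 : (1 : ℝ) + 1 / (j + 1) = (j + 2) / (j + 1) := by field_simp; ring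
  have e2 : (1 : ℝ) + 1 / (j + 2) = (j + 3) / (j + 2) := by field_simp; ring
  rw [e1, e2]
  generalize (1 : ℝ) + 1 / m = q
  field_simp
  ring

theorem coef_le_two (hm : 0 < m) (j : ℕ) :
    (1 + 1 / (m : ℝ)) * (((j : ℝ) + 1) / (j + 2)) ≤ 2 := by
  have h1 : 1 / (m : ℝ) ≤ 1 := by
    rw [div_le_one (by positivity)]; exact_mod_cast hm
  have h2 : ((j : ℝ) + 1) / (j + 2) ≤ 1 := by rw [div_le_one (by positivity)]; linarith
  calc _ ≤ (1 + 1 : ℝ) * 1 := by gcongr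
    _ = 2 := by norm_num

theorem inv_sqrt_le_kk (h : Step L s j c) (hm : 0 < m) :
    1 / √(n * ((s : ℝ) / n * (1 + (s : ℝ) / n))) ≤ 3 * kk (gg n s) m j := by
  have h1 := h.reg.gg_bounds.1
  have h2 := le_kk h.reg.gg_pos.le hm j
  have h3 : 1 / √(n * ((s : ℝ) / n * (1 + (s : ℝ) / n)))
    = 3 * (1 / (3 * √(n * ((s : ℝ) / n * (1 + (s : ℝ) / n))))) := by field_simp
  rw [h3]; linarith

theorem kk_pos (h : Step L s j c) (hm : 0 < m) : 0 < kk (gg n s) m j :=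
  h.reg.gg_pos.trans_le (le_kk h.reg.gg_pos.le hm j)

theorem abs_le_kk (h : Step L s j c) (hm : 0 < m) {q B : ℝ} (hB : 0 ≤ B)
    (hq : |q| ≤ B / √(n * ((s : ℝ) / n * (1 + (s : ℝ) / n)))) :
    |q / kk (gg n s) m j| ≤ 3 * B := by
  have hk := h.kk_pos hm
  rw [abs_div, abs_of_pos hk, div_le_iff₀ hk]
  refine hq.trans ?_
  rw [div_eq_mul_one_div]
  calc _ ≤ B * (3 * kk (gg n s) m j) := by gcongr; exact h.inv_sqrt_le_kk hm
    _ = _ := by ring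

/-- Relative accuracy of the probability that the next row has the right sum. -/
theorem abs_e_le (h : Step L s j c) (hm : 0 < m) :
    |OP s j c (fun _ => 1) / kk (gg n s) m j - 1 / √(1 + uu m s (j + 2) c)|
      ≤ L ^ 29 / √n * (1 / ((j : ℝ) + 2) + |uu m s (j + 2) c|) := by
  have hk := h.kk_pos hm
  have h1 := h.abs_OP_one_sub_le
  have hu := h.one_add_uu_pos hm
  have h2 := h.ww_le_uu hm
  have hw := h.ww_nonneg
  have hL := h.reg.L_pos
  have e1 : √(n * ((s : ℝ) / n * (1 + (s : ℝ) / n)) / VV j c) * gg n s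
      = 1 / √(1 + uu m s (j + 2) c) * kk (gg n s) m j := by
    have e2 : n * ((s : ℝ) / n * (1 + (s : ℝ) / n)) / VV j c
        = ((((j : ℝ) + 2) * (m + 1)) / ((j + 1) * m)) / (1 + uu m s (j + 2) c) := by
      rw [h.VV_eq, h.one_add_uu hm]
      have := h.reg.a_pos
      have hm0 : (0 : ℝ) < m := by exact_mod_cast hm
      have hw1 : 0 < 1 + ww s j c := by linarith
      generalize n * ((s : ℝ) / n * (1 + (s : ℝ) / n)) = a at *
      field_simp
    rw [e2, Real.sqrt_div (by positivity)]
    unfold kk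
    ring
  rw [e1] at h1
  have h3 : OP s j c (fun _ => 1) / kk (gg n s) m j - 1 / √(1 + uu m s (j + 2) c)
      = (OP s j c (fun _ => 1) - 1 / √(1 + uu m s (j + 2) c) * kk (gg n s) m j)
        / kk (gg n s) m j := by field_simp
  rw [h3]
  refine (h.abs_le_kk hm (by positivity) h1).trans ?_
  have h4 : 1 / ((j : ℝ) + 3) ≤ 1 / (j + 2) := by gcongr; norm_num
  have h5 : 6 * L ^ 14 ≤ L ^ 29 :=
    (h.reg.mul_pow_le (by norm_num)).trans (h.reg.pow_le_pow (by norm_num))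
  set u := uu m s (j + 2) c
  have hu0 := abs_nonneg u
  calc _ ≤ 3 * (L ^ 14 / √n * (2 * (1 / ((j : ℝ) + 2) + |u|))) := by gcongr; linarith
    _ = 6 * L ^ 14 / √n * (1 / ((j : ℝ) + 2) + |u|) := by ring
    _ ≤ _ := by gcongr

theorem abs_drift_le (h : Step L s j c) (hm : 0 < m) :
    |OP s j c (fun v => uu m s (j + 1) (c - v) - uu m s (j + 2) c) / kk (gg n s) m j|
      ≤ L ^ 29 / √n * (1 / ((j : ℝ) + 2) ^ 2 + |uu m s (j + 2) c| / (j + 2)) := by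
  have h1 := h.abs_OP_rr_le
  have h2 := h.ww_le_uu hm
  have hw := h.ww_nonneg
  have hL := h.reg.L_pos
  have hLL := h.reg.one_le_L
  have hn := h.reg.n_pos
  have hn1 := h.reg.one_le_n
  have hj := h.hj
  have hc := coef_le_two hm j
  simp only [uu_sub]
  rw [OP_mul_left]
  set q := (1 + 1 / (m : ℝ)) * (((j : ℝ) + 1) / (j + 2)) with hq
  have hq0 : 0 ≤ q := by positivity
  set R := OP s j c (fun v => rr s (j + 1) (c - v)
        - rr s (j + 2) c * (((j : ℝ) + 2) ^ 2 / ((j + 1) * (j + 3))))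
  have h3 := h.abs_le_kk hm (q := R) (by positivity) h1
  rw [mul_div_assoc, abs_mul, abs_of_nonneg hq0]
  set u := uu m s (j + 2) c
  set w := ww s j c
  have hu0 := abs_nonneg u
  set i : ℝ := (j : ℝ) + 2 with hi
  have hi0 : 0 < i := by positivity
  have hr : 0 < √(n : ℝ) := by positivity
  have hrn : √(n : ℝ) ^ 2 = n := Real.sq_sqrt hn.le
  have hr1 : 1 ≤ √(n : ℝ) := Real.one_le_sqrt.2 hn1
  have hi2 : i ≤ 2 * ((j : ℝ) + 1) := by rw [hi]; linarith [Nat.cast_nonneg (α := ℝ) j]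
  have b1 : 1 / ((j : ℝ) + 1) ≤ 2 / i := by
    rw [div_le_div_iff₀ (by positivity) hi0]; linarith
  have b2 : 1 / ((j : ℝ) + 1) ^ 2 ≤ 4 / i ^ 2 := by
    have : (1 / ((j : ℝ) + 1)) ^ 2 ≤ (2 / i) ^ 2 := by gcongr
    rw [div_pow, div_pow] at this
    norm_num at this ⊢; exact this
  have b3 : √w / n ≤ w / √n + L / i / √n := by
    have e1 : √w ≤ w * √n + 1 / √n := by
      have e2 : 0 ≤ (√w * √n - 1) ^ 2 + √w * √n := by positivity
      have e3 : √w ^ 2 = w := Real.sq_sqrt hw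
      have e4 : w * √n + 1 / √n - √w = ((√w * √n - 1) ^ 2 + √w * √n) / √n := by
        rw [← e3]; field_simp; rw [Real.sqrt_sq (Real.sqrt_nonneg w)]; ring
      rw [← sub_nonneg, e4]; positivity
    have e5 : 1 / (n : ℝ) ≤ L / i := by
      rw [div_le_div_iff₀ hn hi0]; linarith
    calc √w / n ≤ (w * √n + 1 / √n) / n := by gcongr
      _ = w * (√n / n) + 1 / n / √n := by ring
      _ = w / √n + 1 / n / √n := by
        congr 1
        rw [← hrn]; field_simp
        rw [Real.sqrt_sq hr.le]
      _ ≤ _ := by gcongr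
  have b4 : 1 / (n : ℝ) ≤ 1 / √n := by
    gcongr
    calc √(n : ℝ) = √n * 1 := by ring
      _ ≤ √n * √n := by gcongr
      _ = n := by rw [← sq, hrn]
  have b5 : (√w / (j + 1) + 1 / ((j : ℝ) + 1) ^ 2) / n
      ≤ 8 * L / √n * (1 / i ^ 2 + |u| / i) := by
    calc _ = √w / n * (1 / ((j : ℝ) + 1)) + 1 / n * (1 / ((j : ℝ) + 1) ^ 2) := by ring
      _ ≤ (w / √n + L / i / √n) * (2 / i) + 1 / √n * (4 / i ^ 2) := by gcongr
      _ ≤ ((1 / i + 2 * |u|) / √n + L / i / √n) * (2 / i) + 1 / √n * (4 / i ^ 2) := by gcongr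
      _ = ((6 + 2 * L) * (1 / i ^ 2) + 4 * (|u| / i)) / √n := by ring_nf
      _ ≤ ((8 * L) * (1 / i ^ 2) + (8 * L) * (|u| / i)) / √n := by gcongr <;> linarith
      _ = _ := by ring
  have h5 : 48 * L ^ 28 ≤ L ^ 29 := h.reg.mul_pow_le (by norm_num)
  calc q * |R / kk (gg n s) m j|
      ≤ 2 * (3 * (L ^ 27 / n * (√w / (j + 1) + 1 / ((j : ℝ) + 1) ^ 2))) := by gcongr
    _ = 6 * L ^ 27 * ((√w / (j + 1) + 1 / ((j : ℝ) + 1) ^ 2) / n) := by ring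
    _ ≤ 6 * L ^ 27 * (8 * L / √n * (1 / i ^ 2 + |u| / i)) := by gcongr
    _ = 48 * L ^ 28 / √n * (1 / i ^ 2 + |u| / i) := by ring
    _ ≤ _ := by gcongr

theorem variation_le (h : Step L s j c) (hm : 0 < m) :
    OP s j c (fun v => (uu m s (j + 1) (c - v) - uu m s (j + 2) c) ^ 2) / kk (gg n s) m j
      ≤ (L ^ 29 / √n) ^ 2 * (1 / ((j : ℝ) + 2) ^ 3 + |uu m s (j + 2) c| / (j + 2) ^ 2) := by
  have h1 := h.OP_rr_sq_le
  have h2 := h.ww_le_uu hm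
  have hw := h.ww_nonneg
  have hL := h.reg.L_pos
  have hn := h.reg.n_pos
  have hc := coef_le_two hm j
  simp only [uu_sub, mul_pow _ (_ - _) 2]
  rw [OP_mul_left]
  set q := (1 + 1 / (m : ℝ)) * (((j : ℝ) + 1) / (j + 2)) with hq
  have hq0 : 0 ≤ q := by positivity
  have hR0 : 0 ≤ OP s j c (fun v => (rr s (j + 1) (c - v)
        - rr s (j + 2) c * (((j : ℝ) + 2) ^ 2 / ((j + 1) * (j + 3)))) ^ 2) :=
    OP_nonneg fun _ _ => sq_nonneg _
  set R := OP s j c (fun v => (rr s (j + 1) (c - v)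
        - rr s (j + 2) c * (((j : ℝ) + 2) ^ 2 / ((j + 1) * (j + 3)))) ^ 2)
  have h3 := (le_abs_self _).trans (h.abs_le_kk hm (q := R)
    (B := L ^ 16 / n * (ww s j c / ((j : ℝ) + 1) ^ 2 + 1 / ((j : ℝ) + 1) ^ 4)) (by positivity)
    (by rw [abs_of_nonneg hR0]; exact h1))
  rw [mul_div_assoc]
  set u := uu m s (j + 2) c
  set w := ww s j c
  have hu0 := abs_nonneg u
  set i : ℝ := (j : ℝ) + 2 with hi
  have hi0 : 0 < i := by positivity
  have hi1 : 1 ≤ i := by rw [hi]; linarith [Nat.cast_nonneg (α := ℝ) j]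
  have hrn : √(n : ℝ) ^ 2 = n := Real.sq_sqrt hn.le
  have hi2 : i ≤ 2 * ((j : ℝ) + 1) := by rw [hi]; linarith [Nat.cast_nonneg (α := ℝ) j]
  have b1 : 1 / ((j : ℝ) + 1) ≤ 2 / i := by
    rw [div_le_div_iff₀ (by positivity) hi0]; linarith
  have b2 : 1 / ((j : ℝ) + 1) ^ 2 ≤ 4 / i ^ 2 := by
    have : (1 / ((j : ℝ) + 1)) ^ 2 ≤ (2 / i) ^ 2 := by gcongr
    rw [div_pow, div_pow] at this
    norm_num at this ⊢; exact this
  have b4 : 1 / ((j : ℝ) + 1) ^ 4 ≤ 16 / i ^ 3 := by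
    have : (1 / ((j : ℝ) + 1)) ^ 4 ≤ (2 / i) ^ 4 := by gcongr
    rw [div_pow, div_pow, one_pow] at this
    refine this.trans ?_
    norm_num
    gcongr
    norm_num
  have b5 : w / ((j : ℝ) + 1) ^ 2 + 1 / ((j : ℝ) + 1) ^ 4 ≤ 20 * (1 / i ^ 3 + |u| / i ^ 2) := by
    calc _ = w * (1 / ((j : ℝ) + 1) ^ 2) + 1 / ((j : ℝ) + 1) ^ 4 := by ring
      _ ≤ (1 / i + 2 * |u|) * (4 / i ^ 2) + 16 / i ^ 3 := by gcongr
      _ = 20 * (1 / i ^ 3) + 8 * (|u| / i ^ 2) := by ring_nf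
      _ ≤ _ := by
        have : 0 ≤ |u| / i ^ 2 := by positivity
        linarith
  have h5 : 240 * L ^ 16 ≤ L ^ 58 :=
    (h.reg.mul_pow_le (by norm_num)).trans (h.reg.pow_le_pow (by norm_num))
  have h0 : 0 ≤ R / kk (gg n s) m j := div_nonneg hR0 (h.kk_pos hm).le
  calc q ^ 2 * (R / kk (gg n s) m j)
      ≤ 2 ^ 2 * (3 * (L ^ 16 / n * (w / ((j : ℝ) + 1) ^ 2 + 1 / ((j : ℝ) + 1) ^ 4))) := by gcongr
    _ ≤ 2 ^ 2 * (3 * (L ^ 16 / n * (20 * (1 / i ^ 3 + |u| / i ^ 2)))) := by gcongr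
    _ = 240 * L ^ 16 / n * (1 / i ^ 3 + |u| / i ^ 2) := by ring
    _ ≤ L ^ 58 / n * (1 / i ^ 3 + |u| / i ^ 2) := by gcongr
    _ = _ := by rw [div_pow, hrn, ← pow_mul]

end Step

end Good

namespace Good

variable {n : ℕ}

/-- Typical value of `FF s j`. -/
noncomputable def KK (g : ℝ) (m j : ℕ) : ℝ := ∏ l ∈ Finset.range j, kk g m l

theorem KK_succ (g : ℝ) (m j : ℕ) : KK g m (j + 1) = KK g m j * kk g m j :=
  Finset.prod_range_succ _ _

theorem pow_le_KK {g : ℝ} (hg : 0 ≤ g) {m : ℕ} (hm : 0 < m) (j : ℕ) : g ^ j ≤ KK g m j := by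
  calc g ^ j = ∏ _l ∈ Finset.range j, g := by simp
    _ ≤ _ := Finset.prod_le_prod (fun _ _ => hg) (fun l _ => le_kk hg hm l)

/-- Penalty for exceptionally large column sums. -/
noncomputable def pen (s r₀ N j : ℕ) (c : Fin n → ℕ) : ℝ :=
  ∑ k, ∑ r ∈ Finset.Icc r₀ N, (1 / (2 * ((s : ℝ) / n))) ^ r * fm j (c k) r

theorem pen_nonneg (s r₀ N j : ℕ) (c : Fin n → ℕ) : 0 ≤ pen s r₀ N j c :=
  Finset.sum_nonneg fun _ _ => Finset.sum_nonneg fun _ _ =>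
    mul_nonneg (by positivity) (fm_nonneg _ _ _)

/-- Parameters of the induction on the number of rows. -/
structure Par (n m s r₀ K : ℕ) (z : ℝ) : Prop where
  hz : (10 : ℝ) ^ 6 ≤ z
  hlog : 2 * 10 ^ 7 * Real.log n ≤ z
  hK : 1 ≤ K
  hzK : 2 * K ≤ z * ((s : ℝ) / n)
  hnK : (n : ℝ) ≤ (z / (4 * (K + 1))) ^ K
  hn : (z * (1 + r₀)) ^ 100 ≤ n
  hm0 : 0 < m
  hm : (m : ℝ) + 1 ≤ z * n
  hr : z ^ 28 ≤ r₀

namespace Par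

variable {m s r₀ K : ℕ} {z : ℝ}

theorem z_pos (h : Par n m s r₀ K z) : 0 < z := by have := h.hz; linarith

theorem one_le (h : Par n m s r₀ K z) : 1 ≤ z * ((s : ℝ) / n) := by
  have h1 := h.hzK
  have : (1 : ℝ) ≤ K := by exact_mod_cast h.hK
  linarith

theorem reg {L : ℝ} (h : Par n m s r₀ K z) (h1 : z ≤ L) (h2 : L ≤ z * (1 + r₀)) :
    Reg L n ((s : ℝ) / n) where
  hL := h.hz.trans h1
  hl := h.one_le.trans (by gcongr)
  hn := (pow_le_pow_left₀ (h.z_pos.le.trans h1) h2 100).trans h.hn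
  hlog := h.hlog.trans h1

theorem le_max (h : Par n m s r₀ K z) : z ≤ z * (1 + r₀) := by
  have := h.z_pos
  have : 0 ≤ z * r₀ := by positivity
  linarith

theorem regM (h : Par n m s r₀ K z) : Reg (z * (1 + r₀)) n ((s : ℝ) / n) :=
  h.reg h.le_max le_rfl

theorem l_pos (h : Par n m s r₀ K z) : 0 < (s : ℝ) / n := h.regM.l_pos

theorem step {j : ℕ} {c : Fin n → ℕ} {L : ℝ} (h : Par n m s r₀ K z)
    (hj : j + 2 ≤ m) (hc : ∑ k, c k = (j + 2) * s)
    (hgood : ∀ k, (c k : ℝ) ≤ z * ((s : ℝ) / n) * (j + 2 + r₀))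
    (h1 : z * (1 + r₀ / (j + 2)) ≤ L) (h2 : L ≤ z * (1 + r₀)) : Step L s j c := by
  have hz := h.z_pos
  have hl := h.l_pos
  have h3 : z ≤ L := by
    have : 0 ≤ z * ((r₀ : ℝ) / (j + 2)) := by positivity
    linarith
  refine ⟨h.reg h3 h2, hc, fun k => ?_, ?_⟩
  · rw [div_le_iff₀ (by positivity)]
    refine (hgood k).trans ?_
    calc _ = z * (1 + r₀ / ((j : ℝ) + 2)) * ((s : ℝ) / n) * (j + 2) := by field_simp
      _ ≤ _ := by gcongr
  · have : ((j + 2 : ℕ) : ℝ) ≤ m := by exact_mod_cast hj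
    push_cast at this
    calc (j : ℝ) + 3 ≤ z * n := by linarith [h.hm]
      _ ≤ _ := by gcongr

theorem pow_le_pen {j : ℕ} {c : Fin n → ℕ} (h : Par n m s r₀ K z) (hj : j + 1 ≤ m)
    (hc : ∑ k, c k = (j + 1) * s) (k : Fin n)
    (hbad : z * ((s : ℝ) / n) * (j + 1 + r₀) < c k) :
    (n : ℝ) ^ (j + 1) ≤ pen s r₀ (m * s) j c := by
  have hz := h.z_pos
  have hl := h.l_pos
  have hn := h.regM.one_le_n
  have hK1 : (1 : ℝ) ≤ K := by exact_mod_cast h.hK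
  set l := (s : ℝ) / n with hl'
  set r := K * (j + 1 + r₀) with hr
  have hrR : (r : ℝ) = K * (j + 1 + r₀) := by rw [hr]; push_cast; ring
  have h2r : 2 * (r : ℝ) ≤ c k := by
    refine le_trans ?_ hbad.le
    calc 2 * (r : ℝ) = 2 * K * (j + 1 + r₀) := by rw [hrR]; ring
      _ ≤ _ := mul_le_mul_of_nonneg_right h.hzK (by positivity)
  have hrc : r ≤ c k := by
    have : (r : ℝ) ≤ c k := by linarith [Nat.cast_nonneg (α := ℝ) r]
    exact_mod_cast this
  have hmem : r ∈ Finset.Icc r₀ (m * s) := by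
    rw [Finset.mem_Icc]
    constructor
    · calc r₀ ≤ 1 * (j + 1 + r₀) := by omega
        _ ≤ _ := Nat.mul_le_mul_right _ h.hK
    · calc r ≤ c k := hrc
        _ ≤ ∑ k, c k := Finset.single_le_sum (f := c) (fun _ _ => Nat.zero_le _) (Finset.mem_univ k)
        _ = (j + 1) * s := hc
        _ ≤ _ := Nat.mul_le_mul_right _ hj
  have h1 : z / (4 * (K + 1)) ≤ 1 / (2 * l) * (((c k : ℝ) - r) / (j + r)) := by
    have e1 : z * l * (j + 1 + r₀) / 2 ≤ (c k : ℝ) - r := by linarith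
    have e2 : (j : ℝ) + r ≤ (K + 1) * (j + 1 + r₀) := by
      rw [hrR]; linarith [Nat.cast_nonneg (α := ℝ) r₀]
    have e3 : 0 < (j : ℝ) + r := by rw [hrR]; positivity
    calc z / (4 * (K + 1))
        = 1 / (2 * l) * (z * l * (j + 1 + r₀) / 2 / ((K + 1) * (j + 1 + r₀))) := by
          field_simp; ring
      _ ≤ _ := by
        have : 0 ≤ (c k : ℝ) - r := le_trans (by positivity) e1
        gcongr
  calc (n : ℝ) ^ (j + 1) ≤ n ^ (j + 1 + r₀) := pow_le_pow_right₀ hn (by omega)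
    _ ≤ ((z / (4 * (K + 1))) ^ K) ^ (j + 1 + r₀) := by gcongr; exact h.hnK
    _ = (z / (4 * (K + 1))) ^ r := by rw [← pow_mul]
    _ ≤ (1 / (2 * l) * (((c k : ℝ) - r) / (j + r))) ^ r := by gcongr
    _ = (1 / (2 * l)) ^ r * (((c k : ℝ) - r) / (j + r)) ^ r := mul_pow _ _ _
    _ ≤ (1 / (2 * l)) ^ r * fm j (c k) r := by gcongr; exact le_fm_pow j (c k) r hrc
    _ ≤ ∑ r ∈ Finset.Icc r₀ (m * s), (1 / (2 * l)) ^ r * fm j (c k) r :=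
        Finset.single_le_sum (f := fun r => (1 / (2 * l)) ^ r * fm j (c k) r)
          (fun _ _ => mul_nonneg (by positivity) (fm_nonneg _ _ _)) hmem
    _ ≤ _ := Finset.single_le_sum
          (f := fun k => ∑ r ∈ Finset.Icc r₀ (m * s), (1 / (2 * l)) ^ r * fm j (c k) r)
          (fun _ _ => Finset.sum_nonneg fun _ _ => mul_nonneg (by positivity) (fm_nonneg _ _ _))
          (Finset.mem_univ k)

end Par

theorem sum_sub_of_mem_comp {s j : ℕ} {c v : Fin n → ℕ} (hv : v ∈ comp s c)
    (hc : ∑ k, c k = (j + 1) * s) : ∑ k, (c - v) k = j * s := by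
  obtain ⟨h1, h2⟩ := mem_comp.1 hv
  have : ∑ k, (c - v) k + ∑ k, v k = ∑ k, c k := by
    rw [← Finset.sum_add_distrib]
    exact Finset.sum_congr rfl fun k _ => by simp [Nat.sub_add_cancel (h1 k)]
  rw [hc, h2] at this
  linarith

theorem FF_le_pow (s j : ℕ) (c : Fin n → ℕ) (hn : 0 < n) (hc : ∑ k, c k = (j + 1) * s) :
    FF s j c ≤ (1 / (1 + (s : ℝ) / n)) ^ j := by
  induction j generalizing c with
  | zero => rw [FF_zero s c (by simpa using hc)]; simp
  | succ j ih =>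
    rw [FF_succ]
    have hex : ∃ k, ((j : ℝ) + 2) * ((s : ℝ) / n) ≤ c k := by
      by_contra! hcon
      have h1 : ∑ k : Fin n, (c k : ℝ) < ∑ _k : Fin n, ((j : ℝ) + 2) * ((s : ℝ) / n) :=
        Finset.sum_lt_sum_of_nonempty ⟨⟨0, hn⟩, Finset.mem_univ _⟩ (fun k _ => hcon k)
      have h2 : ∑ k : Fin n, (c k : ℝ) = ((j : ℝ) + 2) * s := by
        rw [← Nat.cast_sum, hc]; push_cast; ring
      rw [h2] at h1
      have hn' : (n : ℝ) ≠ 0 := by positivity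
      simp only [Finset.sum_const, Finset.card_univ, Fintype.card_fin, nsmul_eq_mul] at h1
      have : (n : ℝ) * ((j + 2) * (s / n)) = (j + 2) * s := by field_simp
      linarith
    obtain ⟨k, hk⟩ := hex
    have h1 : OP s j c (fun _ => 1) ≤ 1 / (1 + (s : ℝ) / n) := by
      refine (OP_one_le s j c k).trans ((bbw_zero_le j (c k)).trans ?_)
      have : (s : ℝ) / n ≤ (c k : ℝ) / (j + 2) := by
        rw [le_div_iff₀ (by positivity)]; linarith
      gcongr
    calc OP s j c (fun v => FF s j (c - v))
        ≤ OP s j c (fun _ => (1 / (1 + (s : ℝ) / n)) ^ j * 1) := by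
          refine OP_mono fun v hv => ?_
          rw [mul_one]
          exact ih _ (sum_sub_of_mem_comp hv hc)
      _ = (1 / (1 + (s : ℝ) / n)) ^ j * OP s j c (fun _ => 1) := OP_mul_left _ _ _ _ _
      _ ≤ (1 / (1 + (s : ℝ) / n)) ^ j * (1 / (1 + (s : ℝ) / n)) := by gcongr
      _ = _ := (pow_succ _ _).symm

namespace Par

variable {m s r₀ K : ℕ} {z : ℝ}

theorem KK_pos (h : Par n m s r₀ K z) (j : ℕ) : 0 < KK (gg n s) m j :=
  lt_of_lt_of_le (pow_pos h.regM.gg_pos j) (pow_le_KK h.regM.gg_pos.le h.hm0 j)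

theorem abs_sub_le_of_bad {j : ℕ} {c : Fin n → ℕ} (h : Par n m s r₀ K z) (hj : j + 1 ≤ m)
    (hc : ∑ k, c k = (j + 1) * s) (k : Fin n)
    (hbad : z * ((s : ℝ) / n) * (j + 1 + r₀) < c k) :
    |FF s j c - KK (gg n s) m j| ≤ KK (gg n s) m j * pen s r₀ (m * s) j c := by
  have hpen := h.pow_le_pen hj hc k hbad
  have hl := h.l_pos
  have hn := h.regM.n_pos
  have hn1 := h.regM.one_le_n
  have hKK := h.KK_pos j
  have hF := FF_le_pow s j c (by exact_mod_cast hn) hc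
  have hF0 := FF_nonneg s j c
  have hp1 : 1 ≤ pen s r₀ (m * s) j c := (one_le_pow₀ hn1).trans hpen
  have hK1 : KK (gg n s) m j ≤ KK (gg n s) m j * pen s r₀ (m * s) j c :=
    le_mul_of_one_le_right hKK.le hp1
  have hg : 1 / (1 + (s : ℝ) / n) ≤ n * gg n s := by
    have h1 := h.regM.gg_bounds.1
    set l := (s : ℝ) / n
    have h9 : 3 ≤ √(n : ℝ) := by
      have := h.regM.pow_le_sqrt (p := 1) (by norm_num)
      have := h.regM.hL
      linarith
    have hrn : √(n : ℝ) * √n = n := Real.mul_self_sqrt hn.le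
    have h2 : √(n * (l * (1 + l))) ≤ √n * (1 + l) := by
      rw [Real.sqrt_mul hn.le]
      gcongr
      rw [Real.sqrt_le_left (by positivity)]
      nlinarith
    have h3 : 0 < √(n * (l * (1 + l))) := by positivity
    calc 1 / (1 + l) = 3 * √n / (3 * (√n * (1 + l))) := by field_simp
      _ ≤ √n * √n / (3 * (√n * (1 + l))) := by gcongr
      _ = n * (1 / (3 * (√n * (1 + l)))) := by rw [hrn]; ring
      _ ≤ n * (1 / (3 * √(n * (l * (1 + l))))) := by gcongr
      _ ≤ _ := by gcongr
  have hF1 : FF s j c ≤ KK (gg n s) m j * pen s r₀ (m * s) j c := by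
    have hg0 := h.regM.gg_pos
    calc FF s j c ≤ (n * gg n s) ^ j := hF.trans (by gcongr)
      _ = gg n s ^ j * n ^ j := by rw [mul_pow, mul_comm]
      _ ≤ KK (gg n s) m j * n ^ (j + 1) := by
        gcongr
        · exact pow_le_KK hg0.le h.hm0 j
        · omega
      _ ≤ _ := by gcongr
  rw [abs_le]
  constructor <;> linarith

end Par

end Good

namespace Good

variable {n : ℕ}

theorem Step.OP_pen_le {L : ℝ} {s j : ℕ} {c : Fin n → ℕ} (h : Step L s j c) (r₀ N : ℕ) :
    OP s j c (fun v => pen s r₀ N j (c - v))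
      ≤ (OP s j c (fun _ => 1) + L ^ 24 / n / √(n * ((s : ℝ) / n * (1 + (s : ℝ) / n))))
        * pen s r₀ N (j + 1) c := by
  unfold pen
  rw [OP_sum s j c Finset.univ (fun k v => ∑ r ∈ Finset.Icc r₀ N,
    (1 / (2 * ((s : ℝ) / n))) ^ r * fm j ((c - v) k) r), Finset.mul_sum]
  refine Finset.sum_le_sum fun k _ => ?_
  rw [OP_sum s j c (Finset.Icc r₀ N) (fun r v =>
    (1 / (2 * ((s : ℝ) / n))) ^ r * fm j ((c - v) k) r), Finset.mul_sum]
  refine Finset.sum_le_sum fun r _ => ?_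
  rw [OP_mul_left, mul_left_comm]
  exact mul_le_mul_of_nonneg_left (h.OP_fm_le k r) (by positivity)

/-- Growth factor of the penalty. -/
noncomputable def GG (n r₀ : ℕ) (z : ℝ) (j : ℕ) : ℝ :=
  ∏ l ∈ Finset.range j, (1 + 1 / ((l : ℝ) + 2) + (z * (1 + r₀ / ((l : ℝ) + 2))) ^ 25 / n)

/-- Accumulated relative error. -/
noncomputable def ee (η : ℝ) (j : ℕ) : ℝ := 20 * η * ∑ l ∈ Finset.range j, 1 / ((l : ℝ) + 2)

theorem ee_succ (η : ℝ) (j : ℕ) : ee η (j + 1) = ee η j + 20 * η / ((j : ℝ) + 2) := by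
  unfold ee; rw [Finset.sum_range_succ]; ring

theorem ee_nonneg {η : ℝ} (hη : 0 ≤ η) (j : ℕ) : 0 ≤ ee η j := by unfold ee; positivity

theorem OP_sq_eq (s j : ℕ) (c : Fin n → ℕ) (q : (Fin n → ℕ) → ℝ) (u : ℝ) :
    OP s j c (fun v => q v ^ 2) = u ^ 2 * OP s j c (fun _ => 1)
      + 2 * u * OP s j c (fun v => q v - u) + OP s j c (fun v => (q v - u) ^ 2) := by
  rw [← OP_mul_left, ← OP_mul_left, ← OP_add, ← OP_add]
  exact OP_congr fun v _ => by ring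

namespace Par

variable {m s r₀ K : ℕ} {z : ℝ}

theorem eta_pos (h : Par n m s r₀ K z) : 0 < (z * (1 + r₀)) ^ 29 / √n := by
  have := h.regM.n_pos
  have := h.regM.L_pos
  positivity

theorem eta_le (h : Par n m s r₀ K z) {p : ℕ} (hp : p ≤ 21) :
    (z * (1 + r₀)) ^ p * ((z * (1 + r₀)) ^ 29 / √n) ≤ 1 := by
  have hn := h.regM.n_pos
  rw [← mul_div_assoc, ← pow_add, div_le_one (by positivity)]
  exact h.regM.pow_le_sqrt (by omega)

theorem GG_one_le (h : Par n m s r₀ K z) (j : ℕ) : 1 ≤ GG n r₀ z j := by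
  have := h.z_pos
  calc (1 : ℝ) = ∏ _l ∈ Finset.range j, 1 := by simp
    _ ≤ _ := Finset.prod_le_prod (fun _ _ => zero_le_one) fun l _ => ?_
  have h1 : 0 ≤ 1 / ((l : ℝ) + 2) := by positivity
  have h2 : 0 ≤ (z * (1 + r₀ / ((l : ℝ) + 2))) ^ 25 / n := by positivity
  linarith

theorem abs_sub_le_of_good {j : ℕ} {c : Fin n → ℕ} (h : Par n m s r₀ K z) (hj : j + 2 ≤ m)
    (hc : ∑ k, c k = (j + 2) * s)
    (hgood : ∀ k, (c k : ℝ) ≤ z * ((s : ℝ) / n) * (j + 2 + r₀)) {η G : ℝ}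
    (hη : η = (z * (1 + r₀)) ^ 29 / √n) (hε : ee η j ≤ 1) (hG : 1 ≤ G)
    (ih : ∀ v ∈ comp s c, |FF s j (c - v) - KK (gg n s) m j| ≤ KK (gg n s) m j
      * (ee η j + ((j : ℝ) + 1) ^ 2 / η * uu m s (j + 1) (c - v) ^ 2
        + G * pen s r₀ (m * s) j (c - v))) :
    |FF s (j + 1) c - KK (gg n s) m (j + 1)| ≤ KK (gg n s) m (j + 1)
      * (ee η (j + 1) + ((j : ℝ) + 2) ^ 2 / η * uu m s (j + 2) c ^ 2
        + G * (1 + 1 / ((j : ℝ) + 2) + (z * (1 + r₀ / ((j : ℝ) + 2))) ^ 25 / n)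
          * pen s r₀ (m * s) (j + 1) c) := by
  have hz := h.z_pos
  have hLM : z * (1 + r₀ / ((j : ℝ) + 2)) ≤ z * (1 + r₀) := by
    have : (r₀ : ℝ) / (j + 2) ≤ r₀ :=
      div_le_self (by positivity) (by linarith [Nat.cast_nonneg (α := ℝ) j])
    gcongr
  have S := h.step hj hc hgood hLM le_rfl
  have S' := h.step hj hc hgood le_rfl hLM
  have hm := h.hm0
  have hkk := S.kk_pos hm
  have hKK := h.KK_pos j
  have hη0 : 0 < η := hη ▸ h.eta_pos
  have he := S.abs_e_le hm
  have hκ := S.abs_drift_le hm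
  have hv := S.variation_le hm
  rw [← hη] at he hκ hv
  have hP := S'.OP_pen_le r₀ (m * s)
  have hinv := S'.inv_sqrt_le_kk hm
  have hu3 := S.one_add_uu_le hm
  have hu0 := S.one_add_uu_pos hm
  have huge := S.uu_ge hm
  have hpen := pen_nonneg s r₀ (m * s) (j + 1) c
  have hL25 : 3 * (z * (1 + r₀ / ((j : ℝ) + 2))) ^ 24 ≤ (z * (1 + r₀ / ((j : ℝ) + 2))) ^ 25 :=
    S'.reg.mul_pow_le (by norm_num)
  have hL0 := S'.reg.L_pos
  have hn := h.regM.n_pos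
  have hM : (10 : ℝ) ^ 6 ≤ z * (1 + r₀) := h.regM.hL
  have hη1 : z * (1 + r₀) * η ≤ 1 := by
    have := h.eta_le (p := 1) (by norm_num); rw [pow_one, ← hη] at this; exact this
  have hη4 : 4 * η * (z * (1 + r₀)) ^ 3 ≤ 1 := by
    have h4 := h.eta_le (p := 4) (by norm_num); rw [← hη] at h4
    have h5 : 4 * (z * (1 + r₀)) ^ 3 ≤ (z * (1 + r₀)) ^ 4 := h.regM.mul_pow_le (by norm_num)
    calc _ = 4 * (z * (1 + r₀)) ^ 3 * η := by ring
      _ ≤ (z * (1 + r₀)) ^ 4 * η := by gcongr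
      _ ≤ 1 := h4
  set M := z * (1 + (r₀ : ℝ))
  set L := z * (1 + (r₀ : ℝ) / ((j : ℝ) + 2))
  have hη8 : η ≤ 1 / 8 := by
    have : 8 * η ≤ M * η := by gcongr; linarith
    linarith
  set u := uu m s (j + 2) c
  set i : ℝ := (j : ℝ) + 2 with hi
  have hi2 : 2 ≤ i := by rw [hi]; linarith [Nat.cast_nonneg (α := ℝ) j]
  have hji : (j : ℝ) + 1 = i - 1 := by rw [hi]; ring
  set k := kk (gg n s) m j
  set f := OP s j c (fun _ => 1) with hf
  set p := 1 / √(1 + u) with hp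
  set e := f / k - p with hedef
  have hp0 : 0 < p := by positivity
  have hpu : p ^ 2 * (1 + u) = 1 := by
    rw [hp, div_pow, Real.sq_sqrt hu0.le]; field_simp
  have hηu : 4 * η * (1 + u) ≤ 1 :=
    (mul_le_mul_of_nonneg_left hu3 (by positivity)).trans hη4
  have hpe : p + e = f / k := by rw [hedef]; ring
  have hfk : f = k * (p + e) := by rw [hpe]; field_simp
  have hdens := density_ratio_le hi2 hη0.le hη8 hηu huge hpu he
  have herr := error_step hi2 hη0 hη8 hηu huge hp0 hpu he hκ hv (ee_nonneg hη0.le j) hε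
  have hf0 : 0 ≤ f := OP_nonneg fun _ _ => zero_le_one
  have hsq := OP_sq_eq s j c (fun v => uu m s (j + 1) (c - v)) u
  set κ := OP s j c (fun v => uu m s (j + 1) (c - v) - u) with hκdef
  set w := OP s j c (fun v => (uu m s (j + 1) (c - v) - u) ^ 2) with hwdef
  set T := OP s j c (fun v => pen s r₀ (m * s) j (c - v)) with hT
  set Q := pen s r₀ (m * s) (j + 1) c
  set B := KK (gg n s) m j
  have hTle : T ≤ k * ((1 + 1 / i + L ^ 25 / n) * Q) := by
    refine hP.trans ?_
    rw [← mul_assoc k]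
    refine mul_le_mul_of_nonneg_right ?_ hpen
    have h1 : L ^ 24 / n / √(n * ((s : ℝ) / n * (1 + (s : ℝ) / n))) ≤ k * (L ^ 25 / n) := by
      calc _ = L ^ 24 / n * (1 / √(n * ((s : ℝ) / n * (1 + (s : ℝ) / n)))) := by ring
        _ ≤ L ^ 24 / n * (3 * k) := by gcongr
        _ = k * (3 * L ^ 24 / n) := by ring
        _ ≤ _ := by gcongr
    have h2 : f ≤ k * (1 + 1 / i) := by rw [hfk]; gcongr
    linarith
  have hdecomp : FF s (j + 1) c - KK (gg n s) m (j + 1)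
      = OP s j c (fun v => FF s j (c - v) - B) + B * (k * (p + e - 1)) := by
    have h1 : OP s j c (fun v => FF s j (c - v) - B)
        = OP s j c (fun v => FF s j (c - v)) - B * f := by
      rw [hf, ← OP_mul_left, ← OP_sub]; simp only [mul_one]
    rw [h1, FF_succ, KK_succ, hfk]; ring
  have hOP : |OP s j c (fun v => FF s j (c - v) - B)|
      ≤ B * (ee η j * f + (i - 1) ^ 2 / η * (u ^ 2 * f + 2 * u * κ + w) + G * T) := by
    refine (OP_abs_le _ _ _ _).trans ((OP_mono ih).trans (le_of_eq ?_))
    rw [OP_mul_left s j c B (fun v => ee η j + ((j : ℝ) + 1) ^ 2 / η * uu m s (j + 1) (c - v) ^ 2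
        + G * pen s r₀ (m * s) j (c - v)),
      OP_add s j c (fun v => ee η j + ((j : ℝ) + 1) ^ 2 / η * uu m s (j + 1) (c - v) ^ 2)
        (fun v => G * pen s r₀ (m * s) j (c - v)),
      OP_add s j c (fun _ => ee η j)
        (fun v => ((j : ℝ) + 1) ^ 2 / η * uu m s (j + 1) (c - v) ^ 2),
      OP_mul_left, OP_mul_left, ← hsq, hji, hf, ← OP_mul_left s j c (ee η j)]
    simp only [mul_one]
    rfl
  have habs : |B * (k * (p + e - 1))| = B * (k * |p + e - 1|) := by
    rw [abs_mul, abs_mul, abs_of_pos hKK, abs_of_pos hkk]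
  rw [hdecomp]
  refine (abs_add_le _ _).trans ?_
  rw [habs, KK_succ, ee_succ]
  have hk1 : κ = k * (κ / k) := by field_simp
  have hk2 : w = k * (w / k) := by field_simp
  calc _ ≤ B * (ee η j * f + (i - 1) ^ 2 / η * (u ^ 2 * f + 2 * u * κ + w) + G * T)
        + B * (k * |p + e - 1|) := by gcongr
    _ = B * k * (|p + e - 1| + ee η j * (p + e)
          + (i - 1) ^ 2 / η * (u ^ 2 * (p + e) + 2 * u * (κ / k) + w / k)) + B * (G * T) := by
        rw [hfk]; nth_rewrite 1 [hk1, hk2]; ring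
    _ ≤ B * k * (ee η j + 20 * η / i + i ^ 2 / η * u ^ 2)
        + B * (G * (k * ((1 + 1 / i + L ^ 25 / n) * Q))) := by gcongr
    _ = _ := by ring

theorem abs_FF_sub_KK_le (h : Par n m s r₀ K z) {η : ℝ}
    (hη : η = (z * (1 + r₀)) ^ 29 / √n) (hε : ∀ j < m, ee η j ≤ 1) (j : ℕ) (hj : j < m)
    (c : Fin n → ℕ) (hc : ∑ k, c k = (j + 1) * s) :
    |FF s j c - KK (gg n s) m j| ≤ KK (gg n s) m j
      * (ee η j + ((j : ℝ) + 1) ^ 2 / η * uu m s (j + 1) c ^ 2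
        + GG n r₀ z j * pen s r₀ (m * s) j c) := by
  have hη0 : 0 < η := hη ▸ h.eta_pos
  induction j generalizing c with
  | zero =>
    rw [FF_zero s c (by simpa using hc)]
    have h1 : KK (gg n s) m 0 = 1 := by simp [KK]
    rw [h1, sub_self, abs_zero, one_mul]
    have := ee_nonneg hη0.le 0
    have := pen_nonneg s r₀ (m * s) 0 c
    have := h.GG_one_le 0
    positivity
  | succ j ih =>
    by_cases hgood : ∀ k, (c k : ℝ) ≤ z * ((s : ℝ) / n) * (j + 2 + r₀)
    · have h1 := h.abs_sub_le_of_good (by omega) hc hgood hη (hε j (by omega)) (h.GG_one_le j)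
        (fun v hv => ih (by omega) _ (sum_sub_of_mem_comp hv hc))
      have e1 : ((j + 1 : ℕ) : ℝ) + 1 = j + 2 := by push_cast; ring
      have e2 : GG n r₀ z (j + 1) = GG n r₀ z j
          * (1 + 1 / ((j : ℝ) + 2) + (z * (1 + r₀ / ((j : ℝ) + 2))) ^ 25 / n) :=
        Finset.prod_range_succ _ _
      rw [e1, e2]
      exact h1
    · push Not at hgood
      obtain ⟨k, hk⟩ := hgood
      have e1 : ((j + 1 : ℕ) : ℝ) + 1 = j + 2 := by push_cast; ring
      refine (h.abs_sub_le_of_bad (by omega) hc k (by rw [e1]; exact hk)).trans ?_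
      refine mul_le_mul_of_nonneg_left ?_ (h.KK_pos _).le
      have h1 := ee_nonneg hη0.le (j + 1)
      have h2 := pen_nonneg s r₀ (m * s) (j + 1) c
      have h3 : pen s r₀ (m * s) (j + 1) c ≤ GG n r₀ z (j + 1) * pen s r₀ (m * s) (j + 1) c :=
        le_mul_of_one_le_left h2 (h.GG_one_le _)
      have h4 : 0 ≤ (((j + 1 : ℕ) : ℝ) + 1) ^ 2 / η * uu m s (j + 1 + 1) c ^ 2 := by positivity
      linarith

end Par

end Good

namespace Good

variable {n : ℕ}

theorem sum_inv_le_log {j m : ℕ} (h : j < m) :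
    ∑ l ∈ Finset.range j, 1 / ((l : ℝ) + 2) ≤ Real.log m := by
  have h1 := harmonic_le_one_add_log (j + 1)
  unfold harmonic at h1
  rw [Finset.sum_range_succ'] at h1
  push_cast at h1
  have h2 : Real.log ((j : ℝ) + 1) ≤ Real.log m := by
    apply Real.log_le_log (by positivity)
    exact_mod_cast h
  have h3 : ∑ l ∈ Finset.range j, 1 / ((l : ℝ) + 2)
      = ∑ l ∈ Finset.range j, ((l : ℝ) + 1 + 1)⁻¹ :=
    Finset.sum_congr rfl fun l _ => by rw [one_div, add_assoc]; norm_num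
  rw [h3]
  norm_num at h1
  linarith

namespace Par

variable {m s r₀ K : ℕ} {z : ℝ}

theorem log_le (h : Par n m s r₀ K z) : Real.log m ≤ z := by
  have hz := h.z_pos
  have hn := h.regM.n_pos
  have hm : (0 : ℝ) < m := by exact_mod_cast h.hm0
  have h1 : Real.log m ≤ Real.log (z * n) := Real.log_le_log hm (by linarith [h.hm])
  rw [Real.log_mul hz.ne' hn.ne'] at h1
  have h2 := Real.log_le_sub_one_of_pos (show 0 < z / 2 by positivity)
  rw [Real.log_div hz.ne' two_ne_zero] at h2
  have h3 := Real.log_two_lt_d9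
  have h4 := h.hlog
  have h5 : 0 ≤ Real.log n := Real.log_nonneg h.regM.one_le_n
  linarith

theorem ee_le (h : Par n m s r₀ K z) {j : ℕ} (hj : j < m) :
    ee ((z * (1 + r₀)) ^ 29 / √n) j ≤ (z * (1 + r₀)) ^ 31 / √n := by
  have hn := h.regM.n_pos
  have hM := h.regM.hL
  have hM0 := h.regM.L_pos
  have h1 : ∑ l ∈ Finset.range j, 1 / ((l : ℝ) + 2) ≤ z * (1 + r₀) :=
    (sum_inv_le_log hj).trans (h.log_le.trans h.le_max)
  have h2 := h.regM.mul_pow_le (p := 30) (C := 20) (by norm_num)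
  unfold ee
  set M := z * (1 + (r₀ : ℝ))
  calc _ ≤ 20 * (M ^ 29 / √n) * M := by gcongr
    _ = 20 * M ^ 30 / √n := by ring
    _ ≤ _ := by gcongr

theorem ee_le_one (h : Par n m s r₀ K z) {j : ℕ} (hj : j < m) :
    ee ((z * (1 + r₀)) ^ 29 / √n) j ≤ 1 := by
  refine (h.ee_le hj).trans ?_
  have hn := h.regM.n_pos
  rw [div_le_one (by positivity)]
  exact h.regM.pow_le_sqrt (by norm_num)

theorem GG_le (h : Par n m s r₀ K z) {j : ℕ} (hj : j < m) :
    GG n r₀ z j ≤ Real.exp (2 ^ 25 * z ^ 26) := by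
  have hz := h.z_pos
  have hn := h.regM.n_pos
  have h1 : GG n r₀ z j ≤ Real.exp (∑ l ∈ Finset.range j,
      (1 / ((l : ℝ) + 2) + (z * (1 + r₀ / ((l : ℝ) + 2))) ^ 25 / n)) := by
    rw [Real.exp_sum]
    refine Finset.prod_le_prod (fun _ _ => by positivity) fun l _ => ?_
    have := Real.add_one_le_exp (1 / ((l : ℝ) + 2) + (z * (1 + r₀ / ((l : ℝ) + 2))) ^ 25 / n)
    linarith
  refine h1.trans (Real.exp_le_exp.2 ?_)
  rw [Finset.sum_add_distrib]
  have hs := sum_inv_le_log hj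
  have hl := h.log_le
  have h2 : ∀ l : ℕ, (z * (1 + r₀ / ((l : ℝ) + 2))) ^ 25 / n
      ≤ 2 ^ 24 / n * z ^ 25 + 2 ^ 24 / n * (z * r₀) ^ 25 * (1 / ((l : ℝ) + 2)) := by
    intro l
    have e1 := add_pow_le hz.le (show 0 ≤ z * (r₀ / ((l : ℝ) + 2)) by positivity) 25
    have e2 : (z * (r₀ / ((l : ℝ) + 2))) ^ 25 ≤ (z * r₀) ^ 25 * (1 / ((l : ℝ) + 2)) := by
      have e3 : z * (r₀ / ((l : ℝ) + 2)) = z * r₀ * (1 / ((l : ℝ) + 2)) := by ring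
      rw [e3, mul_pow]
      have e4 : 1 / ((l : ℝ) + 2) ≤ 1 := by
        rw [div_le_one (by positivity)]; linarith [Nat.cast_nonneg (α := ℝ) l]
      gcongr
      exact pow_le_of_le_one (by positivity) e4 (by norm_num)
    calc _ = (z + z * (r₀ / ((l : ℝ) + 2))) ^ 25 / n := by ring
      _ ≤ 2 ^ 24 * (z ^ 25 + (z * r₀) ^ 25 * (1 / ((l : ℝ) + 2))) / n := by
        gcongr
        refine e1.trans ?_
        gcongr
      _ = _ := by ring
  have h3 : ∑ l ∈ Finset.range j, (z * (1 + r₀ / ((l : ℝ) + 2))) ^ 25 / n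
      ≤ 2 ^ 24 * z ^ 26 + 1 := by
    refine (Finset.sum_le_sum fun l _ => h2 l).trans ?_
    rw [Finset.sum_add_distrib, Finset.sum_const, Finset.card_range, nsmul_eq_mul, ← Finset.mul_sum]
    have hjm : (j : ℝ) ≤ z * n := by
      have : (j : ℝ) ≤ m := by exact_mod_cast hj.le
      linarith [h.hm]
    have hM := h.regM.hL
    have hM0 := h.regM.L_pos
    have hM30 := h.regM.pow_le_sqrt (p := 30) (by norm_num)
    have hsn : √(n : ℝ) ≤ n := by
      rw [Real.sqrt_le_left hn.le]
      have := h.regM.one_le_n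
      nlinarith
    have hzr : z * r₀ ≤ z * (1 + r₀) := by gcongr; linarith
    have hsz := hs.trans (hl.trans h.le_max)
    have a1 : (j : ℝ) * (2 ^ 24 / n * z ^ 25) ≤ 2 ^ 24 * z ^ 26 := by
      calc _ ≤ z * n * (2 ^ 24 / n * z ^ 25) := by gcongr
        _ = _ := by field_simp
    have a2 : 2 ^ 24 / (n : ℝ) * (z * r₀) ^ 25 * ∑ l ∈ Finset.range j, 1 / ((l : ℝ) + 2) ≤ 1 := by
      set M := z * (1 + (r₀ : ℝ))
      have a3 : (2 : ℝ) ^ 24 ≤ M ^ 2 := by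
        calc (2 : ℝ) ^ 24 ≤ (10 ^ 6) ^ 2 := by norm_num
          _ ≤ _ := by gcongr
      calc _ ≤ M ^ 2 / (n : ℝ) * M ^ 25 * M := by gcongr
        _ = M ^ 28 / n := by ring
        _ ≤ 1 := by
          rw [div_le_one hn]
          have := h.regM.pow_le_sqrt (p := 28) (by norm_num)
          linarith
    linarith
  have h4 : z + 1 ≤ z ^ 26 := by
    have : 10 ^ 6 ≤ z := h.hz
    have h5 : z ^ 2 ≤ z ^ 26 := pow_le_pow_right₀ (by linarith) (by norm_num)
    nlinarith
  have h6 : 0 ≤ z ^ 26 := by positivity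
  linarith

end Par

theorem pen_const_le {s m t r₀ : ℕ} (hm : 0 < m) (hl : 0 < (s : ℝ) / n)
    (hst : (t : ℝ) / m = (s : ℝ) / n) (N : ℕ) :
    pen s r₀ N (m - 1) (fun _ : Fin n => t) ≤ 2 * n * (1 / 2) ^ r₀ := by
  unfold pen
  rw [Finset.sum_const, Finset.card_univ, Fintype.card_fin, nsmul_eq_mul]
  have h1 : ∑ r ∈ Finset.Icc r₀ N, (1 / (2 * ((s : ℝ) / n))) ^ r * fm (m - 1) t r
      ≤ ∑ r ∈ Finset.Ico r₀ (N + 1), (1 / 2 : ℝ) ^ r := by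
    have : Finset.Icc r₀ N = Finset.Ico r₀ (N + 1) := by ext; simp
    rw [this]
    refine Finset.sum_le_sum fun r _ => ?_
    have h2 := fm_le_pow (m - 1) t r
    have h3 : ((m - 1 : ℕ) : ℝ) + 1 = m := by
      rw [Nat.cast_sub hm]; push_cast; ring
    rw [h3, hst] at h2
    calc _ ≤ (1 / (2 * ((s : ℝ) / n))) ^ r * ((s : ℝ) / n) ^ r := by gcongr
      _ = _ := by
        rw [← mul_pow]; congr 1; generalize (s : ℝ) / n = l at *; field_simp
  have h2 := geom_sum_Ico_le_of_lt_one (x := (1 / 2 : ℝ)) (m := r₀) (n := N + 1) (by norm_num)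
    (by norm_num)
  have h3 : (1 / 2 : ℝ) ^ r₀ / (1 - 1 / 2) = 2 * (1 / 2) ^ r₀ := by ring
  rw [h3] at h2
  calc _ ≤ (n : ℝ) * (2 * (1 / 2) ^ r₀) := by gcongr; exact h1.trans h2
    _ = _ := by ring

theorem uu_const {s m t : ℕ} (hm : 0 < m) (hn : 0 < n) (hl : 0 < (s : ℝ) / n)
    (hst : (t : ℝ) / m = (s : ℝ) / n) : uu m s m (fun _ : Fin n => t) = 0 := by
  unfold uu rr
  rw [Finset.sum_const, Finset.card_univ, Fintype.card_fin, nsmul_eq_mul, hst]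
  have : (0 : ℝ) < m := by exact_mod_cast hm
  have : (0 : ℝ) < n := by exact_mod_cast hn
  rw [div_self (by positivity), div_self (by positivity)]
  norm_num

/-- The probability that all row sums are right, for constant column sums. -/
theorem Par.abs_FF_const_le {m s r₀ K t : ℕ} {z : ℝ} (h : Par n m s r₀ K z)
    (hmt : m * s = n * t) :
    |FF s (m - 1) (fun _ : Fin n => t) / KK (gg n s) m (m - 1) - 1|
      ≤ 2 * ((z * (1 + r₀)) ^ 31 / √n) := by
  have hm0 := h.hm0
  have hn := h.regM.n_pos
  have hl := h.l_pos
  have hz := h.z_pos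
  have hm1 : m - 1 + 1 = m := by omega
  have hmR : (0 : ℝ) < m := by exact_mod_cast hm0
  have hst : (t : ℝ) / m = (s : ℝ) / n := by
    rw [div_eq_div_iff hmR.ne' hn.ne']
    have : (m : ℝ) * s = n * t := by exact_mod_cast hmt
    linarith
  have h1 := h.abs_FF_sub_KK_le rfl (fun j hj => h.ee_le_one hj) (m - 1) (by omega)
    (fun _ => t) (by rw [hm1, hmt]; simp)
  have hu : uu m s (m - 1 + 1) (fun _ : Fin n => t) = 0 := by
    rw [hm1]; exact uu_const hm0 (by exact_mod_cast hn) hl hst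
  have hKK := h.KK_pos (m - 1)
  rw [hu] at h1
  have h2 : GG n r₀ z (m - 1) * pen s r₀ (m * s) (m - 1) (fun _ : Fin n => t) ≤ 1 / n := by
    have e1 := h.GG_le (show m - 1 < m by omega)
    have e2 := pen_const_le (r₀ := r₀) hm0 hl hst (m * s)
    have e3 : (1 / 2 : ℝ) ^ r₀ ≤ Real.exp (-(z ^ 28 / 2)) := by
      have e4 : (1 / 2 : ℝ) ≤ Real.exp (-(1 / 2)) := by
        have := Real.add_one_le_exp (-(1 / 2) : ℝ)
        linarith
      calc (1 / 2 : ℝ) ^ r₀ ≤ Real.exp (-(1 / 2)) ^ r₀ := by gcongr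
        _ = Real.exp (-(r₀ / 2)) := by rw [← Real.exp_nat_mul]; ring_nf
        _ ≤ _ := by gcongr; exact h.hr
    have e5 : (n : ℝ) = Real.exp (Real.log n) := (Real.exp_log hn).symm
    have e6 := pen_nonneg s r₀ (m * s) (m - 1) (fun _ : Fin n => t)
    rw [le_div_iff₀ hn]
    calc _ ≤ Real.exp (2 ^ 25 * z ^ 26) * (2 * n * Real.exp (-(z ^ 28 / 2))) * n := by
          gcongr
          exact e2.trans (by gcongr)
      _ = 2 * Real.exp (2 ^ 25 * z ^ 26 + Real.log n + -(z ^ 28 / 2) + Real.log n) := by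
          rw [Real.exp_add, Real.exp_add, Real.exp_add, ← e5]; ring
      _ ≤ Real.exp 1 * Real.exp (2 ^ 25 * z ^ 26 + Real.log n + -(z ^ 28 / 2) + Real.log n) := by
          gcongr
          have := Real.add_one_le_exp (1 : ℝ)
          linarith
      _ = Real.exp (1 + (2 ^ 25 * z ^ 26 + Real.log n + -(z ^ 28 / 2) + Real.log n)) := by
          rw [Real.exp_add 1]
      _ ≤ 1 := by
          rw [Real.exp_le_one_iff]
          have f1 := h.hz
          have f2 : 10 ^ 12 * z ^ 26 ≤ z ^ 28 := by
            calc _ = (10 ^ 6) ^ 2 * z ^ 26 := by norm_num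
              _ ≤ z ^ 2 * z ^ 26 := by gcongr
              _ = _ := by ring
          have f3 : z ≤ z ^ 26 := by
            calc z = z ^ 1 := (pow_one z).symm
              _ ≤ _ := pow_le_pow_right₀ (by linarith) (by norm_num)
          have f4 := h.hlog
          have f5 : 0 ≤ Real.log n := Real.log_nonneg h.regM.one_le_n
          linarith
  have h3 : 1 / (n : ℝ) ≤ (z * (1 + r₀)) ^ 31 / √n := by
    have e1 := h.regM.one_le_pow 31
    have e2 : √(n : ℝ) ≤ n := by
      rw [Real.sqrt_le_left hn.le]
      have := h.regM.one_le_n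
      nlinarith
    gcongr
  have h4 := h.ee_le (show m - 1 < m by omega)
  rw [div_sub_one hKK.ne', abs_div, abs_of_pos hKK, div_le_iff₀ hKK]
  refine h1.trans ?_
  rw [mul_comm]
  refine mul_le_mul_of_nonneg_right ?_ hKK.le
  norm_num at h2 h3 ⊢
  linarith

end Good

namespace Good

variable {n : ℕ}

theorem abs_log_le {x : ℝ} (h : |x - 1| ≤ 1 / 2) : |Real.log x| ≤ 2 * |x - 1| := by
  have h1 := abs_le.1 h
  have hx : 0 < x := by linarith
  have h2 := Real.log_le_sub_one_of_pos hx
  have h3 := Real.one_sub_inv_le_log_of_pos hx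
  have h4 : -(2 * |x - 1|) ≤ 1 - x⁻¹ := by
    have e : 1 - x⁻¹ = (x - 1) / x := by field_simp
    rw [e, le_div_iff₀ hx]
    have := neg_abs_le (x - 1)
    have : |x - 1| * (1 / 2) ≤ |x - 1| * x := by gcongr; linarith
    linarith
  rw [abs_le]
  constructor
  · linarith
  · linarith [le_abs_self (x - 1), abs_nonneg (x - 1)]

theorem KK_eq (g : ℝ) {m : ℕ} (hm : 0 < m) (j : ℕ) :
    KK g m j = g ^ j * √(((j : ℝ) + 1) * (1 + 1 / m) ^ j) := by
  have hm' : (0 : ℝ) < m := by exact_mod_cast hm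
  induction j with
  | zero => simp [KK]
  | succ j ih =>
    rw [KK_succ, ih, kk]
    have : √((((j + 1 : ℕ) : ℝ) + 1) * (1 + 1 / (m : ℝ)) ^ (j + 1))
        = √(((j : ℝ) + 1) * (1 + 1 / m) ^ j) * √((((j : ℝ) + 2) * (m + 1)) / ((j + 1) * m)) := by
      rw [← Real.sqrt_mul (by positivity)]
      congr 1
      have e : (1 : ℝ) + 1 / m = (m + 1) / m := by field_simp
      rw [pow_succ, e]
      push_cast
      generalize (((m : ℝ) + 1) / m) ^ j = y
      field_simp
      ring
    rw [this]; ring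

theorem abs_log_sqrt_pow_sub_le {m : ℕ} (hm : 0 < m) :
    |Real.log (√((1 + 1 / (m : ℝ)) ^ (m - 1))) - 1 / 2| ≤ 1 / m := by
  have hm' : (0 : ℝ) < m := by exact_mod_cast hm
  have hm1 : (1 : ℝ) ≤ m := by exact_mod_cast hm
  have hx : 0 < 1 + 1 / (m : ℝ) := by positivity
  rw [Real.log_sqrt (by positivity), Real.log_pow, Nat.cast_sub hm, Nat.cast_one]
  have h1 := Real.log_le_sub_one_of_pos hx
  have h2 := Real.one_sub_inv_le_log_of_pos hx
  set y := Real.log (1 + 1 / (m : ℝ))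
  have h3 : 1 - (1 + 1 / (m : ℝ))⁻¹ = 1 / (m + 1) := by field_simp; ring
  rw [h3] at h2
  have h4 : ((m : ℝ) - 1) * y ≤ (m - 1) * (1 / m) :=
    mul_le_mul_of_nonneg_left (by linarith) (by linarith)
  have h5 : ((m : ℝ) - 1) * (1 / (m + 1)) ≤ (m - 1) * y :=
    mul_le_mul_of_nonneg_left h2 (by linarith)
  have h6 : ((m : ℝ) - 1) * (1 / m) = 1 - 1 / m := by field_simp
  have h7 : ((m : ℝ) - 1) * (1 / (m + 1)) = 1 - 2 * (1 / (m + 1)) := by field_simp; ring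
  have h8 : 1 / ((m : ℝ) + 1) ≤ 1 / m := by gcongr; linarith
  have h9 : 0 < 1 / (m : ℝ) := by positivity
  rw [abs_le]
  constructor <;> linarith

theorem matCount_div_goodG {m s t : ℕ} (hm : 0 < m) (hs : 0 < s) (hn : 0 < n) (ht : 0 < t)
    (hmt : m * s = n * t) :
    (matCount m s n t : ℝ) / goodG m s n t
      = FF s (m - 1) (fun _ : Fin n => t) * gg (m * n) (m * s) / gg n s ^ m := by
  have hmR : (0 : ℝ) < m := by exact_mod_cast hm
  have hnR : (0 : ℝ) < n := by exact_mod_cast hn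
  have hsR : (0 : ℝ) < s := by exact_mod_cast hs
  have h1 : matCount m s n t = cnt s m (fun _ : Fin n => t) := by
    rw [← card_mats]; rfl
  have hm1 : m - 1 + 1 = m := by omega
  have h2 : (t + (m - 1)).choose (m - 1) = (m + t - 1).choose t := by
    rw [← Nat.choose_symm_add]; congr 1; omega
  have hl : ((m * s : ℕ) : ℝ) / ((m * n : ℕ) : ℝ) = s / n := by push_cast; field_simp
  unfold goodG FF gg
  rw [hm1, h1, hl, mul_comm s m, Finset.prod_const, Finset.card_univ, Fintype.card_fin, h2]
  have c1 : (0 : ℝ) < ((n + s - 1).choose s : ℝ) := by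
    exact_mod_cast Nat.choose_pos (by omega)
  have c2 : (0 : ℝ) < ((m + t - 1).choose t : ℝ) := by
    exact_mod_cast Nat.choose_pos (by omega)
  have c3 : (0 : ℝ) < ((m * n + m * s - 1).choose (m * s) : ℝ) := by
    have : 1 ≤ m * n := Nat.mul_pos hm hn
    exact_mod_cast Nat.choose_pos (by omega)
  have c4 : 0 < (s : ℝ) / n := by positivity
  generalize (s : ℝ) / n = l at *
  have e1 : l ^ (m * s) = (l ^ s) ^ m := by rw [← pow_mul, mul_comm]
  have e2 : (1 + l) ^ (m * n + m * s) = ((1 + l) ^ (n + s)) ^ m := by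
    rw [← pow_mul]; congr 1; ring
  rw [e1, e2, div_pow, mul_pow]
  have c5 : 0 < (l ^ s) ^ m := by positivity
  have c6 : 0 < ((1 + l) ^ (n + s)) ^ m := by positivity
  field_simp

namespace Par

variable {m s r₀ K : ℕ} {z : ℝ}

theorem reg_mul (h : Par n m s r₀ K z) :
    Reg (z * (1 + r₀)) (m * n) (((m * s : ℕ) : ℝ) / ((m * n : ℕ) : ℝ)) := by
  have hmR : (1 : ℝ) ≤ m := by exact_mod_cast h.hm0
  have hnR := h.regM.n_pos
  have hl : ((m * s : ℕ) : ℝ) / ((m * n : ℕ) : ℝ) = s / n := by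
    push_cast; field_simp
  rw [hl]
  refine ⟨h.regM.hL, h.regM.hl, ?_, ?_⟩
  · refine h.regM.hn.trans ?_
    push_cast
    exact le_mul_of_one_le_left hnR.le hmR
  · push_cast
    rw [Real.log_mul (by positivity) hnR.ne']
    have h1 := h.log_le
    have h2 := h.hlog
    have h3 : 0 ≤ Real.log n := Real.log_nonneg h.regM.one_le_n
    have h4 : z * z ^ 28 ≤ z * (1 + r₀) := by
      have := h.z_pos
      gcongr; linarith [h.hr]
    have hz := h.hz
    have h5 : 10 ^ 12 * z ≤ z * z ^ 28 := by
      calc _ = (10 ^ 6) ^ 2 * z := by norm_num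
        _ ≤ z ^ 28 * z := by
          gcongr
          calc ((10 : ℝ) ^ 6) ^ 2 ≤ z ^ 2 := by gcongr
            _ ≤ _ := pow_le_pow_right₀ (by linarith) (by norm_num)
        _ = _ := mul_comm _ _
    linarith

theorem abs_log_gg_le (h : Par n m s r₀ K z) :
    |Real.log (√m * gg (m * n) (m * s) / gg n s)| ≤ (z * (1 + r₀)) ^ 12 / √n := by
  have h1 := h.regM.abs_gg_sub_le
  have h2 := h.reg_mul.abs_gg_sub_le
  have hg1 := h.regM.gg_pos
  have hg2 := h.reg_mul.gg_pos
  have hmR : (1 : ℝ) ≤ m := by exact_mod_cast h.hm0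
  have hn := h.regM.n_pos
  have hM := h.regM.hL
  have hM0 := h.regM.L_pos
  have ha := h.regM.a_pos
  have hl : ((m * s : ℕ) : ℝ) / ((m * n : ℕ) : ℝ) = s / n := by
    push_cast; field_simp
  have hp := h.regM.pow_le_sqrt (p := 13) (by norm_num)
  have hq := h.regM.mul_pow_le (p := 10) (C := 12) (by norm_num)
  rw [hl] at h2
  have hmn : ((m * n : ℕ) : ℝ) * ((s : ℝ) / n * (1 + (s : ℝ) / n))
      = m * (n * ((s : ℝ) / n * (1 + (s : ℝ) / n))) := by push_cast; ring
  rw [hmn] at h2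
  set M := z * (1 + (r₀ : ℝ))
  set a := n * ((s : ℝ) / n * (1 + (s : ℝ) / n))
  set g := gg n s
  set G := gg (m * n) (m * s)
  have hπ : √(2 * π) ≤ 3 := by
    rw [Real.sqrt_le_left (by norm_num)]; linarith [Real.pi_lt_four]
  have hπ0 : 0 < √(2 * π) := by positivity
  have ha0 : 0 < √a := by positivity
  have hm0 : 0 < √(m : ℝ) := by positivity
  set δ := M ^ 10 / √n with hδ
  have hx : |√(2 * π) * √a * g - 1| ≤ 3 * δ := by
    have e : √(2 * π) * √a * g - 1 = √(2 * π) * √a * (g - 1 / √(2 * π * a)) := by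
      rw [Real.sqrt_mul (x := 2 * π) (by positivity) a]; field_simp
    rw [e, abs_mul, abs_of_pos (by positivity)]
    calc _ ≤ √(2 * π) * √a * (δ / √a) := by gcongr
      _ = √(2 * π) * δ := by field_simp
      _ ≤ _ := by gcongr
  have hy : |√(2 * π) * √a * √m * G - 1| ≤ 3 * δ := by
    have e : √(2 * π) * √a * √m * G - 1
        = √(2 * π) * √a * √m * (G - 1 / √(2 * π * (m * a))) := by
      rw [Real.sqrt_mul (x := 2 * π) (by positivity) (m * a), Real.sqrt_mul (x := m) (by positivity) a]
      field_simp
    rw [e, abs_mul, abs_of_pos (by positivity)]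
    have hδ' : M ^ 10 / √((m * n : ℕ) : ℝ) ≤ δ := by
      rw [hδ]
      gcongr
      exact Nat.le_mul_of_pos_left n h.hm0
    calc _ ≤ √(2 * π) * √a * √m * (M ^ 10 / √((m * n : ℕ) : ℝ) / √(m * a)) := by gcongr
      _ = √(2 * π) * (M ^ 10 / √((m * n : ℕ) : ℝ)) := by
        rw [Real.sqrt_mul (x := m) (by positivity) a]; field_simp
      _ ≤ _ := by gcongr
  have hδ2 : 3 * δ ≤ 1 / 2 := by
    have : 6 * M ^ 10 ≤ √n := by
      have : 6 * M ^ 10 ≤ M ^ 11 := h.regM.mul_pow_le (by norm_num)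
      exact this.trans ((h.regM.pow_le_pow (by norm_num)).trans hp)
    rw [hδ, ← mul_div_assoc, div_le_iff₀ (by positivity)]
    linarith
  have e : Real.log (√m * G / g)
      = Real.log (√(2 * π) * √a * √m * G) - Real.log (√(2 * π) * √a * g) := by
    rw [← Real.log_div (by positivity) (by positivity)]
    congr 1; field_simp
  rw [e]
  calc _ ≤ |Real.log (√(2 * π) * √a * √m * G)| + |Real.log (√(2 * π) * √a * g)| := abs_sub _ _
    _ ≤ 2 * (3 * δ) + 2 * (3 * δ) := by
      gcongr
      · exact (abs_log_le (hy.trans hδ2)).trans (by gcongr)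
      · exact (abs_log_le (hx.trans hδ2)).trans (by gcongr)
    _ = 12 * M ^ 10 / √n := by rw [hδ]; ring
    _ ≤ M ^ 12 / √n := by
      gcongr
      exact hq.trans (h.regM.pow_le_pow (by norm_num))

/-- Explicit version of the main estimate. -/
theorem abs_log_ratio_sub_le {t : ℕ} (h : Par n m s r₀ K z) (hs : 0 < s) (ht : 0 < t)
    (hmt : m * s = n * t) (hnm : (n : ℝ) ≤ z * m) :
    |Real.log ((matCount m s n t : ℝ) / goodG m s n t) - 1 / 2|
      ≤ (z * (1 + r₀)) ^ 32 / √n := by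
  have hm0 := h.hm0
  have hn := h.regM.n_pos
  have hmR : (0 : ℝ) < m := by exact_mod_cast hm0
  have hg := h.regM.gg_pos
  have hg2 := h.reg_mul.gg_pos
  have hKK := h.KK_pos (m - 1)
  have hM := h.regM.hL
  have hM0 := h.regM.L_pos
  have h1 := h.abs_FF_const_le hmt
  have h2 := h.abs_log_gg_le
  have h3 := abs_log_sqrt_pow_sub_le hm0
  have h5 : 1 / (m : ℝ) ≤ (z * (1 + r₀)) ^ 12 / √n := by
    have e1 : z ≤ z * (1 + r₀) := h.le_max
    have e2 : z * (1 + r₀) ≤ (z * (1 + r₀)) ^ 12 := by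
      have := h.regM.pow_le_pow (p := 1) (q := 12) (by norm_num)
      rwa [pow_one] at this
    have e3 : √(n : ℝ) ≤ n := by
      rw [Real.sqrt_le_left hn.le]
      have := h.regM.one_le_n
      nlinarith
    rw [div_le_div_iff₀ hmR (by positivity), one_mul]
    calc √(n : ℝ) ≤ z * m := e3.trans hnm
      _ ≤ _ := by gcongr; exact e1.trans e2
  set M := z * (1 + (r₀ : ℝ))
  have hb : 2 * (M ^ 31 / √n) ≤ 1 / 2 := by
    have e1 : 4 * M ^ 31 ≤ M ^ 32 := h.regM.mul_pow_le (by norm_num)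
    have e2 : M ^ 32 ≤ √(n : ℝ) := h.regM.pow_le_sqrt (by norm_num)
    rw [← mul_div_assoc, div_le_iff₀ (by positivity)]
    linarith
  have h4 := abs_log_le (h1.trans hb)
  have hF : 0 < FF s (m - 1) (fun _ : Fin n => t) / KK (gg n s) m (m - 1) := by
    have := (abs_le.1 (h1.trans hb)).1
    linarith
  have hFF : 0 < FF s (m - 1) (fun _ : Fin n => t) := by
    have := mul_pos hF hKK
    rwa [div_mul_cancel₀ _ hKK.ne'] at this
  have hK := KK_eq (gg n s) hm0 (m - 1)
  have hm1 : ((m - 1 : ℕ) : ℝ) + 1 = m := by rw [Nat.cast_sub hm0]; push_cast; ring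
  rw [hm1, Real.sqrt_mul hmR.le] at hK
  have hP : 0 < √((1 + 1 / (m : ℝ)) ^ (m - 1)) := by positivity
  have e : Real.log ((matCount m s n t : ℝ) / goodG m s n t)
      = Real.log (FF s (m - 1) (fun _ : Fin n => t) / KK (gg n s) m (m - 1))
        + Real.log (√m * gg (m * n) (m * s) / gg n s)
        + Real.log (√((1 + 1 / (m : ℝ)) ^ (m - 1))) := by
    rw [matCount_div_goodG hm0 hs (by exact_mod_cast hn) ht hmt, ← Real.log_mul hF.ne' (by positivity),
      ← Real.log_mul (by positivity) hP.ne', hK]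
    congr 1
    have : gg n s ^ m = gg n s ^ (m - 1) * gg n s := by
      rw [← pow_succ]; congr 1; omega
    rw [this]
    field_simp
  rw [e]
  have hq : 6 * M ^ 31 ≤ M ^ 32 := h.regM.mul_pow_le (by norm_num)
  have hr : M ^ 12 ≤ M ^ 31 := h.regM.pow_le_pow (by norm_num)
  calc _ = |Real.log (FF s (m - 1) (fun _ : Fin n => t) / KK (gg n s) m (m - 1))
        + Real.log (√m * gg (m * n) (m * s) / gg n s)
        + (Real.log (√((1 + 1 / (m : ℝ)) ^ (m - 1))) - 1 / 2)| := by congr 1; ring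
    _ ≤ |Real.log (FF s (m - 1) (fun _ : Fin n => t) / KK (gg n s) m (m - 1))|
        + |Real.log (√m * gg (m * n) (m * s) / gg n s)|
        + |Real.log (√((1 + 1 / (m : ℝ)) ^ (m - 1))) - 1 / 2| := by
      refine (abs_add_le _ _).trans ?_
      gcongr
      exact abs_add_le _ _
    _ ≤ 2 * (2 * (M ^ 31 / √n)) + M ^ 12 / √n + M ^ 12 / √n := by
      gcongr
      · exact h4.trans (by gcongr)
      · exact h3.trans h5
    _ ≤ 2 * (2 * (M ^ 31 / √n)) + M ^ 31 / √n + M ^ 31 / √n := by gcongr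
    _ = 6 * M ^ 31 / √n := by ring
    _ ≤ _ := by gcongr

end Par

end Good

namespace Good

theorem eventually_mul_log_add_le (C : ℝ) {e : ℝ} (he : 0 < e) :
    ∀ᶠ n : ℕ in Filter.atTop, C * Real.log n + C ≤ (n : ℝ) ^ e := by
  have h1 : (fun x : ℝ => C * Real.log x + C) =o[Filter.atTop] fun x : ℝ => x ^ e := by
    refine ((isLittleO_log_rpow_atTop he).const_mul_left C).add ?_
    exact Asymptotics.isLittleO_const_left.2
      (Or.inr (Filter.tendsto_abs_atTop_atTop.comp (tendsto_rpow_atTop he)))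
  have h2 := tendsto_natCast_atTop_atTop.eventually (h1.bound one_pos)
  filter_upwards [h2] with n hn
  rw [one_mul, Real.norm_eq_abs, Real.norm_of_nonneg (Real.rpow_nonneg n.cast_nonneg e)] at hn
  exact (le_abs_self _).trans hn

theorem density_factor_bounds {l p q A : ℝ} (hl : 0 < l) (hp : 0 ≤ p) (hq : 0 ≤ q)
    (h : (1 + 2 * l) ^ 2 / (4 * l * (1 + l)) * (1 + p + q) ≤ A) :
    1 ≤ 4 * l * A ∧ p ≤ A ∧ q ≤ A := by
  set X := (1 + 2 * l) ^ 2 / (4 * l * (1 + l)) with hX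
  have h1 : 1 ≤ X := by
    rw [hX, one_le_div (by positivity)]
    nlinarith
  have h2 : 1 ≤ 4 * l * X := by
    rw [hX, show 4 * l * ((1 + 2 * l) ^ 2 / (4 * l * (1 + l))) = (1 + 2 * l) ^ 2 / (1 + l) by
      field_simp, one_le_div (by positivity)]
    nlinarith
  have h3 : 1 + p + q ≤ A :=
    (le_mul_of_one_le_left (by positivity) h1).trans h
  have h4 : X ≤ A := (le_mul_of_one_le_right (by linarith) (by linarith)).trans h
  refine ⟨h2.trans (by gcongr), by linarith, by linarith⟩

/-- `Par` holds for `z = n ^ ε` when `n` is large. -/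
theorem par_of_large {a e C : ℝ} {m n s K : ℕ} (ha : 0 < a) (he : 0 < e)
    (he' : 3000 * e ≤ 1) (hK : 1 ≤ K) (hKe : 2 ≤ K * e)
    (hC1 : 2 * 10 ^ 7 ≤ C) (hC2 : 4 * ((K : ℝ) + 1) ≤ C) (hC3 : 8 * K * a ≤ C)
    (hm : 0 < m) (hs : 0 < s) (hn : 0 < n)
    (hy : C * Real.log n + C ≤ (n : ℝ) ^ (e / 2))
    (h : (1 + 2 * ((s : ℝ) / n)) ^ 2 / (4 * ((s : ℝ) / n) * (1 + (s : ℝ) / n))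
          * (1 + 5 * (m : ℝ) / (6 * n) + 5 * (n : ℝ) / (6 * m)) ≤ a * Real.log n) :
    Par n m s ⌈((n : ℝ) ^ e) ^ 28⌉₊ K ((n : ℝ) ^ e) ∧ (n : ℝ) ≤ (n : ℝ) ^ e * m ∧
      ((n : ℝ) ^ e) * (1 + (⌈((n : ℝ) ^ e) ^ 28⌉₊ : ℝ)) ≤ ((n : ℝ) ^ e) ^ 30 := by
  have hmR : (0 : ℝ) < m := by exact_mod_cast hm
  have hsR : (0 : ℝ) < s := by exact_mod_cast hs
  have hnR : (0 : ℝ) < n := by exact_mod_cast hn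
  have hn1 : (1 : ℝ) ≤ n := by exact_mod_cast hn
  have hK1 : (1 : ℝ) ≤ K := by exact_mod_cast hK
  have hlog : 0 ≤ Real.log n := Real.log_nonneg hn1
  obtain ⟨d1, d2, d3⟩ := density_factor_bounds (by positivity) (by positivity) (by positivity) h
  set z := (n : ℝ) ^ e with hz
  set y := (n : ℝ) ^ (e / 2) with hyd
  have hzy : z = y * y := by rw [hz, hyd, ← Real.rpow_add hnR]; congr 1; ring
  have hy0 : 0 < y := by positivity
  have key : ∀ c, c ≤ C → c * Real.log n ≤ y ∧ c ≤ y := fun c hc => by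
    have h1 := mul_le_mul_of_nonneg_right hc hlog
    have h2 : 0 ≤ C * Real.log n := mul_nonneg (by linarith) hlog
    constructor <;> linarith
  have hy7 : 2 * 10 ^ 7 ≤ y := (key _ hC1).2
  have hzy2 : 2 * y ≤ z := by rw [hzy]; exact mul_le_mul_of_nonneg_right (by linarith) hy0.le
  have hz1 : (10 : ℝ) ^ 6 ≤ z := by linarith
  have hz0 : 0 < z := by linarith
  have ha8 : 8 * a ≤ 8 * K * a := by nlinarith
  have hA : 8 * (a * Real.log n) ≤ y := by
    have := (key (8 * a) (ha8.trans hC3)).1; linarith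
  have hM : z * (1 + (⌈z ^ 28⌉₊ : ℝ)) ≤ z ^ 30 := by
    have h1 : (⌈z ^ 28⌉₊ : ℝ) ≤ z ^ 28 + 1 := (Nat.ceil_lt_add_one (by positivity)).le
    have h2 : (1 : ℝ) ≤ z ^ 28 := one_le_pow₀ (by linarith)
    calc z * (1 + (⌈z ^ 28⌉₊ : ℝ)) ≤ z * (10 ^ 6 * z ^ 28) := by
          apply mul_le_mul_of_nonneg_left _ hz0.le; linarith
      _ ≤ z * (z * z ^ 28) := by gcongr
      _ = z ^ 30 := by ring
  refine ⟨⟨hz1, ?_, hK, ?_, ?_, ?_, hm, ?_, Nat.le_ceil _⟩, ?_, hM⟩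
  · exact (key _ hC1).1.trans (by linarith)
  · have h1 := (key _ hC3).1
    calc (2 : ℝ) * K ≤ 2 * K * (4 * ((s : ℝ) / n) * (a * Real.log n)) :=
          le_mul_of_one_le_right (by positivity) d1
      _ = 8 * K * a * Real.log n * ((s : ℝ) / n) := by ring
      _ ≤ z * ((s : ℝ) / n) := by
          apply mul_le_mul_of_nonneg_right _ (by positivity); linarith
  · have h1 := (key _ hC2).2
    have h2 : y ≤ z / (4 * (K + 1)) := by
      rw [le_div_iff₀ (by positivity), hzy]; gcongr
    calc (n : ℝ) = (n : ℝ) ^ (1 : ℝ) := (Real.rpow_one _).symm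
      _ ≤ (n : ℝ) ^ (e / 2 * K) := Real.rpow_le_rpow_of_exponent_le hn1 (by linarith)
      _ = y ^ K := by rw [Real.rpow_mul hnR.le, Real.rpow_natCast]
      _ ≤ _ := by gcongr
  · calc (z * (1 + (⌈z ^ 28⌉₊ : ℝ))) ^ 100 ≤ (z ^ 30) ^ 100 := by gcongr
      _ = (n : ℝ) ^ (e * (3000 : ℕ)) := by
          rw [Real.rpow_mul hnR.le, Real.rpow_natCast, ← pow_mul]
      _ ≤ (n : ℝ) ^ (1 : ℝ) :=
          Real.rpow_le_rpow_of_exponent_le hn1 (by push_cast; linarith)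
      _ = n := Real.rpow_one _
  · rw [div_le_iff₀ (by positivity)] at d2
    have h1 : (y + y) * n ≤ z * n := by gcongr; linarith
    have h2 : 8 * (a * Real.log n) * n ≤ y * n := by gcongr
    have h3 : 1 * 1 ≤ y * n := by gcongr; linarith
    linarith
  · rw [div_le_iff₀ (by positivity)] at d3
    have h1 : y * m ≤ z * m := by gcongr; linarith
    have h2 : 8 * (a * Real.log n) * m ≤ y * m := by gcongr
    linarith

end Good

/-- Theorem 1 of the paper, in the form (1.2): for constants `a, b > 0` with
`a + b < 1/2`, uniformly over `m, s, n, t` with `ms = nt` and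
`((1+2λ)²/(4λ(1+λ)))(1 + 5m/(6n) + 5n/(6m)) ≤ a log n` (`λ = s/n = t/m`),
`M(m,s;n,t) = G(m,s;n,t) exp(1/2 + O(n^{−b}))`. -/
theorem stmt_0 (a b : ℝ) (ha : 0 < a) (hb : 0 < b) (hab : a + b < 1 / 2) :
    ∃ C : ℝ, 0 < C ∧ ∃ N₀ : ℕ, ∀ m s n t : ℕ,
      0 < m → 0 < s → 0 < n → 0 < t → N₀ ≤ m → N₀ ≤ n → m * s = n * t →
      (1 + 2 * ((s : ℝ) / n)) ^ 2 / (4 * ((s : ℝ) / n) * (1 + (s : ℝ) / n))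
          * (1 + 5 * (m : ℝ) / (6 * n) + 5 * (n : ℝ) / (6 * m)) ≤ a * Real.log n →
      |Real.log ((matCount m s n t : ℝ) / goodG m s n t) - 1 / 2|
        ≤ C * (n : ℝ) ^ (-b) := by
  obtain ⟨e, he, he1, he2⟩ : ∃ e : ℝ, 0 < e ∧ 3000 * e ≤ 1 ∧ 960 * e ≤ 1 / 2 - b := by
    refine ⟨min (1 / 3000) ((1 / 2 - b) / 960), lt_min (by norm_num) (by linarith), ?_, ?_⟩
    · linarith [min_le_left (1 / 3000 : ℝ) ((1 / 2 - b) / 960)]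
    · linarith [min_le_right (1 / 3000 : ℝ) ((1 / 2 - b) / 960)]
  obtain ⟨K, hK⟩ := exists_nat_ge (2 / e)
  have hKe : 2 ≤ K * e := (div_le_iff₀ he).1 hK
  have hK1 : 1 ≤ K := by
    rw [Nat.one_le_iff_ne_zero]
    rintro rfl
    norm_num at hKe
  have hKa : 0 ≤ 8 * (K : ℝ) * a := by positivity
  have hK0 : (0 : ℝ) ≤ K := K.cast_nonneg
  obtain ⟨N₀, hN₀⟩ := Filter.eventually_atTop.1 (Good.eventually_mul_log_add_le
    (2 * 10 ^ 7 + 4 * ((K : ℝ) + 1) + 8 * K * a) (half_pos he))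
  refine ⟨1, one_pos, N₀, fun m s n t hm hs hn ht _ hNn hmt h => ?_⟩
  obtain ⟨hpar, hnm, hM⟩ := Good.par_of_large ha he he1 hK1 hKe (by linarith) (by linarith)
    (by linarith) hm hs hn (hN₀ n hNn) h
  have hnR : (0 : ℝ) < n := by exact_mod_cast hn
  have hn1 : (1 : ℝ) ≤ n := by exact_mod_cast hn
  refine (hpar.abs_log_ratio_sub_le hs ht hmt hnm).trans ?_
  rw [one_mul, div_le_iff₀ (by positivity), Real.sqrt_eq_rpow, ← Real.rpow_add hnR]
  calc _ ≤ (((n : ℝ) ^ e) ^ 30) ^ 32 := by gcongr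
    _ = (n : ℝ) ^ (e * (960 : ℕ)) := by
        rw [Real.rpow_mul hnR.le, Real.rpow_natCast, ← pow_mul]
    _ ≤ _ := Real.rpow_le_rpow_of_exponent_le hn1 (by push_cast; linarith)
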